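/- Let S₁, S₂, S₃ ⊆ ℝ³ and suppose S₂ is nonempty and connected. If S₁ ⊴ S₂ and S₂ ⊴ S₃, then S₁ ⊴ S₃. (Theorem: transitivity of the relation ⊴ on connected slices.) -/

import Mathlib

noncomputable section

/-- ℝ⁴ with coordinates (x₁, x₂, y₁, y₂). -/
abbrev R4 := ℝ × ℝ × ℝ × ℝ
/-- ℝ² with coordinates (x₁, y₁). -/
abbrev R2 := ℝ × ℝ
/-- ℝ³ with coordinates (x₁, x₂, y₁). -/
abbrev R3 := ℝ × ℝ × ℝ

/-- The standard symplectic form ω(u,v) = u₁v₃ − u₃v₁ + u₂v₄ − u₄v₂ on ℝ⁴. -/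
def omega4 (u v : R4) : ℝ :=
  u.1 * v.2.2.1 - u.2.2.1 * v.1 + u.2.1 * v.2.2.2 - u.2.2.2 * v.2.1

/-- A symplectomorphism of ℝ⁴. -/
def IsSymplectomorphism (ψ : R4 → R4) : Prop :=
  Function.Bijective ψ ∧ ContDiff ℝ (⊤ : ℕ∞) ψ ∧ ContDiff ℝ (⊤ : ℕ∞) (Function.invFun ψ) ∧
  ∀ p u v : R4, omega4 (fderiv ℝ ψ p u) (fderiv ℝ ψ p v) = omega4 u v

/-- The Hamiltonian vector field of H : ℝ⁴ → ℝ, coordinates (x₁, x₂, y₁, y₂). -/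
def HamVF (H : R4 → ℝ) (p : R4) : R4 :=
  (fderiv ℝ H p (0, 0, 1, 0), fderiv ℝ H p (0, 0, 0, 1),
   -fderiv ℝ H p (1, 0, 0, 0), -fderiv ℝ H p (0, 1, 0, 0))

/-- A global Hamiltonian flow of H on ℝ⁴. -/
def IsHamFlow (H : R4 → ℝ) (Φ : ℝ × R4 → R4) : Prop :=
  ContDiff ℝ (⊤ : ℕ∞) Φ ∧ (∀ p, Φ (0, p) = p) ∧
  ∀ (t : ℝ) (p : R4), HasDerivAt (fun s => Φ (s, p)) (HamVF H (Φ (t, p))) t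

/-- A parametrization of a flat-at-infinity planar Lagrangian. -/
def IsFlatParam (f : R2 → R4) : Prop :=
  ContDiff ℝ (⊤ : ℕ∞) f ∧ Function.Injective f ∧ IsProperMap f ∧
  (∀ p : R2, Function.Injective (fderiv ℝ f p)) ∧
  (∀ (p : R2) (u v : R2), omega4 (fderiv ℝ f p u) (fderiv ℝ f p v) = 0) ∧
  ∃ K : Set R2, IsCompact K ∧ ∀ p : R2, p ∉ K → f p = (p.1, p.2, 0, 0)

/-- A flat-at-infinity planar Lagrangian. -/
def IsFlatLagrangian (L : Set R4) : Prop :=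
  ∃ f : R2 → R4, IsFlatParam f ∧ Set.range f = L

/-- `L` is transverse to the hyperplane {y₂ = a}. -/
def TransverseAt (L : Set R4) (a : ℝ) : Prop :=
  ∃ f : R2 → R4, IsFlatParam f ∧ Set.range f = L ∧
    ∀ p : R2, (f p).2.2.2 = a → fderiv ℝ (fun q => (f q).2.2.2) p ≠ 0

/-- An area-preserving diffeomorphism of ℝ². -/
def IsAreaDiffeo (φ : R2 → R2) : Prop :=
  Function.Bijective φ ∧ ContDiff ℝ (⊤ : ℕ∞) φ ∧ ContDiff ℝ (⊤ : ℕ∞) (Function.invFun φ) ∧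
  ∀ p : R2, LinearMap.det ((fderiv ℝ φ p) : R2 →ₗ[ℝ] R2) = 1

/-- φ equals the identity outside a compact set. -/
def IsCompactSupported (φ : R2 → R2) : Prop :=
  ∃ K : Set R2, IsCompact K ∧ ∀ p : R2, p ∉ K → φ p = p

/-- φ × id : ℝ³ → ℝ³. -/
def phiTimesId (φ : R2 → R2) (p : R3) : R3 :=
  ((φ (p.1, p.2.2)).1, p.2.1, (φ (p.1, p.2.2)).2)

/-- The inclusion i_a : ℝ³ → ℝ⁴. -/
def iMap (a : ℝ) (p : R3) : R4 := (p.1, p.2.1, p.2.2, a)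

/-- S ◁ S' : strict Lagrange cobordism relation. -/
def SliceRelStrict (S S' : Set R3) : Prop :=
  ∃ (L : Set R4) (a b : ℝ), a < b ∧ b < 0 ∧ IsFlatLagrangian L ∧
    TransverseAt L a ∧ TransverseAt L b ∧
    L ∩ {p : R4 | p.2.2.2 = a} = iMap a '' S ∧
    L ∩ {p : R4 | p.2.2.2 = b} = iMap b '' S'

/-- S ⊴ S' : non-strict Lagrange cobordism relation. -/
def SliceRel (S S' : Set R3) : Prop :=
  ∃ (L : Set R4) (a b : ℝ), a ≤ b ∧ b < 0 ∧ IsFlatLagrangian L ∧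
    TransverseAt L a ∧ TransverseAt L b ∧
    L ∩ {p : R4 | p.2.2.2 = a} = iMap a '' S ∧
    L ∩ {p : R4 | p.2.2.2 = b} = iMap b '' S'

/-- S ∼ S' : equivalence of slices. -/
def SliceEquiv (S S' : Set R3) : Prop :=
  ∃ φ : R2 → R2, IsAreaDiffeo φ ∧ IsCompactSupported φ ∧ phiTimesId φ '' S = S'

/-- A negative slice. -/
def IsNegativeSlice (S : Set R3) : Prop :=
  ∃ (L : Set R4) (a : ℝ), a < 0 ∧ IsFlatLagrangian L ∧ TransverseAt L a ∧
    L ∩ {p : R4 | p.2.2.2 = a} = iMap a '' S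
/-- Time-dependent Hamiltonian vector field on ℝ⁴. -/
def HamVF4t (H : ℝ × R4 → ℝ) (t : ℝ) (p : R4) : R4 :=
  (fderiv ℝ (fun q => H (t, q)) p (0, 0, 1, 0),
   fderiv ℝ (fun q => H (t, q)) p (0, 0, 0, 1),
   -fderiv ℝ (fun q => H (t, q)) p (1, 0, 0, 0),
   -fderiv ℝ (fun q => H (t, q)) p (0, 1, 0, 0))

/-- A global Hamiltonian flow of a time-dependent Hamiltonian on ℝ⁴. -/
def IsHamFlow4t (H : ℝ × R4 → ℝ) (Φ : ℝ × R4 → R4) : Prop :=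
  ContDiff ℝ (⊤ : ℕ∞) Φ ∧ (∀ p, Φ (0, p) = p) ∧
  ∀ (t : ℝ) (p : R4), HasDerivAt (fun s => Φ (s, p)) (HamVF4t H t (Φ (t, p))) t

/-- Time-dependent Hamiltonian vector field on ℝ², coordinates (x₁, y₁). -/
def HamVF2t (H : ℝ × R2 → ℝ) (t : ℝ) (q : R2) : R2 :=
  (fderiv ℝ (fun r => H (t, r)) q (0, 1), -fderiv ℝ (fun r => H (t, r)) q (1, 0))

/-- A global Hamiltonian flow of a time-dependent Hamiltonian on ℝ². -/
def IsHamFlow2t (H : ℝ × R2 → ℝ) (φ : ℝ × R2 → R2) : Prop :=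
  ContDiff ℝ (⊤ : ℕ∞) φ ∧ (∀ q, φ (0, q) = q) ∧
  ∀ (t : ℝ) (q : R2), HasDerivAt (fun s => φ (s, q)) (HamVF2t H t (φ (t, q))) t

/-- Translation of ℝ⁴ by s in the x₁-direction. -/
def trX1 (s : ℝ) (p : R4) : R4 := (p.1 + s, p.2.1, p.2.2.1, p.2.2.2)

/-- Φ_φ : ℝ⁴ → ℝ⁴ induced by an area-preserving diffeomorphism φ of the x₁y₁-plane. -/
def PhiPhi (φ : R2 → R2) (p : R4) : R4 :=
  ((φ (p.1, p.2.2.1)).1, p.2.1, (φ (p.1, p.2.2.1)).2, p.2.2.2)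

set_option linter.all false
open Set Filter Topology MeasureTheory
open scoped ContDiff
local notation "RR" => ℝ
local notation "CDi" => ContDiff ℝ ∞
local notation "fD" => fderiv ℝ
local notation "P2" => ℝ × ℝ
local notation "PI" => Real.pi

theorem contDiff_paramInt {P F : Type} [NormedAddCommGroup P] [NormedSpace RR P]
    [NormedAddCommGroup F] [NormedSpace RR F] [CompleteSpace F] (φ : P × RR → F)
    (hφ : CDi φ) : CDi (fun p => ∫ θ in (0:RR)..1, φ (p, θ)) := by
  obtain ⟨b, hb1, -⟩ : ∃ b : ContDiffBump (0:RR), b.rIn = 2 ∧ b.rOut = 3 :=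
    ⟨⟨2, 3, by norm_num, by norm_num⟩, rfl, rfl⟩
  let g : P → RR → F := fun p y => b y • φ (p, -y)
  have hg : CDi (↿g) := by
    have h1 : CDi (fun x : P × RR => b x.2) := b.contDiff.comp contDiff_snd
    have h2 : CDi (fun x : P × RR => φ (x.1, -x.2)) := by fun_prop
    exact h1.smul h2
  let f : RR → RR := Set.indicator (Icc 0 1) (fun _ => 1)
  have hf : LocallyIntegrable f volume := by
    apply Integrable.locallyIntegrable
    rw [integrable_indicator_iff measurableSet_Icc]
    exact integrableOn_const (by simp)
  have := contDiffOn_convolution_right_with_param (μ := volume) (n := ⊤) (f := f)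
    (ContinuousLinearMap.lsmul RR RR) (g := g) (s := univ) (k := Metric.closedBall 0 b.rOut)
    isOpen_univ (isCompact_closedBall _ _) (by
      intro p x _ hx
      have : b x = 0 := by
        apply b.zero_of_le_dist
        simp only [Metric.mem_closedBall, not_le] at hx
        exact hx.le
      simp [g, this]) hf hg.contDiffOn
  rw [univ_prod_univ, contDiffOn_univ] at this
  have h3 : CDi (fun p : P => (p, (0:RR))) := by fun_prop
  have h4 := this.comp h3
  convert h4 using 1
  ext p
  simp only [Function.comp, convolution]
  rw [intervalIntegral.integral_of_le zero_le_one, ← integral_Icc_eq_integral_Ioc,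
    ← integral_indicator measurableSet_Icc]
  congr 1
  ext θ
  by_cases h : θ ∈ Icc (0:RR) 1
  · have hb : b (-θ) = 1 := by
      apply b.one_of_mem_closedBall
      rw [hb1, Metric.mem_closedBall, dist_zero_right, norm_neg, Real.norm_eq_abs, abs_le]
      constructor <;> linarith [h.1, h.2]
    simp [f, h, g, hb]
  · simp [f, h]

theorem hadamard {F : Type} [NormedAddCommGroup F] [NormedSpace RR F] [CompleteSpace F]
    (k : RR → F) (hk : CDi k) : ∃ q : P2 → F, CDi q ∧
      (∀ s h, k (s + h) - k s = h • q (s, h)) ∧ ∀ s, q (s, 0) = deriv k s := by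
  have hd : CDi (deriv k) := by
    have := hk.iterate_deriv 1
    simpa using this
  refine ⟨fun p => ∫ θ in (0:RR)..1, deriv k (p.1 + θ * p.2), ?_, ?_, ?_⟩
  · apply contDiff_paramInt (fun x : (P2) × RR => deriv k (x.1.1 + x.2 * x.1.2))
    fun_prop
  · intro s h
    have h1 : ∀ θ : RR, HasDerivAt (fun θ : RR => k (s + θ * h)) (h • deriv k (s + θ * h)) θ := by
      intro θ
      have a1 : HasDerivAt k (deriv k (s + θ * h)) (s + θ * h) :=
        (hk.differentiable (by simp)).differentiableAt.hasDerivAt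
      have a2 : HasDerivAt (fun θ : RR => s + θ * h) h θ := by
        simpa using ((hasDerivAt_id θ).mul_const h).const_add s
      exact a1.scomp θ a2
    have h2 := intervalIntegral.integral_eq_sub_of_hasDerivAt (a := 0) (b := 1)
      (fun θ _ => h1 θ) (by
        apply Continuous.intervalIntegrable
        have := hd.continuous
        fun_prop)
    simp only [one_mul, zero_mul, add_zero] at h2
    rw [← h2, intervalIntegral.integral_smul]
  · intro s; simp

theorem ift {E F : Type} [NormedAddCommGroup E] [NormedSpace RR E] [CompleteSpace E]
    [NormedAddCommGroup F] [NormedSpace RR F] [CompleteSpace F] (f : E → F) (p : E)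
    (hf : ∀ᶠ x in 𝓝 p, ContDiffAt RR ∞ f x) (f' : E ≃L[RR] F) (hi : HasFDerivAt f (f' : E →L[RR] F) p) :
    ∃ Θ : OpenPartialHomeomorph E F, p ∈ Θ.source ∧ (∀ x, Θ x = f x) ∧ ContDiffOn RR ∞ Θ Θ.source ∧
      ContDiffOn RR ∞ Θ.symm Θ.target := by
  have hp := hf.self_of_nhds
  let Θ0 := hp.toOpenPartialHomeomorph f hi (by simp)
  have h1 : ∀ᶠ x in 𝓝 p, fD f x ∈ range ((↑) : (E ≃L[RR] F) → (E →L[RR] F)) := by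
    have hc : ContinuousAt (fD f) p := by
      have := hp.fderiv_right (m := 0) (by simp)
      exact this.continuousAt
    apply hc
    rw [hi.fderiv]
    exact f'.nhds
  obtain ⟨s, hs, hso, hps⟩ := eventually_nhds_iff.1 (hf.and h1)
  let Θ := Θ0.restrOpen s hso
  have hcoe : ∀ x, Θ x = f x := fun x => rfl
  have hsrc : Θ.source = Θ0.source ∩ s := rfl
  refine ⟨Θ, ⟨hp.mem_toOpenPartialHomeomorph_source hi (by simp), hps⟩, hcoe, ?_, ?_⟩
  · intro x hx
    exact ((hs x hx.2).1).contDiffWithinAt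
  · intro y hy
    have hx : Θ.symm y ∈ Θ.source := Θ.map_target hy
    obtain ⟨h2, g, hg⟩ := hs _ hx.2
    apply ContDiffAt.contDiffWithinAt
    apply Θ.contDiffAt_symm (f₀' := g) hy _ h2
    rw [hg]
    exact (h2.differentiableAt (by simp)).hasFDerivAt

theorem local_leftInv {E F : Type} [NormedAddCommGroup E] [NormedSpace RR E] [FiniteDimensional RR E]
    [NormedAddCommGroup F] [NormedSpace RR F] [FiniteDimensional RR F] (f : E → F) (p : E)
    (hf : ∀ᶠ x in 𝓝 p, ContDiffAt RR ∞ f x) (hi : Function.Injective (fD f p)) :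
    ∃ g : F → E, (∀ᶠ y in 𝓝 (f p), ContDiffAt RR ∞ g y) ∧ ∀ᶠ x in 𝓝 p, g (f x) = x := by
  have : CompleteSpace E := FiniteDimensional.complete RR E
  obtain ⟨A, hA⟩ := LinearMap.exists_leftInverse_of_injective
    ((fD f p : E →L[RR] F) : E →ₗ[RR] F) (LinearMap.ker_eq_bot.2 hi)
  let A' : F →L[RR] E := LinearMap.toContinuousLinearMap A
  have h1 : ∀ᶠ x in 𝓝 p, ContDiffAt RR ∞ (fun x => A' (f x)) x := by
    filter_upwards [hf] with x hx using A'.contDiff.contDiffAt.comp x hx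
  have h2 : HasFDerivAt (fun x => A' (f x)) ((ContinuousLinearEquiv.refl RR E : E ≃L[RR] E) : E →L[RR] E) p := by
    have := A'.hasFDerivAt.comp p (hf.self_of_nhds.differentiableAt (by simp)).hasFDerivAt
    have e : ((ContinuousLinearEquiv.refl RR E : E ≃L[RR] E) : E →L[RR] E) = A'.comp (fD f p) := by
      ext x
      exact (LinearMap.congr_fun hA x).symm
    rw [e]
    exact this
  obtain ⟨Θ, hp, hΘ, hs, ht⟩ := ift _ p h1 _ h2
  refine ⟨fun y => Θ.symm (A' y), ?_, ?_⟩
  · have h5 : A' (f p) ∈ Θ.target := by rw [← hΘ]; exact Θ.map_source hp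
    have : ∀ᶠ y in 𝓝 (f p), A' y ∈ Θ.target :=
      A'.continuous.continuousAt (Θ.open_target.mem_nhds h5)
    filter_upwards [this] with y hy
    exact ((ht _ hy).contDiffAt (Θ.open_target.mem_nhds hy)).comp y A'.contDiff.contDiffAt
  · filter_upwards [Θ.open_source.mem_nhds hp] with x hx
    rw [← hΘ, Θ.left_inv hx]

def IsD {E : Type} [NormedAddCommGroup E] [NormedSpace RR E] (Φ : E ≃ E) : Prop :=
  CDi Φ ∧ CDi Φ.symm

theorem isD_of_homeo {E : Type} [NormedAddCommGroup E] [NormedSpace RR E] [FiniteDimensional RR E]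
    (f : E ≃ₜ E) (hf : CDi f) (hi : ∀ p, Function.Injective (fD f p)) :
    IsD f.toEquiv := by
  have : CompleteSpace E := FiniteDimensional.complete RR E
  refine ⟨hf, ?_⟩
  let f' : E → E ≃L[RR] E := fun p =>
    (LinearEquiv.ofInjectiveEndo ((fD f p : E →L[RR] E) : E →ₗ[RR] E) (hi p)).toContinuousLinearEquiv
  apply Homeomorph.contDiff_symm f (f₀' := f') _ hf
  intro a
  have := ((hf.differentiable (by simp)) a).hasFDerivAt
  have e : (f' a : E →L[RR] E) = fD f a := by ext x; rfl
  rw [e]; exact this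

theorem isD_of_inj {E : Type} [NormedAddCommGroup E] [NormedSpace RR E] [FiniteDimensional RR E]
    (f : E → E) (hf : CDi f) (hinj : Function.Injective f)
    (hi : ∀ p, Function.Injective (fD f p)) (R : RR) (hR : ∀ p, R ≤ ‖p‖ → f p = p) :
    ∃ Φ : E ≃ E, IsD Φ ∧ ∀ p, Φ p = f p := by
  have : CompleteSpace E := FiniteDimensional.complete RR E
  have : ProperSpace E := FiniteDimensional.proper RR E
  let f' : E → E ≃L[RR] E := fun p =>
    (LinearEquiv.ofInjectiveEndo ((fD f p : E →L[RR] E) : E →ₗ[RR] E) (hi p)).toContinuousLinearEquiv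
  have hop : IsOpenMap f := by
    apply isOpenMap_of_hasStrictFDerivAt_equiv (f' := f')
    intro a
    have := (hf.contDiffAt (x := a)).hasStrictFDerivAt (by simp)
    have e : (f' a : E →L[RR] E) = fD f a := by ext x; rfl
    rw [e]; exact this
  have hprop : IsProperMap f := by
    rw [isProperMap_iff_tendsto_cocompact]
    refine ⟨hf.continuous, ?_⟩
    apply tendsto_id.congr'
    have : (Metric.closedBall (0:E) R)ᶜ ∈ cocompact E := (isCompact_closedBall _ _).compl_mem_cocompact
    filter_upwards [this] with x hx
    simp only [mem_compl_iff, Metric.mem_closedBall, dist_zero_right, not_le] at hx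
    exact (hR x hx.le).symm
  have hsurj : Function.Surjective f := by
    rw [← Set.range_eq_univ]
    exact IsClopen.eq_univ ⟨hprop.isClosedMap.isClosed_range, hop.isOpen_range⟩ (range_nonempty f)
  let Φ := Equiv.ofBijective f ⟨hinj, hsurj⟩
  let H : E ≃ₜ E := Φ.toHomeomorphOfIsInducing (Topology.IsClosedEmbedding.of_continuous_injective_isClosedMap hf.continuous hinj hprop.isClosedMap).isInducing
  exact ⟨Φ, isD_of_homeo H hf hi, fun p => rfl⟩


theorem IsD.symm {E : Type} [NormedAddCommGroup E] [NormedSpace RR E] {Φ : E ≃ E} (h : IsD Φ) :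
    IsD Φ.symm := ⟨h.2, h.1⟩

theorem IsD.trans {E : Type} [NormedAddCommGroup E] [NormedSpace RR E] {Φ Ψ : E ≃ E} (h : IsD Φ)
    (h' : IsD Ψ) : IsD (Φ.trans Ψ) := ⟨h'.1.comp h.1, h.2.comp h'.2⟩

theorem isD_small {E : Type} [NormedAddCommGroup E] [NormedSpace RR E] [FiniteDimensional RR E]
    (V : E → E) (hV : CDi V) (hd : ∀ z, ‖fD V z‖ ≤ 1/2) (R : RR)
    (hR : ∀ p, R ≤ ‖p‖ → V p = 0) :
    ∃ Φ : E ≃ E, IsD Φ ∧ ∀ p, Φ p = p + V p := by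
  have hVd := hV.differentiable (by simp)
  apply isD_of_inj (fun p => p + V p) (by fun_prop) _ _ R
  · intro p hp; simp [hR p hp]
  · intro x y hxy
    have h1 : ‖V y - V x‖ ≤ 1/2 * ‖y - x‖ :=
      convex_univ.norm_image_sub_le_of_norm_fderiv_le (fun z _ => hVd z) (fun z _ => hd z)
        (mem_univ x) (mem_univ y)
    have h2 : V y - V x = -(y - x) := by
      have : x + V x = y + V y := hxy
      have h3 : V y = x + V x - y := by rw [this]; abel
      rw [h3]; abel
    rw [h2, norm_neg] at h1
    have h4 : ‖y - x‖ = 0 := by linarith [norm_nonneg (y - x)]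
    exact (sub_eq_zero.1 (norm_eq_zero.1 h4)).symm
  · intro p
    have e : fD (fun p => p + V p) p = ContinuousLinearMap.id RR E + fD V p := by
      have := (hasFDerivAt_id p).add (hVd p).hasFDerivAt
      exact this.fderiv
    rw [e]
    rw [injective_iff_map_eq_zero]
    intro v hv
    have h1 := (fD V p).le_opNorm v
    have h2 : fD V p v = -v := by
      have : v + fD V p v = 0 := hv
      exact (neg_eq_of_add_eq_zero_right this).symm
    rw [h2, norm_neg] at h1
    have h4 : ‖v‖ = 0 := by nlinarith [norm_nonneg v, hd p]
    exact norm_eq_zero.1 h4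

theorem exists_sigma (e : RR → ℂ) (he : CDi e) (hinj : Function.Injective e)
    (hd : ∀ s, deriv e s ≠ 0) (K : RR) : ∃ σ : ℂ → RR, CDi σ ∧ ∀ s, |s| ≤ K → σ (e s) = s := by
  let t : ℂ → Set RR := fun z => {x | ∀ s, |s| ≤ K → e s = z → x = s}
  have hK : IsCompact {s : RR | |s| ≤ K} := by
    have : {s : RR | |s| ≤ K} = Metric.closedBall 0 K := by ext; simp
    rw [this]; exact isCompact_closedBall _ _
  obtain ⟨g, hg⟩ := exists_contMDiffMap_forall_mem_convex_of_local (n := ⊤) (modelWithCornersSelf RR ℂ)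
    (t := t) (by
      intro z x hx y hy a b ha hb hab s hs hz
      simp only [hx s hs hz, hy s hs hz, smul_eq_mul, ← add_mul, hab, one_mul]) (by
      intro z
      by_cases hz : ∃ s0, |s0| ≤ K ∧ e s0 = z
      · obtain ⟨s0, hs0, rfl⟩ := hz
        obtain ⟨g, hg, hgl⟩ := local_leftInv e s0 (Eventually.of_forall fun _ => he.contDiffAt) (by
          rw [injective_iff_map_eq_zero]
          intro v hv
          have h1 : fD e s0 v = v • deriv e s0 := by
            rw [← fderiv_apply_one_eq_deriv, ← map_smul]; simp
          rw [h1] at hv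
          simpa [hd s0] using hv)
        obtain ⟨δ, hδ, hgδ⟩ := Metric.eventually_nhds_iff_ball.1 hgl
        have hK2 : IsClosed (e '' ({s : RR | |s| ≤ K} ∩ (Metric.ball s0 δ)ᶜ)) :=
          ((hK.inter_right Metric.isOpen_ball.isClosed_compl).image he.continuous).isClosed
        have hm : e s0 ∉ e '' ({s : RR | |s| ≤ K} ∩ (Metric.ball s0 δ)ᶜ) := by
          rintro ⟨s, ⟨-, hs⟩, h⟩
          rw [hinj h] at hs
          exact hs (Metric.mem_ball_self hδ)
        refine ⟨_, (hg.and (hK2.isOpen_compl.mem_nhds hm)), g, ?_, ?_⟩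
        · intro y hy
          exact hy.1.contDiffWithinAt.contMDiffWithinAt
        · rintro y ⟨-, hy⟩ s hs rfl
          by_cases h : s ∈ Metric.ball s0 δ
          · exact hgδ s h
          · exact absurd ⟨s, ⟨hs, h⟩, rfl⟩ hy
      · have h1 : IsClosed (e '' {s : RR | |s| ≤ K}) := (hK.image he.continuous).isClosed
        refine ⟨_, h1.isOpen_compl.mem_nhds (x := z) ?_, fun _ => 0, contMDiffOn_const, ?_⟩
        · rintro ⟨s, hs, h⟩; exact hz ⟨s, hs, h⟩
        · intro y hy s hs hsy
          exact absurd ⟨s, hs, hsy⟩ hy)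
  exact ⟨g, g.contMDiff.contDiff, fun s hs => hg (e s) s hs rfl⟩

theorem isotopy (E : P2 → ℂ) (hE : CDi E)
    (hinj : ∀ t ∈ Icc (0:RR) 1, Function.Injective fun s => E (t, s))
    (himm : ∀ t ∈ Icc (0:RR) 1, ∀ s, deriv (fun s => E (t, s)) s ≠ 0) (K M : RR) (hM : 0 < M)
    (hKM : ∀ s, |s| ≤ K → (∀ t ∈ Icc (0:RR) 1, ‖E (t, s)‖ ≤ M) ∨
      (∀ t ∈ Icc (0:RR) 1, E (t, s) = E (0, s))) :
    ∃ Φ : ℂ ≃ ℂ, IsD Φ ∧ (∀ z, M + 1 ≤ ‖z‖ → Φ z = z) ∧ ∀ s, |s| ≤ K → Φ (E (0, s)) = E (1, s) := by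
  let P : RR → RR → Prop := fun t t' => ∃ Φ : ℂ ≃ ℂ, IsD Φ ∧ (∀ z, M + 1 ≤ ‖z‖ → Φ z = z) ∧
    ∀ s, |s| ≤ K → Φ (E (t, s)) = E (t', s)
  refine isPreconnected_Icc.induction₂ (s := Icc (0:RR) 1) P ?_ ?_ ?_
    (left_mem_Icc.2 zero_le_one) (right_mem_Icc.2 zero_le_one)
  · intro t0 ht0
    obtain ⟨σ, hσ, hσE⟩ := exists_sigma (fun s => E (t0, s)) (by fun_prop) (hinj t0 ht0) (himm t0 ht0) K
    let χ : ContDiffBump (0:ℂ) := ⟨M, M + 1, hM, by linarith⟩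
    let V : RR × ℂ → ℂ := fun x => χ x.2 • (E (x.1, σ x.2) - E (t0, σ x.2))
    have hV : CDi V := by
      have : CDi (fun x : RR × ℂ => χ x.2) := χ.contDiff.comp contDiff_snd
      exact this.smul (by fun_prop)
    have hV0 : ∀ t z, M + 1 ≤ ‖z‖ → V (t, z) = 0 := by
      intro t z hz
      have : χ z = 0 := χ.zero_of_le_dist (by simpa using hz)
      simp [V, this]
    have hVf : Continuous (fun x : RR × ℂ => fD (fun z => V (x.1, z)) x.2) := by
      have h1 : ∀ x : RR × ℂ, fD (fun z => V (x.1, z)) x.2 =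
          (fD V x).comp (ContinuousLinearMap.inr RR RR ℂ) := by
        intro x
        have a1 := (hV.differentiable (by simp) x).hasFDerivAt
        have a2 : HasFDerivAt (fun z : ℂ => (x.1, z)) (ContinuousLinearMap.inr RR RR ℂ) x.2 :=
          hasFDerivAt_prodMk_right x.1 x.2
        exact (HasFDerivAt.comp x.2 a1 a2).fderiv
      simp_rw [h1]
      have h2 := hV.continuous_fderiv (by simp)
      fun_prop
    have hev : ∀ᶠ t in 𝓝 t0, ∀ z ∈ Metric.closedBall (0:ℂ) (M + 1),
        ‖fD (fun z => V (t, z)) z‖ < 1/2 := by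
      apply (isCompact_closedBall (0:ℂ) (M+1)).eventually_forall_of_forall_eventually
      intro z _
      have h3 : ‖fD (fun z => V (t0, z)) z‖ < 1/2 := by
        have : (fun z => V (t0, z)) = fun _ => 0 := by ext z; simp [V]
        rw [this]; simp
      have h4 : ContinuousAt (fun x : RR × ℂ => ‖fD (fun z => V (x.1, z)) x.2‖) (t0, z) :=
        hVf.norm.continuousAt
      exact h4.eventually (gt_mem_nhds h3)
    have hev2 := (eventually_nhdsWithin_of_eventually_nhds (s := Icc (0:RR) 1) hev).and
      (self_mem_nhdsWithin : Icc (0:RR) 1 ∈ 𝓝[Icc (0:RR) 1] t0)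
    refine hev2.mono ?_
    · rintro t ⟨ht, htI⟩
      obtain ⟨Φ, hΦ, hΦV⟩ := isD_small (fun z => V (t, z)) (by fun_prop) (by
        intro z
        by_cases hz : z ∈ Metric.closedBall (0:ℂ) (M + 1)
        · exact (ht z hz).le
        · have : (fun z => V (t, z)) =ᶠ[𝓝 z] fun _ => 0 := by
            filter_upwards [Metric.isClosed_closedBall.isOpen_compl.mem_nhds hz] with y hy
            apply hV0
            simp only [mem_compl_iff, Metric.mem_closedBall, dist_zero_right, not_le] at hy
            exact hy.le
          rw [this.fderiv_eq]; simp) (M + 1) (hV0 t)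
      refine ⟨Φ, hΦ, fun z hz => by rw [hΦV, hV0 t z hz, add_zero], fun s hs => ?_⟩
      rw [hΦV]
      simp only [V, hσE s hs]
      rcases hKM s hs with h | h
      · have : χ (E (t0, s)) = 1 := χ.one_of_mem_closedBall (by simpa using h t0 ht0)
        rw [this]; simp
      · rw [h t htI, h t0 ht0]; simp
  · rintro x y z - - - ⟨Φ, h1, h2, h3⟩ ⟨Ψ, h1', h2', h3'⟩
    refine ⟨Φ.trans Ψ, h1.trans h1', fun z hz => ?_, fun s hs => ?_⟩
    · simp [h2 z hz, h2' z hz]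
    · simp [h3 s hs, h3' s hs]
  · rintro x y - - ⟨Φ, h1, h2, h3⟩
    refine ⟨Φ.symm, h1.symm, fun z hz => ?_, fun s hs => ?_⟩
    · rw [Equiv.symm_apply_eq, h2 z hz]
    · rw [Equiv.symm_apply_eq, h3 s hs]


theorem isD_sub (a : ℂ) : IsD (Equiv.subRight a) := by
  constructor
  · show CDi (fun z : ℂ => z - a); fun_prop
  · show CDi (fun z : ℂ => z + a); fun_prop

theorem isD_mul (a : ℂ) (ha : a ≠ 0) : IsD (Equiv.mulRight₀ a ha) := by
  constructor
  · show CDi (fun z : ℂ => z * a); fun_prop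
  · show CDi (fun z : ℂ => z * a⁻¹); fun_prop

theorem arc_straight (k : RR → ℂ) (hk : CDi k) (hinj : Function.Injective k)
    (hd : ∀ s, deriv k s ≠ 0) (K : RR) : ∃ Φ : ℂ ≃ ℂ, IsD Φ ∧ ∀ v : RR, |v| ≤ K → Φ (k v) = v := by
  obtain ⟨q, hq, hkq, hq0⟩ := hadamard k hk
  let E : P2 → ℂ := fun x => (x.2 : ℂ) * q (0, x.1 * x.2)
  have hE : CDi E := by
    have : CDi (fun x : P2 => (x.2 : ℂ)) := Complex.ofRealCLM.contDiff.comp contDiff_snd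
    exact this.mul (by fun_prop)
  have hE0 : ∀ s, E (0, s) = s * deriv k 0 := by intro s; simp [E, hq0]
  have hEt : ∀ t s : RR, (t : ℂ) * E (t, s) = k (t * s) - k 0 := by
    intro t s
    have := hkq 0 (t * s)
    rw [zero_add] at this
    rw [this, Complex.real_smul]; simp [E]; ring
  have hE1 : ∀ s, E (1, s) = k s - k 0 := by intro s; simpa using hEt 1 s
  have hcpt : IsCompact (Icc (0:RR) 1 ×ˢ {s : RR | |s| ≤ K}) := by
    have : {s : RR | |s| ≤ K} = Metric.closedBall 0 K := by ext; simp
    rw [this]; exact isCompact_Icc.prod (isCompact_closedBall _ _)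
  obtain ⟨M, hM⟩ := hcpt.exists_bound_of_continuousOn hE.continuous.continuousOn
  obtain ⟨Φ, hΦ, -, hΦE⟩ := isotopy E hE (by
      intro t ht x y hxy
      by_cases h0 : t = 0
      · subst h0
        simp only [hE0] at hxy
        exact_mod_cast mul_right_cancel₀ (hd 0) hxy
      · have h1 : (t:ℂ) * E (t, x) = t * E (t, y) := by rw [show E (t, x) = E (t, y) from hxy]
        rw [hEt, hEt] at h1
        exact mul_left_cancel₀ h0 (hinj (sub_left_injective h1))) (by
      intro t ht s
      by_cases h0 : t = 0
      · subst h0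
        have : (fun s => E (0, s)) = fun s : RR => (s : ℂ) * deriv k 0 := by ext s; exact hE0 s
        rw [this]
        have h2 : HasDerivAt (fun s : RR => (s : ℂ) * deriv k 0) (1 * deriv k 0) s :=
          (Complex.ofRealCLM.hasDerivAt (x := s)).mul_const _
        rw [h2.deriv, one_mul]; exact hd 0
      · have h0' : (t:ℂ) ≠ 0 := by exact_mod_cast h0
        have : (fun s => E (t, s)) = fun s : RR => (t : ℂ)⁻¹ * (k (t * s) - k 0) := by
          ext s; rw [← hEt]; field_simp
        rw [this]
        have h2 : HasDerivAt (fun s : RR => k (t * s)) (t • deriv k (t * s)) s := by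
          have a1 : HasDerivAt k (deriv k (t * s)) (t * s) :=
            (hk.differentiable (by simp)).differentiableAt.hasDerivAt
          have a2 : HasDerivAt (fun s : RR => t * s) t s := by
            simpa using (hasDerivAt_id s).const_mul t
          exact a1.scomp s a2
        rw [((h2.sub_const (k 0)).const_mul (t:ℂ)⁻¹).deriv, Complex.real_smul, ← mul_assoc, inv_mul_cancel₀ h0', one_mul]
        exact hd _) K (max M 1) (by positivity) (fun s hs => Or.inl fun t ht => (hM (t, s) ⟨ht, hs⟩).trans (le_max_left _ _))
  refine ⟨((Equiv.subRight (k 0)).trans Φ.symm).trans (Equiv.mulRight₀ (deriv k 0)⁻¹ (inv_ne_zero (hd 0))),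
    ((isD_sub _).trans hΦ.symm).trans (isD_mul _ _), fun v hv => ?_⟩
  have := hΦE v hv
  rw [hE0, hE1, ← Equiv.eq_symm_apply] at this
  simp [← this, hd 0]

theorem exists_log {E : Type} [NormedAddCommGroup E] [NormedSpace RR E] (q : E → ℂ) (hq : CDi q)
    (h0 : ∀ x, q x ≠ 0) : ∃ l : E → ℂ, CDi l ∧ ∀ x, Complex.exp (l x) = q x := by
  have hfd : CDi (fD q) := hq.fderiv_right (by simp)
  let φ : E × RR → ℂ := fun x => fD q (x.2 • x.1) x.1 * (q (x.2 • x.1))⁻¹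
  have hφ : CDi φ := by
    refine ContDiff.mul ?_ (ContDiff.inv (by fun_prop) (fun x => h0 _))
    exact (hfd.comp (by fun_prop : CDi fun x : E × RR => x.2 • x.1)).clm_apply contDiff_fst
  refine ⟨fun x => Complex.log (q 0) + ∫ θ in (0:RR)..1, φ (x, θ), contDiff_const.add (contDiff_paramInt φ hφ), ?_⟩
  intro x
  let G : RR → ℂ := fun r => Complex.log (q 0) + ∫ θ in (0:RR)..r, φ (x, θ)
  have hG : ∀ r, HasDerivAt G (φ (x, r)) r := by
    intro r
    have hc : Continuous (fun θ => φ (x, θ)) := by have := hφ.continuous; fun_prop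
    exact (hc.integral_hasStrictDerivAt 0 r).hasDerivAt.const_add _
  have hQ : ∀ r : RR, HasDerivAt (fun r : RR => q (r • x)) (fD q (r • x) x) r := by
    intro r
    have a1 := (hq.differentiable (by simp) (r • x)).hasFDerivAt
    have a2 : HasDerivAt (fun r : RR => r • x) x r := by
      simpa using (hasDerivAt_id r).smul_const x
    exact a1.comp_hasDerivAt r a2
  have hD : ∀ r : RR, HasDerivAt (fun r : RR => q (r • x) * Complex.exp (-G r)) 0 r := by
    intro r
    have h := (hQ r).mul (hG r).neg.cexp
    have e := mul_inv_cancel₀ (h0 (r • x))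
    have e2 : fD q (r • x) x * Complex.exp ((-G) r) + q (r • x) * (Complex.exp ((-G) r) * -φ (x, r)) = 0 := by
      show fD q (r • x) x * Complex.exp ((-G) r) + q (r • x) * (Complex.exp ((-G) r) * -(fD q (r • x) x * (q (r • x))⁻¹)) = 0
      linear_combination (-(fD q (r • x) x * Complex.exp ((-G) r))) * e
    rw [e2] at h
    exact h
  have hconst := is_const_of_deriv_eq_zero (fun r => (hD r).differentiableAt) (fun r => (hD r).deriv) 1 0
  simp only [one_smul, zero_smul] at hconst
  have hG0 : G 0 = Complex.log (q 0) := by simp [G]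
  rw [hG0, Complex.exp_neg, Complex.exp_neg, Complex.exp_log (h0 0), mul_inv_cancel₀ (h0 0)] at hconst
  have hne := Complex.exp_ne_zero (G 1)
  have : Complex.exp (G 1) = q x := by
    field_simp at hconst
    exact hconst.symm
  exact this

theorem log_eq_on {E : Type} [TopologicalSpace E] (q l : E → ℂ) (hq : Continuous q)
    (hl : Continuous l) (hlq : ∀ x, Complex.exp (l x) = q x) (S : Set E) (hS : IsPreconnected S)
    (hre : ∀ x ∈ S, 0 < (q x).re) (x0 : E) (hx0 : x0 ∈ S) (h0 : l x0 = Complex.log (q x0)) :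
    ∀ x ∈ S, l x = Complex.log (q x) := by
  let g : E → RR := fun x => ((l x - Complex.log (q x)).im) / (2 * PI)
  have hg : ContinuousOn g S := by
    have h1 : ContinuousOn (fun x => Complex.log (q x)) S :=
      ContinuousOn.clog hq.continuousOn (fun x hx => Or.inl (hre x hx))
    exact (Complex.continuous_im.comp_continuousOn (hl.continuousOn.sub h1)).div_const _
  have hint : ∀ x ∈ S, ∃ n : ℤ, l x = Complex.log (q x) + n * (2 * PI * Complex.I) := by
    intro x hx
    have hne : q x ≠ 0 := by intro h; have := hre x hx; rw [h] at this; simp at this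
    rw [← Complex.exp_eq_exp_iff_exists_int, hlq, Complex.exp_log hne]
  have hgi : ∀ x, ∀ n : ℤ, l x = Complex.log (q x) + n * (2 * PI * Complex.I) → g x = n := by
    intro x n h
    simp only [g, h, add_sub_cancel_left]
    have : ((n:ℂ) * (2 * PI * Complex.I)).im = n * (2 * PI) := by simp
    rw [this]; field_simp
  have hg0 : g x0 = 0 := by simp [g, h0]
  intro x hx
  obtain ⟨n, hn⟩ := hint x hx
  have hgx := hgi x n hn
  by_cases hn0 : n = 0
  · rw [hn, hn0]; simp
  exfalso
  have key : ∀ c : RR, c ∈ g '' S → ∃ m : ℤ, c = m := by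
    rintro c ⟨y, hy, rfl⟩
    obtain ⟨m, hm⟩ := hint y hy
    exact ⟨m, hgi y m hm⟩
  have hord := (hS.image g hg).ordConnected
  have hm0 : (0:RR) ∈ g '' S := ⟨x0, hx0, hg0⟩
  have hmn : (n:RR) ∈ g '' S := ⟨x, hx, hgx⟩
  rcases lt_or_gt_of_ne hn0 with h | h
  · have h' : (n:RR) ≤ -1 := by exact_mod_cast (by omega : n ≤ -1)
    obtain ⟨m, hm⟩ := key (-1/2) (hord.out hmn hm0 ⟨by linarith, by norm_num⟩)
    have : (2:RR) * m = -1 := by linarith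
    have : (2:ℤ) * m = -1 := by exact_mod_cast this
    omega
  · have h' : (1:RR) ≤ n := by exact_mod_cast (by omega : 1 ≤ n)
    obtain ⟨m, hm⟩ := key (1/2) (hord.out hm0 hmn ⟨by norm_num, by linarith⟩)
    have : (2:RR) * m = 1 := by linarith
    have : (2:ℤ) * m = 1 := by exact_mod_cast this
    omega

theorem long_isotopy (L : P2 → ℂ) (hL : CDi L) (M : RR) (hM0 : 0 < M)
    (hM : ∀ t ∈ Icc (0:RR) 1, ∀ x, ‖L (t, x)‖ ≤ M) (N0 : RR)
    (hb : ∀ t ∈ Icc (0:RR) 1, ∀ x, N0 ≤ |x| → ‖deriv (fun x => L (t, x)) x‖ ≤ 1/4)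
    (hinj : ∀ t ∈ Icc (0:RR) 1, Function.Injective fun x : RR => (x : ℂ) + L (t, x))
    (himm : ∀ t ∈ Icc (0:RR) 1, ∀ x, 1 + deriv (fun x => L (t, x)) x ≠ 0)
    (h0 : ∀ x, L (0, x) = 0) (h1 : ∀ x, N0 ≤ |x| → L (1, x) = 0) :
    ∃ Φ : ℂ ≃ ℂ, IsD Φ ∧ (∃ R, ∀ z, R ≤ ‖z‖ → Φ z = z) ∧ ∀ x : RR, Φ x = x + L (1, x) := by
  let χ : ContDiffBump (0:RR) := ⟨2, 3, by norm_num, by norm_num⟩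
  obtain ⟨C, hC⟩ : ∃ C, ∀ x, ‖deriv χ x‖ ≤ C := by
    have hcs : HasCompactSupport (deriv χ) := χ.hasCompactSupport.deriv
    exact hcs.exists_bound_of_continuous (χ.contDiff (n := 1) |>.continuous_deriv le_rfl)
  have hC0 : 0 ≤ C := (norm_nonneg _).trans (hC 0)
  obtain ⟨N, hN1, hN2, hN3, hN4⟩ : ∃ N : RR, N0 ≤ N ∧ 2 * M < N ∧ 4 * C * M ≤ N ∧ 0 < N := by
    refine ⟨max N0 (2 * M + 1 + 4 * C * M), le_max_left _ _, ?_, ?_, ?_⟩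
    · exact lt_of_lt_of_le (by nlinarith) (le_max_right _ _)
    · exact le_trans (by nlinarith) (le_max_right _ _)
    · exact lt_of_lt_of_le (by nlinarith) (le_max_right _ _)
  let X : RR → RR := fun x => χ (x / N)
  have hX : CDi X := χ.contDiff.comp (by fun_prop)
  have hX1 : ∀ x, |x| ≤ 2 * N → X x = 1 := by
    intro x hx
    apply χ.one_of_mem_closedBall
    rw [Metric.mem_closedBall, dist_zero_right, Real.norm_eq_abs, abs_div, abs_of_pos hN4, div_le_iff₀ hN4]
    exact hx
  have hX0 : ∀ x, 3 * N ≤ |x| → X x = 0 := by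
    intro x hx
    apply χ.zero_of_le_dist
    rw [dist_zero_right, Real.norm_eq_abs, abs_div, abs_of_pos hN4, le_div_iff₀ hN4]
    exact hx
  have hXd : ∀ x, HasDerivAt X (deriv χ (x / N) * (1 / N)) x := by
    intro x
    have a1 : HasDerivAt χ (deriv χ (x/N)) (x/N) :=
      ((χ.contDiff (n := 1)).differentiable (by simp)).differentiableAt.hasDerivAt
    exact HasDerivAt.comp (h₂ := χ) (h := fun x => x / N) x a1 ((hasDerivAt_id x).div_const N)
  have hXle : ∀ x, |X x| ≤ 1 := fun x => by
    rw [abs_of_nonneg χ.nonneg]; exact χ.le_one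
  let T : P2 → ℂ := fun p => X p.2 • L p
  have hT : CDi T := (hX.comp contDiff_snd).smul hL
  have hLd : ∀ t x, HasDerivAt (fun x => L (t, x)) (deriv (fun x => L (t, x)) x) x := by
    intro t x
    have : CDi (fun x => L (t, x)) := by fun_prop
    exact (this.differentiable (by simp)).differentiableAt.hasDerivAt
  have hTd : ∀ t x, HasDerivAt (fun x => T (t, x)) (deriv (fun x => T (t, x)) x) x := by
    intro t x
    have : CDi (fun x => T (t, x)) := by fun_prop
    exact (this.differentiable (by simp)).differentiableAt.hasDerivAt
  have hTle : ∀ t ∈ Icc (0:RR) 1, ∀ x, ‖T (t, x)‖ ≤ M := by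
    intro t ht x
    simp only [T, norm_smul, Real.norm_eq_abs]
    nlinarith [hXle x, hM t ht x, norm_nonneg (L (t, x)), abs_nonneg (X x)]
  have hTdle : ∀ t ∈ Icc (0:RR) 1, ∀ x, N ≤ |x| → ‖deriv (fun x => T (t, x)) x‖ ≤ 1/2 := by
    intro t ht x hx
    have e := ((hXd x).smul (hLd t x)).deriv
    have e2 : deriv (fun x => T (t, x)) x = X x • deriv (fun x => L (t, x)) x + (deriv χ (x / N) * (1 / N)) • L (t, x) := e
    rw [e2]
    refine (norm_add_le _ _).trans ?_
    rw [norm_smul, norm_smul, norm_mul, Real.norm_eq_abs (X x), Real.norm_of_nonneg (by positivity : (0:RR) ≤ 1 / N)]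
    have b1 := hb t ht x (hN1.trans hx)
    have b2 : |X x| * ‖deriv (fun x => L (t, x)) x‖ ≤ 1 * (1/4) :=
      mul_le_mul (hXle x) b1 (norm_nonneg _) zero_le_one
    have b3 : ‖deriv χ (x / N)‖ * (1 / N) * ‖L (t, x)‖ ≤ C * (1/N) * M := by
      gcongr
      · exact hC _
      · exact hM t ht x
    have b4 : C * (1/N) * M ≤ 1/4 := by
      rw [mul_one_div, div_mul_eq_mul_div, div_le_iff₀ hN4]; linarith
    linarith
  have hTL : ∀ t x, |x| ≤ 2 * N → T (t, x) = L (t, x) := by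
    intro t x hx; simp [T, hX1 x hx]
  have hlip : ∀ t ∈ Icc (0:RR) 1, ∀ x y, (N ≤ x ∧ N ≤ y) ∨ (x ≤ -N ∧ y ≤ -N) → 
      (x:ℂ) + T (t, x) = y + T (t, y) → x = y := by
    intro t ht x y hxy h
    have h2 : ‖T (t, y) - T (t, x)‖ ≤ 1/2 * ‖y - x‖ := by
      rcases hxy with hxy | hxy
      · exact (convex_Ici N).norm_image_sub_le_of_norm_hasDerivWithin_le
          (fun z _ => (hTd t z).hasDerivWithinAt) (fun z hz => hTdle t ht z (le_trans hz (le_abs_self _)))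
          hxy.1 hxy.2
      · exact (convex_Iic (-N)).norm_image_sub_le_of_norm_hasDerivWithin_le
          (fun z _ => (hTd t z).hasDerivWithinAt) (fun z hz => hTdle t ht z (by
            have : z ≤ -N := hz
            have := neg_le_abs z; linarith))
          hxy.1 hxy.2
    have h3 : T (t, y) - T (t, x) = ((x - y : RR) : ℂ) := by
      push_cast; linear_combination -h
    rw [h3, Complex.norm_real, norm_sub_rev x y] at h2
    have : ‖y - x‖ = 0 := by linarith [norm_nonneg (y - x)]
    rw [norm_eq_zero] at this; linarith
  have hTinj : ∀ t ∈ Icc (0:RR) 1, Function.Injective fun x : RR => (x : ℂ) + T (t, x) := by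
    intro t ht x y hxy
    simp only at hxy
    have hd : |x - y| ≤ 2 * M := by
      have h3 : ((x - y : RR) : ℂ) = T (t, y) - T (t, x) := by
        push_cast; linear_combination hxy
      have := congrArg norm h3
      rw [Complex.norm_real, Real.norm_eq_abs] at this
      rw [this]
      exact (norm_sub_le _ _).trans (by linarith [hTle t ht x, hTle t ht y])
    rw [abs_le] at hd
    by_cases hx : |x| ≤ 2 * N
    · by_cases hy : |y| ≤ 2 * N
      · rw [hTL t x hx, hTL t y hy] at hxy
        exact hinj t ht hxy
      · apply hlip t ht x y _ hxy
        rw [not_le, lt_abs] at hy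
        rcases hy with hy | hy
        · left; constructor <;> linarith
        · right; constructor <;> linarith
    · apply hlip t ht x y _ hxy
      rw [not_le, lt_abs] at hx
      rcases hx with hx | hx
      · left; constructor <;> linarith
      · right; constructor <;> linarith
  have hcoe : ∀ s, HasDerivAt (fun s : RR => (s:ℂ)) 1 s := fun s => Complex.ofRealCLM.hasDerivAt (x := s)
  obtain ⟨Φ, hΦ, hΦi, hΦE⟩ := isotopy (fun p => (p.2 : ℂ) + T p)
    ((Complex.ofRealCLM.contDiff.comp contDiff_snd).add hT) hTinj (by
      intro t ht s
      have e : deriv (fun s : RR => (s:ℂ) + T (t, s)) s = 1 + deriv (fun x => T (t, x)) s :=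
        ((hcoe s).add (hTd t s)).deriv
      show deriv (fun s : RR => (s:ℂ) + T (t, s)) s ≠ 0
      rw [e]
      by_cases hs : |s| < 2 * N
      · have : (fun x => T (t, x)) =ᶠ[𝓝 s] fun x => L (t, x) := by
          have : ∀ᶠ x in 𝓝 s, |x| < 2 * N := continuous_abs.continuousAt.eventually (gt_mem_nhds hs)
          filter_upwards [this] with x hx using hTL t x hx.le
        rw [this.deriv_eq]; exact himm t ht s
      · intro h
        have h2 := hTdle t ht s (by linarith)
        rw [eq_neg_of_add_eq_zero_right h] at h2
        norm_num at h2) (3 * N + M + 1) (3 * N + M) (by positivity) (by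
      intro s hs
      by_cases h : |s| ≤ 3 * N
      · left
        intro t ht
        refine (norm_add_le _ _).trans ?_
        rw [Complex.norm_real]
        exact add_le_add h (hTle t ht s)
      · right
        intro t ht
        simp [T, hX0 s (not_le.1 h).le])
  refine ⟨Φ, hΦ, ⟨_, hΦi⟩, fun x => ?_⟩
  have hT1 : T (1, x) = L (1, x) := by
    by_cases h : |x| ≤ 2 * N
    · exact hTL 1 x h
    · have : L (1, x) = 0 := h1 x (by linarith)
      simp [T, this]
  by_cases h : |x| ≤ 3 * N + M + 1
  · have := hΦE x h
    have e : T (0, x) = 0 := by simp [T, h0]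
    simp only [e, add_zero] at this
    rw [this, ← hT1]
  · rw [hΦi x (by rw [Complex.norm_real]; exact (not_le.1 h).le), h1 x (by linarith), add_zero]


theorem long_main (γ : RR → ℂ) (hγ : CDi γ) (hinj : Function.Injective γ)
    (hd : ∀ s, deriv γ s ≠ 0) (hout : ∀ s, 1 ≤ |s| → γ s = s) (C : RR) (hC1 : 1 ≤ C)
    (hC : ∀ s, ‖γ s - s‖ ≤ C) (R : RR) (hR2 : 2 ≤ R) (hR : ∀ s < R, 0 < (R - γ s).re) :
    ∃ Φ : ℂ ≃ ℂ, IsD Φ ∧ (∃ R', ∀ z, R' ≤ ‖z‖ → Φ z = z) ∧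
      ∀ s < R, Φ (Real.log (R - s)) = Complex.log (R - γ s) := by
  obtain ⟨q0, hq0, hγq0, hq0d⟩ := hadamard γ hγ
  let q : P2 → ℂ := fun p => q0 (p.1, -p.2)
  have hq : CDi q := by fun_prop
  have hγq : ∀ t h : RR, γ t - γ (t - h) = h * q (t, h) := by
    intro t h
    have := hγq0 t (-h)
    rw [Complex.real_smul, ← sub_eq_add_neg] at this
    push_cast at this
    linear_combination -this
  have hqne : ∀ p, q p ≠ 0 := by
    rintro ⟨t, h⟩ h0
    by_cases hh : h = 0
    · subst hh
      simp only [q, neg_zero, hq0d] at h0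
      exact hd t h0
    · have := hγq t h
      rw [h0, mul_zero, sub_eq_zero] at this
      have := hinj this
      apply hh; linarith
  obtain ⟨l0, hl0, hlq0⟩ := exists_log q hq hqne
  let l : P2 → ℂ := fun p => l0 p - l0 (-1, 1)
  have hl : CDi l := by fun_prop
  have hqdiv : ∀ t h : RR, h ≠ 0 → q (t, h) = (γ t - γ (t - h)) / h := by
    intro t h hh
    have : (h:ℂ) ≠ 0 := by exact_mod_cast hh
    rw [hγq]; field_simp
  have hqm1 : ∀ h : RR, 0 < h → q (-1, h) = 1 := by
    intro h hh
    have : (h:ℂ) ≠ 0 := by exact_mod_cast hh.ne'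
    rw [hqdiv _ _ hh.ne', hout (-1) (by simp), hout (-1 - h) (by rw [le_abs]; right; linarith)]
    push_cast; field_simp; ring
  have hlq : ∀ p, Complex.exp (l p) = q p := by
    intro p
    simp only [l, Complex.exp_sub, hlq0, hqm1 1 one_pos, div_one]
  let H0 : RR := R + 1 + 2 * C
  have hH0 : 0 < H0 := by simp only [H0]; linarith
  have hqbig : ∀ t ∈ Icc (-1) R, ∀ h, H0 ≤ h → q (t, h) = 1 + (γ t - t) / h := by
    intro t ht h hh
    have h0 : 0 < h := by linarith
    have : (h:ℂ) ≠ 0 := by exact_mod_cast h0.ne'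
    rw [hqdiv _ _ h0.ne', hout (t - h) (by rw [le_abs]; right; simp only [H0] at hh; linarith [ht.2])]
    push_cast; field_simp; ring
  have hqnear : ∀ t ∈ Icc (-1) R, ∀ h, H0 ≤ h → ‖q (t, h) - 1‖ ≤ 1/2 := by
    intro t ht h hh
    have h0 : 0 < h := by linarith
    rw [hqbig t ht h hh, add_sub_cancel_left, norm_div, Complex.norm_real, Real.norm_of_nonneg h0.le,
      div_le_iff₀ h0]
    have := hC t
    simp only [H0] at hh
    linarith
  have hrebig : ∀ t ∈ Icc (-1) R, ∀ h, H0 ≤ h → 0 < (q (t, h)).re := by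
    intro t ht h hh
    have h1 := (abs_le.1 ((Complex.abs_re_le_norm _).trans (hqnear t ht h hh))).1
    simp only [Complex.sub_re, Complex.one_re] at h1
    linarith
  have hL1 : ∀ p ∈ ({-1} : Set RR) ×ˢ Ioi (0:RR), l p = Complex.log (q p) := by
    apply log_eq_on q l hq.continuous hl.continuous hlq _ (isPreconnected_singleton.prod isPreconnected_Ioi) _ (-1, 1)
    · simp
    · simp [l, hqm1]
    · rintro ⟨t, h⟩ ⟨ht, hh⟩
      rw [show t = -1 from ht, hqm1 h hh]; simp
  have hL2 : ∀ p ∈ Icc (-1) R ×ˢ Ici H0, l p = Complex.log (q p) := by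
    apply log_eq_on q l hq.continuous hl.continuous hlq _ (isPreconnected_Icc.prod isPreconnected_Ici) _ (-1, H0)
    · exact ⟨⟨le_rfl, by linarith⟩, self_mem_Ici⟩
    · exact hL1 _ ⟨rfl, hH0⟩
    · rintro ⟨t, h⟩ ⟨ht, hh⟩
      exact hrebig t ht h hh
  have hL3 : ∀ p ∈ ({R} : Set RR) ×ˢ Ioi (0:RR), l p = Complex.log (q p) := by
    apply log_eq_on q l hq.continuous hl.continuous hlq _ (isPreconnected_singleton.prod isPreconnected_Ioi) _ (R, H0)
    · exact ⟨rfl, hH0⟩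
    · exact hL2 _ ⟨⟨by linarith, le_rfl⟩, self_mem_Ici⟩
    · rintro ⟨t, h⟩ ⟨ht, hh⟩
      have hh : 0 < h := hh
      rw [show t = R from ht, hqdiv _ _ hh.ne', Complex.div_ofReal_re, hout R (by rw [le_abs]; left; linarith)]
      exact div_pos (hR _ (by linarith)) hh
  let L : P2 → ℂ := fun p => l (-1 + p.1 * (R + 1), Real.exp p.2)
  have hL : CDi L := by
    have : CDi (fun p : P2 => ((-1 + p.1 * (R + 1), Real.exp p.2) : P2)) := by
      refine ContDiff.prodMk (by fun_prop) (Real.contDiff_exp.comp contDiff_snd)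
    exact hl.comp this
  have hT : ∀ t ∈ Icc (0:RR) 1, -1 + t * (R + 1) ∈ Icc (-1) R := by
    intro t ht; constructor <;> nlinarith [ht.1, ht.2]
  have hLd : ∀ t x, HasDerivAt (fun x => L (t, x)) (deriv (fun x => L (t, x)) x) x := by
    intro t x
    have : CDi (fun x => L (t, x)) := by fun_prop
    exact (this.differentiable (by simp)).differentiableAt.hasDerivAt
  obtain ⟨M1, hM1⟩ := (isCompact_Icc.prod isCompact_Icc : IsCompact (Icc (-1) R ×ˢ Icc 0 H0)).exists_bound_of_continuousOn
    hl.continuous.continuousOn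
  obtain ⟨M2, hM2⟩ := (isCompact_closedBall (1:ℂ) (1/2)).exists_bound_of_continuousOn (f := Complex.log) (by
    intro z hz
    apply ContinuousAt.continuousWithinAt
    apply continuousAt_clog
    left
    have h1 := (abs_le.1 ((Complex.abs_re_le_norm _).trans (by simpa [dist_eq_norm] using hz : ‖z - 1‖ ≤ 1/2))).1
    simp only [Complex.sub_re, Complex.one_re] at h1
    linarith)
  have hldc : Continuous (fun p => fD l p (0, 1)) := by
    have := hl.continuous_fderiv (by simp)
    fun_prop
  obtain ⟨M3, hM3⟩ := (isCompact_Icc.prod isCompact_Icc : IsCompact (Icc (-1) R ×ˢ Icc (0:RR) 1)).exists_bound_of_continuousOn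
    hldc.continuousOn
  have hM30 : 0 ≤ M3 := (norm_nonneg _).trans (hM3 (-1, 0) ⟨⟨le_rfl, by linarith⟩, ⟨le_rfl, zero_le_one⟩⟩)
  have hexpL : ∀ t x, Complex.exp (x + L (t, x)) = γ (-1 + t * (R + 1)) - γ (-1 + t * (R + 1) - Real.exp x) := by
    intro t x
    rw [hγq, Complex.exp_add, Complex.ofReal_exp, hlq]
  let A : RR := max (max H0 (8 * C)) (R + 1)
  let a : RR := min (1 / (4 * (M3 + 1))) (R - 1)
  have ha : 0 < a := lt_min (by positivity) (by linarith)
  have ha1 : a ≤ 1 := by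
    refine (min_le_left _ _).trans ?_
    rw [div_le_one (by positivity)]; linarith
  have hA : 0 < A := hH0.trans_le ((le_max_left _ _).trans (le_max_left _ _))
  let N0 := max (Real.log A) (-Real.log a)
  have hN0 : ∀ x, N0 ≤ |x| → A ≤ Real.exp x ∨ Real.exp x ≤ a := by
    intro x hx
    rw [le_abs] at hx
    rcases hx with hx | hx
    · left
      rw [← Real.log_le_iff_le_exp hA]
      exact (le_max_left _ _).trans hx
    · right
      rw [← Real.le_log_iff_exp_le ha]
      linarith [(le_max_right (Real.log A) (-Real.log a)).trans hx]
  obtain ⟨Φ, hΦ, hΦi, hΦL⟩ := long_isotopy L hL (max (max M1 M2) 1) (by positivity) (by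
      intro t ht x
      by_cases hx : Real.exp x ≤ H0
      · exact (hM1 (-1 + t * (R + 1), Real.exp x) ⟨hT t ht, (Real.exp_pos x).le, hx⟩).trans ((le_max_left _ _).trans (le_max_left _ _))
      · have hx := (not_le.1 hx).le
        simp only [L]
        rw [hL2 (-1 + t * (R + 1), Real.exp x) ⟨hT t ht, hx⟩]
        exact (hM2 _ (by simpa [dist_eq_norm] using hqnear _ (hT t ht) _ hx)).trans ((le_max_right _ _).trans (le_max_left _ _))) N0 (by
      intro t ht x hx
      rcases hN0 x hx with hx | hx
      · have hxH : max H0 (8 * C) ≤ Real.exp x := (le_max_left _ _).trans hx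
        have hx1 : H0 ≤ Real.exp x := (le_max_left _ _).trans hxH
        have hx2 : 8 * C ≤ Real.exp x := (le_max_right _ _).trans hxH
        set T := -1 + t * (R + 1) with hTdef
        have e1 := (hasDerivAt_id (x:ℂ)).comp_ofReal.add (hLd t x) |>.cexp
        have e2 : HasDerivAt (fun x : RR => γ T - γ (T - Real.exp x)) (Real.exp x : ℂ) x := by
          have : (fun x : RR => γ T - γ (T - Real.exp x)) =ᶠ[𝓝 x] fun x => γ T - T + ((Real.exp x : RR) : ℂ) := by
            have : ∀ᶠ y in 𝓝 x, H0 - 1 < Real.exp y := Real.continuous_exp.continuousAt.eventually (lt_mem_nhds (by linarith))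
            filter_upwards [this] with y hy
            rw [hout (T - Real.exp y) (by rw [le_abs]; right; simp only [H0] at hy; linarith [(hT t ht).2])]
            push_cast; ring
          refine HasDerivAt.congr_of_eventuallyEq ?_ this
          exact ((Real.hasDerivAt_exp x).ofReal_comp).const_add _
        have e3 : (fun x : RR => Complex.exp (x + L (t, x))) = fun x : RR => γ T - γ (T - Real.exp x) := by
          ext x; exact hexpL t x
        have e4 : Complex.exp (x + L (t, x)) * (1 + deriv (fun x => L (t, x)) x) = Real.exp x := by
          have e5 : HasDerivAt (fun x : RR => Complex.exp (x + L (t, x))) (Complex.exp (x + L (t, x)) * (1 + deriv (fun x => L (t, x)) x)) x := e1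
          rw [e3] at e5
          exact e5.unique e2
        have e6 : Complex.exp (x + L (t, x)) = γ T - T + Real.exp x := by
          rw [hexpL, ← hTdef, hout (T - Real.exp x) (by rw [le_abs]; right; simp only [H0] at hx1; linarith [(hT t ht).2])]
          push_cast; ring
        rw [e6] at e4
        have e7 : (γ T - T + Real.exp x) * deriv (fun x => L (t, x)) x = -(γ T - T) := by linear_combination e4
        have e8 := congrArg norm e7
        rw [norm_mul, norm_neg] at e8
        have e9 : 7 * C ≤ ‖γ T - T + Real.exp x‖ := by
          have h1 := norm_sub_norm_le ((Real.exp x : RR) : ℂ) (-(γ T - T))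
          rw [norm_neg, Complex.norm_real, Real.norm_of_nonneg (Real.exp_pos x).le, sub_neg_eq_add, add_comm ((Real.exp x : RR):ℂ)] at h1
          linarith [hC T]
        have := hC T
        by_contra hcon
        rw [not_le] at hcon
        nlinarith [norm_nonneg (deriv (fun x => L (t, x)) x)]
      · have e1 : HasDerivAt (fun x => L (t, x)) (fD l (-1 + t * (R + 1), Real.exp x) (0, Real.exp x)) x := by
          have a1 := (hl.differentiable (by simp) (-1 + t * (R + 1), Real.exp x)).hasFDerivAt
          have a2 : HasDerivAt (fun x : RR => ((-1 + t * (R + 1), Real.exp x) : P2)) (0, Real.exp x) x :=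
            (hasDerivAt_const x _).prodMk (Real.hasDerivAt_exp x)
          exact a1.comp_hasDerivAt x a2
        rw [e1.deriv]
        have : ((0, Real.exp x) : P2) = Real.exp x • (0, 1) := by simp
        rw [this, map_smul, norm_smul, Real.norm_of_nonneg (Real.exp_pos x).le]
        have h1 := hM3 (-1 + t * (R + 1), Real.exp x) ⟨hT t ht, (Real.exp_pos x).le, hx.trans ha1⟩
        have h2 : Real.exp x ≤ 1 / (4 * (M3 + 1)) := hx.trans (min_le_left _ _)
        rw [le_div_iff₀ (by positivity)] at h2
        have := Real.exp_pos x
        nlinarith) (by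
      intro t ht x y hxy
      have := congrArg Complex.exp hxy
      simp only [hexpL] at this
      have := hinj (sub_right_injective this)
      exact Real.exp_injective (by linarith)) (by
      intro t ht x h0
      have e1 := (hasDerivAt_id (x:ℂ)).comp_ofReal.add (hLd t x) |>.cexp
      have e5 : HasDerivAt (fun x : RR => Complex.exp (x + L (t, x))) (Complex.exp (x + L (t, x)) * (1 + deriv (fun x => L (t, x)) x)) x := e1
      rw [h0, mul_zero] at e5
      set T := -1 + t * (R + 1) with hTdef
      have e3 : (fun x : RR => Complex.exp (x + L (t, x))) = fun x : RR => γ T - γ (T - Real.exp x) := by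
        ext x; exact hexpL t x
      rw [e3] at e5
      have e6 : HasDerivAt (fun x : RR => γ T - γ (T - Real.exp x)) (-((-Real.exp x) • deriv γ (T - Real.exp x))) x := by
        have a1 : HasDerivAt γ (deriv γ (T - Real.exp x)) (T - Real.exp x) :=
          (hγ.differentiable (by simp)).differentiableAt.hasDerivAt
        have a2 : HasDerivAt (fun x : RR => T - Real.exp x) (-Real.exp x) x := (Real.hasDerivAt_exp x).const_sub T
        exact (HasDerivAt.scomp x a1 a2).const_sub _
      have := e5.unique e6
      rw [neg_smul, neg_neg, eq_comm, smul_eq_zero] at this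
      rcases this with h | h
      · exact (Real.exp_pos x).ne' h
      · exact hd _ h) (by
      intro x
      simp only [L, zero_mul, add_zero]
      rw [hL1 (-1, Real.exp x) ⟨rfl, Real.exp_pos x⟩, hqm1 _ (Real.exp_pos x), Complex.log_one]) (by
      intro x hx
      have e : -1 + 1 * (R + 1) = R := by ring
      simp only [L, e]
      rw [hL3 (R, Real.exp x) ⟨rfl, Real.exp_pos x⟩, hqdiv _ _ (Real.exp_pos x).ne', hout R (by rw [le_abs]; left; linarith),
        hout (R - Real.exp x)]
      · have : ((Real.exp x : RR) : ℂ) ≠ 0 := by exact_mod_cast (Real.exp_pos x).ne'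
        push_cast at this ⊢
        rw [sub_sub_cancel, div_self this, Complex.log_one]
      · rw [le_abs]
        rcases hN0 x hx with h | h
        · right; linarith [(le_max_right (max H0 (8 * C)) (R + 1)).trans h]
        · left; linarith [h.trans (min_le_right (1 / (4 * (M3 + 1))) (R - 1))])
  refine ⟨Φ, hΦ, hΦi, fun s hs => ?_⟩
  have hs' : 0 < R - s := by linarith
  have hs'' : ((R - s : RR) : ℂ) ≠ 0 := by exact_mod_cast hs'.ne'
  rw [hΦL]
  have e : -1 + 1 * (R + 1) = R := by ring
  simp only [L, e]
  rw [Real.exp_log hs', hL3 (R, R - s) ⟨rfl, hs'⟩, ← Complex.log_ofReal_mul hs' (hqne _), ← hγq,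
    hout R (by rw [le_abs]; left; linarith), sub_sub_cancel]

theorem bend (b : RR) (hb : 1 ≤ b) : ∃ R0 : RR, ∀ R, R0 ≤ R → ∃ H : ℂ ≃ ℂ, IsD H ∧ (∀ z, b + 1 ≤ ‖z‖ → H z = z) ∧
    (∀ z, ‖z‖ ≤ b → H z = -R * Complex.log (1 - z / R)) ∧ ∀ s : RR, ∃ r : RR, H s = r := by
  let χ : ContDiffBump (0:ℂ) := ⟨b, b + 1, by linarith, by linarith⟩
  obtain ⟨C, hC⟩ : ∃ C, ∀ x, ‖fD χ x‖ ≤ C := by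
    have hcs : HasCompactSupport (fD χ) := χ.hasCompactSupport.fderiv RR
    exact hcs.exists_bound_of_continuous (χ.contDiff (n := 1) |>.continuous_fderiv (by simp))
  have hC0 : 0 ≤ C := (norm_nonneg _).trans (hC 0)
  refine ⟨4 * (b + 1) + 4 * C * (b + 1) ^ 2 + 1, fun R hR => ?_⟩
  have hRb : 2 * (b + 1) < R := by nlinarith [mul_nonneg hC0 (sq_nonneg (b + 1))]
  have hR0 : 0 < R := by linarith
  have hRc : (R:ℂ) ≠ 0 := by exact_mod_cast hR0.ne'
  let W : ℂ → ℂ := fun z => -R * Complex.log (1 - z / R) - z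
  have hnz : ∀ z : ℂ, ‖z‖ < R → ‖z / R‖ < 1 := by
    intro z hz
    rw [norm_div, Complex.norm_real, Real.norm_of_nonneg hR0.le, div_lt_one hR0]; exact hz
  have hslit : ∀ z : ℂ, ‖z‖ < R → 1 - z / R ∈ Complex.slitPlane := by
    intro z hz
    left
    have := (abs_lt.1 ((Complex.abs_re_le_norm _).trans_lt (hnz z hz))).2
    simp only [Complex.sub_re, Complex.one_re]; linarith
  have hWd : ∀ z : ℂ, ‖z‖ < R → HasDerivAt W ((z / R) / (1 - z / R)) z := by
    intro z hz
    have h1 : HasDerivAt (fun z : ℂ => 1 - z / R) (-(1 / R)) z := ((hasDerivAt_id z).div_const _).const_sub 1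
    have h2 := ((h1.clog (hslit z hz)).const_mul (-R : ℂ)).sub (hasDerivAt_id z)
    have h3 := Complex.slitPlane_ne_zero (hslit z hz)
    have e : -(R:ℂ) * (-(1 / R) / (1 - z / R)) - 1 = (z / R) / (1 - z / R) := by
      have e1 : -(R:ℂ) * (-(1 / R) / (1 - z / R)) = 1 / (1 - z / R) := by
        rw [mul_div_assoc', neg_mul_neg, mul_one_div_cancel hRc]
      rw [e1, div_sub_one h3, sub_sub_cancel]
    rw [e] at h2
    exact h2
  have hWdn : ∀ z : ℂ, ‖z‖ ≤ b + 1 → ‖(z / R) / (1 - z / R)‖ ≤ 2 * (b + 1) / R := by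
    intro z hz
    have h1 : ‖z / R‖ ≤ (b + 1) / R := by
      rw [norm_div, Complex.norm_real, Real.norm_of_nonneg hR0.le]; gcongr
    have h2 : (b + 1) / R ≤ 1 / 2 := by rw [div_le_div_iff₀ hR0 two_pos]; linarith
    have h3 : 1 / 2 ≤ ‖1 - z / R‖ := by
      have := norm_sub_norm_le (1:ℂ) (z / R)
      rw [norm_one] at this; linarith
    rw [norm_div, div_le_iff₀ (by linarith)]
    have : 2 * (b + 1) / R = 2 * ((b + 1) / R) := by ring
    rw [this]
    have : 0 ≤ (b + 1) / R := by positivity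
    nlinarith
  have hWn : ∀ z : ℂ, ‖z‖ ≤ b + 1 → ‖W z‖ ≤ 2 * (b + 1) ^ 2 / R := by
    intro z hz
    have := (convex_closedBall (0:ℂ) (b + 1)).norm_image_sub_le_of_norm_hasDerivWithin_le (f := W)
      (f' := fun z => (z / R) / (1 - z / R)) (C := 2 * (b + 1) / R) (x := 0) (y := z)
      (fun y hy => (hWd y (by have : ‖y‖ ≤ b + 1 := by simpa using hy
                              linarith)).hasDerivWithinAt)
      (fun y hy => hWdn y (by simpa using hy)) (by simp; linarith) (by simpa using hz)
    have hW0 : W 0 = 0 := by simp [W]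
    rw [hW0, sub_zero, sub_zero] at this
    refine this.trans ?_
    rw [div_mul_eq_mul_div]
    have h7 : 2 * (b + 1) * ‖z‖ ≤ 2 * (b + 1) ^ 2 := by nlinarith
    exact div_le_div_of_nonneg_right h7 hR0.le
  let V : ℂ → ℂ := fun z => χ z • W z
  have hV0 : ∀ z, b + 1 ≤ ‖z‖ → V z = 0 := by
    intro z hz
    have : χ z = 0 := χ.zero_of_le_dist (by simpa using hz)
    simp [V, this]
  have hVev : ∀ z, b + 1 < ‖z‖ → V =ᶠ[𝓝 z] fun _ => 0 := by
    intro z hz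
    have : ∀ᶠ y in 𝓝 z, b + 1 < ‖y‖ := continuous_norm.continuousAt.eventually (lt_mem_nhds hz)
    filter_upwards [this] with y hy using hV0 y hy.le
  have hWs : ∀ z, ‖z‖ < R → ContDiffAt RR ∞ W z := by
    intro z hz
    have h1 : ContDiffAt ℂ ∞ W z := by
      have := Complex.contDiffAt_log (n := ∞) (hslit z hz)
      have h2 : ContDiffAt ℂ ∞ (fun z : ℂ => 1 - z / R) z := by
        have : ContDiff ℂ ∞ (fun z : ℂ => 1 - z / R) := by fun_prop
        exact this.contDiffAt
      have h3 := ContDiffAt.comp z this h2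
      exact (contDiffAt_const.mul h3).sub contDiffAt_id
    exact h1.restrict_scalars RR
  have hV : CDi V := by
    rw [contDiff_iff_contDiffAt]
    intro z
    by_cases hz : ‖z‖ < R
    · exact χ.contDiffAt.smul (hWs z hz)
    · exact contDiffAt_const.congr_of_eventuallyEq (hVev z (by linarith))
  obtain ⟨H, hH, hHV⟩ := isD_small V hV (by
    intro z
    by_cases hz : ‖z‖ ≤ b + 1
    · have h1 := (hWd z (by linarith)).complexToReal_fderiv
      have h2 : HasFDerivAt χ (fD χ z) z := ((χ.contDiff (n := 1)).differentiable (by simp) z).hasFDerivAt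
      have h3 := (h2.smul h1).fderiv
      have h4 : fD V z = _ := h3
      rw [h4]
      refine (norm_add_le _ _).trans ?_
      have b1 : ‖χ z • ((z / R) / (1 - z / R)) • (1 : ℂ →L[RR] ℂ)‖ ≤ 1 * (2 * (b + 1) / R * 1) := by
        rw [norm_smul, norm_smul]
        gcongr
        · rw [Real.norm_of_nonneg χ.nonneg]; exact χ.le_one
        · exact hWdn z hz
        · exact ContinuousLinearMap.norm_id_le
      have b2 : ‖(fD χ z).smulRight (W z)‖ ≤ C * (2 * (b + 1) ^ 2 / R) := by
        rw [ContinuousLinearMap.norm_smulRight_apply]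
        gcongr
        · exact hC z
        · exact hWn z hz
      refine (add_le_add b1 b2).trans ?_
      have : 1 * (2 * (b + 1) / R * 1) + C * (2 * (b + 1) ^ 2 / R) = (2 * (b + 1) + 2 * C * (b + 1) ^ 2) / R := by ring
      rw [this, div_le_div_iff₀ hR0 two_pos]
      linarith
    · rw [(hVev z (not_le.1 hz)).fderiv_eq]; simp) (b + 1) hV0
  refine ⟨H, hH, fun z hz => by rw [hHV, hV0 z hz, add_zero], fun z hz => ?_, fun s => ?_⟩
  · have : χ z = 1 := χ.one_of_mem_closedBall (by simpa using hz)
    rw [hHV]; simp only [V, this, one_smul, W]; ring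
  · rw [hHV]
    by_cases hs : |s| < R
    · refine ⟨s + χ s * (-R * Real.log (1 - s / R) - s), ?_⟩
      have : 0 ≤ 1 - s / R := by
        rw [sub_nonneg, div_le_one hR0]; exact (le_abs_self s).trans hs.le
      simp only [V, W, Complex.real_smul]
      push_cast
      rw [Complex.ofReal_log this]
      push_cast
      rfl
    · refine ⟨s, ?_⟩
      rw [hV0 _ (by rw [Complex.norm_real]; simp only [Real.norm_eq_abs]; linarith), add_zero]

theorem long_line (γ : RR → ℂ) (hγ : CDi γ) (hinj : Function.Injective γ)
    (hd : ∀ s, deriv γ s ≠ 0) (hout : ∀ s, 1 ≤ |s| → γ s = s) :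
    ∃ Φ : ℂ ≃ ℂ, IsD Φ ∧ (∃ R', ∀ z, R' ≤ ‖z‖ → Φ z = z) ∧ ∀ s : RR, Φ s = γ s := by
  have hcpt : IsCompact {s : RR | |s| ≤ 1} := by
    have : {s : RR | |s| ≤ 1} = Metric.closedBall 0 1 := by ext; simp
    rw [this]; exact isCompact_closedBall _ _
  obtain ⟨B0, hB0⟩ := hcpt.exists_bound_of_continuousOn hγ.continuous.continuousOn
  let B := max B0 1
  have hB : ∀ s, |s| ≤ 1 → ‖γ s‖ ≤ B := fun s hs => (hB0 s hs).trans (le_max_left _ _)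
  have hB1 : 1 ≤ B := le_max_right _ _
  obtain ⟨R0, hR0⟩ := bend B hB1
  let R := max R0 (B + 2)
  have hRB : B + 2 ≤ R := le_max_right _ _
  have hRpos : 0 < R := by linarith
  have hRc : (R:ℂ) ≠ 0 := by exact_mod_cast hRpos.ne'
  obtain ⟨H, hH, hHi, hHb, hHr⟩ := hR0 R (le_max_left _ _)
  have hre : ∀ s < R, 0 < (R - γ s).re := by
    intro s hs
    by_cases h : |s| ≤ 1
    · have := (abs_le.1 ((Complex.abs_re_le_norm _).trans (hB s h))).2
      simp only [Complex.sub_re, Complex.ofReal_re]; linarith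
    · rw [hout s (not_le.1 h).le]
      simp only [Complex.sub_re, Complex.ofReal_re]; linarith
  obtain ⟨Φ1, hΦ1, ⟨R1, hR1⟩, hΦ1L⟩ := long_main γ hγ hinj hd hout (B + 1) (by linarith) (by
    intro s
    by_cases h : |s| ≤ 1
    · refine (norm_sub_le _ _).trans ?_
      rw [Complex.norm_real]; exact add_le_add (hB s h) h
    · rw [hout s (not_le.1 h).le, sub_self, norm_zero]; linarith) R (by linarith) hre
  let A : ℂ ≃ ℂ := (Equiv.subRight (Real.log R : ℂ)).trans (Equiv.mulRight₀ (-R : ℂ) (neg_ne_zero.2 hRc))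
  have hAD : IsD A := (isD_sub _).trans (isD_mul _ _)
  have hA : ∀ w, A w = (w - Real.log R) * (-R) := fun w => rfl
  have hAlog : ∀ z : ℂ, 0 < (R - z).re → A (Complex.log (R - z)) = -R * Complex.log (1 - z / R) := by
    intro z hz
    have h1 : (R:ℂ) - z = (R:RR) * (1 - z / R) := by field_simp
    have h2 : (1:ℂ) - z / R ≠ 0 := by
      intro h; rw [h, mul_zero] at h1; rw [h1] at hz; simp at hz
    rw [h1, Complex.log_ofReal_mul hRpos h2, hA]; ring
  have hlogr : ∀ s < R, (Real.log (R - s) : ℂ) = Complex.log (R - s) := by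
    intro s hs
    rw [Complex.ofReal_log (by linarith)]; push_cast; rfl
  have hres : ∀ s < R, 0 < ((R:ℂ) - s).re := by
    intro s hs; simp; linarith
  let P : ℂ ≃ ℂ := (A.symm.trans Φ1).trans A
  have hP : ∀ s < R, P (-R * Complex.log (1 - s / R)) = -R * Complex.log (1 - γ s / R) := by
    intro s hs
    rw [← hAlog s (hres s hs), ← hAlog _ (hre s hs)]
    simp only [P, Equiv.trans_apply, Equiv.symm_apply_apply]
    rw [← hlogr s hs, hΦ1L s hs]
  refine ⟨(H.trans P).trans H.symm, (hH.trans ((hAD.symm.trans hΦ1).trans hAD)).trans hH.symm, ?_, ?_⟩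
  · refine ⟨max (B + 1) ((R1 + ‖(Real.log R : ℂ)‖) * R), fun z hz => ?_⟩
    have h1 := hHi z ((le_max_left _ _).trans hz)
    simp only [Equiv.trans_apply]
    rw [Equiv.symm_apply_eq, h1]
    have h2 : A.symm z = z * (-R:ℂ)⁻¹ + Real.log R := rfl
    have h3 : Φ1 (A.symm z) = A.symm z := by
      apply hR1
      have h4 := (le_max_right _ _).trans hz
      have h5 := norm_sub_norm_le (z * (-R:ℂ)⁻¹) (-(Real.log R : ℂ))
      rw [sub_neg_eq_add, ← h2, norm_neg, norm_mul, norm_inv, norm_neg, Complex.norm_real R, Real.norm_of_nonneg hRpos.le, ← div_eq_mul_inv] at h5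
      rw [← le_div_iff₀ hRpos] at h4
      linarith
    simp only [P, Equiv.trans_apply, h3, Equiv.apply_symm_apply]
  · intro s
    simp only [Equiv.trans_apply]
    rw [Equiv.symm_apply_eq]
    by_cases hs : |s| ≤ 1
    · have hsR : s < R := by linarith [le_abs_self s]
      rw [hHb s (by rw [Complex.norm_real]; exact hs.trans hB1), hP s hsR, hHb _ (hB s hs)]
    · have hs := (not_le.1 hs).le
      rw [hout s hs]
      obtain ⟨r, hr⟩ := hHr s
      rw [hr]
      let s' : RR := R * (1 - Real.exp (-r / R))
      have hs'R : s' < R := by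
        have := Real.exp_pos (-r / R)
        simp only [s']; nlinarith
      have e1 : (-R * Complex.log (1 - s' / R) : ℂ) = r := by
        have : (1:ℂ) - s' / R = ((Real.exp (-r / R) : RR) : ℂ) := by
          simp only [s']; push_cast; field_simp; ring
        rw [this, ← Complex.ofReal_log (Real.exp_pos _).le, Real.log_exp]
        push_cast; field_simp
      have hs'1 : 1 ≤ |s'| := by
        by_contra hcon
        have hcon := not_le.1 hcon
        have e2 := hHb s' (by rw [Complex.norm_real]; exact hcon.le.trans hB1)
        rw [e1, ← hr] at e2
        have e3 : s' = s := by exact_mod_cast H.injective e2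
        rw [e3] at hcon; linarith
      have e4 := hP s' hs'R
      rw [hout s' hs'1, e1] at e4
      exact e4


theorem ode_global (X : ℂ → ℂ) (B : NNReal) (hB : ∀ z, ‖X z‖ ≤ B) (K : NNReal) (hK : LipschitzWith K X) (p : ℂ) :
    ∃ c : RR → ℂ, c 0 = p ∧ ∀ t, HasDerivAt c (X (c t)) t := by
  have hloc : ∀ T : RR, 0 < T → ∃ c : RR → ℂ, c 0 = p ∧ ∀ t ∈ Ioo (-T) T, HasDerivAt c (X (c t)) t := by
    intro T hT
    have h0 : (0:RR) ∈ Icc (-T) T := ⟨by linarith, hT.le⟩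
    have hPL : IsPicardLindelof (fun _ => X) (⟨0, h0⟩ : Icc (-T) T) p (B * NNReal.mk T hT.le) 0 B K :=
      { lipschitzOnWith := fun t _ => hK.lipschitzOnWith
        continuousOn := fun x _ => continuousOn_const
        norm_le := fun t _ x _ => hB x
        mul_max_le := by simp }
    obtain ⟨α, h1, h2⟩ := hPL.exists_eq_forall_mem_Icc_hasDerivWithinAt₀
    exact ⟨α, h1, fun t ht => (h2 t (Ioo_subset_Icc_self ht)).hasDerivAt (Icc_mem_nhds ht.1 ht.2)⟩
  choose! γ h0 hd using hloc
  have huniq : ∀ T T' : RR, 0 < T → T ≤ T' → ∀ t ∈ Ioo (-T) T, γ T t = γ T' t := by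
    intro T T' hT hTT t ht
    exact ODE_solution_unique_of_mem_Ioo (v := fun _ => X) (s := fun _ => univ) (K := K) (t₀ := 0)
      (fun t _ => hK.lipschitzOnWith) ⟨by linarith, hT⟩ (fun t ht => ⟨hd T hT t ht, trivial⟩)
      (fun t ht => ⟨hd T' (by linarith) t ⟨by linarith [ht.1], by linarith [ht.2]⟩, trivial⟩)
      ((h0 T hT).trans (h0 T' (by linarith)).symm) ht
  refine ⟨fun t => γ (|t| + 1) t, h0 _ (by positivity), fun t => ?_⟩
  have ht : t ∈ Ioo (-(|t| + 2)) (|t| + 2) := ⟨by linarith [neg_abs_le t], by linarith [le_abs_self t]⟩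
  have h1 := hd (|t| + 2) (by positivity) t ht
  have e : ∀ s, |s| < |t| + 1 → γ (|s| + 1) s = γ (|t| + 2) s := by
    intro s hs
    exact huniq _ _ (by positivity) (by linarith) s ⟨by linarith [neg_abs_le s], by linarith [le_abs_self s]⟩
  have h2 : (fun s => γ (|s| + 1) s) =ᶠ[𝓝 t] γ (|t| + 2) := by
    have : ∀ᶠ s in 𝓝 t, |s| < |t| + 1 := continuous_abs.continuousAt.eventually (gt_mem_nhds (by linarith))
    filter_upwards [this] with s hs using e s hs
  have h3 := h1.congr_of_eventuallyEq h2
  rw [← e t (by linarith)] at h3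
  exact h3

theorem ode_smooth (X : ℂ → ℂ) (hX : CDi X) (c : RR → ℂ) (hc : ∀ t, HasDerivAt c (X (c t)) t) :
    CDi c := by
  rw [contDiff_infty]
  intro n
  induction n with
  | zero => exact contDiff_zero.2 (continuous_iff_continuousAt.2 fun t => (hc t).continuousAt)
  | succ n ih =>
    push_cast
    rw [contDiff_succ_iff_deriv]
    refine ⟨fun t => (hc t).differentiableAt, by simp, ?_⟩
    have : deriv c = X ∘ c := funext fun t => (hc t).deriv
    rw [this]
    exact (hX.of_le (by exact_mod_cast le_top)).comp ih

theorem fderiv_complex_apply (g : ℂ → RR) (z w : ℂ) :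
    fD g z w = w.re * fD g z 1 + w.im * fD g z Complex.I := by
  conv_lhs => rw [← Complex.re_add_im w]
  have e1 : (w.re : ℂ) = w.re • (1:ℂ) := by simp
  have e2 : (w.im : ℂ) * Complex.I = w.im • Complex.I := by simp
  rw [e1, e2, map_add, map_smul, map_smul]; simp

theorem level_field (g : ℂ → RR) (hg : CDi g) (hcpt : IsCompact {z | g z = 0})
    (hreg : ∀ z, g z = 0 → fD g z ≠ 0) :
    ∃ X : ℂ → ℂ, CDi X ∧ (∃ B : NNReal, ∀ z, ‖X z‖ ≤ B) ∧ (∃ K, LipschitzWith K X) ∧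
      (∀ z, fD g z (X z) = 0) ∧ ∀ z, g z = 0 → X z ≠ 0 := by
  obtain ⟨r, hr⟩ := hcpt.isBounded.exists_norm_le
  let χ : ContDiffBump (0:ℂ) := ⟨|r| + 1, |r| + 2, by positivity, by linarith⟩
  let X : ℂ → ℂ := fun z => χ z • (-(fD g z Complex.I : ℂ) + (fD g z 1 : ℂ) * Complex.I)
  have hf : CDi (fD g) := hg.fderiv_right (by simp)
  have hX : CDi X := by
    refine χ.contDiff.smul (ContDiff.add ?_ (ContDiff.mul ?_ contDiff_const))
    · exact (Complex.ofRealCLM.contDiff.comp (hf.clm_apply contDiff_const)).neg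
    · exact Complex.ofRealCLM.contDiff.comp (hf.clm_apply contDiff_const)
  have hcs : HasCompactSupport X := χ.hasCompactSupport.smul_right
  refine ⟨X, hX, ?_, ContDiff.lipschitzWith_of_hasCompactSupport hcs hX (by simp), ?_, ?_⟩
  · obtain ⟨B, hB⟩ := hcs.exists_bound_of_continuous hX.continuous
    exact ⟨⟨|B|, abs_nonneg _⟩, fun z => (hB z).trans (le_abs_self _)⟩
  · intro z
    simp only [X, map_smul]
    rw [fderiv_complex_apply]
    simp
    right; ring
  · intro z hz h
    have h1 : χ z = 1 := χ.one_of_mem_closedBall (by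
      simp only [mem_closedBall_zero_iff]
      show ‖z‖ ≤ |r| + 1
      linarith [hr z hz, le_abs_self r])
    simp only [X, h1, one_smul] at h
    have hre := congrArg Complex.re h
    have him := congrArg Complex.im h
    simp at hre him
    apply hreg z hz
    ext w
    rw [fderiv_complex_apply, hre, him]; simp

theorem orbit_nhds (g : ℂ → RR) (hg : CDi g) (X : ℂ → ℂ) (c : RR → ℂ) (hc : CDi c)
    (hcX : ∀ t, HasDerivAt c (X (c t)) t) (hgX : ∀ z, fD g z (X z) = 0)
    (hcg : ∀ t, g (c t) = 0) (t0 : RR) (h0 : X (c t0) ≠ 0) (hreg : fD g (c t0) ≠ 0) :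
    ∀ N ∈ 𝓝 t0, ∀ᶠ z in 𝓝 (c t0), g z = 0 → ∃ t ∈ N, c t = z := by
  intro N hN
  set q := c t0 with hq
  set x := X q with hx
  let l : ℂ →L[RR] RR := x.re • Complex.reCLM + x.im • Complex.imCLM
  have hl : ∀ w, l w = x.re * w.re + x.im * w.im := fun w => rfl
  let Θ : ℂ → P2 := fun z => (l z, g z)
  have hΘ : CDi Θ := l.contDiff.prodMk hg
  have hgd : HasFDerivAt g (fD g q) q := (hg.differentiable (by simp) q).hasFDerivAt
  have hΘd : HasFDerivAt Θ (l.prod (fD g q)) q := l.hasFDerivAt.prodMk hgd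
  have hxx : 0 < x.re * x.re + x.im * x.im := by
    have := Complex.normSq_pos.2 h0
    rwa [Complex.normSq_apply] at this
  have hinj : Function.Injective (l.prod (fD g q)) := by
    rw [injective_iff_map_eq_zero]
    intro w hw
    rw [ContinuousLinearMap.prod_apply, Prod.mk_eq_zero] at hw
    obtain ⟨h1, h2⟩ := hw
    rw [hl] at h1
    have h3 := hgX q
    rw [fderiv_complex_apply] at h2 h3
    rw [← hx] at h3
    set A := fD g q 1
    set B := fD g q Complex.I
    by_contra hw0
    have hww : 0 < w.re * w.re + w.im * w.im := by
      have := Complex.normSq_pos.2 hw0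
      rwa [Complex.normSq_apply] at this
    have hA : A * ((x.re * x.re + x.im * x.im) * (w.re * w.re + w.im * w.im)) = 0 := by
      linear_combination ((x.im * w.re-x.re*w.im)*(-w.im)) * h3 + (x.im * w.re-x.re*w.im)*x.im * h2 + A * (x.re*w.re+x.im*w.im) * h1
    have hB : B * ((x.re * x.re + x.im * x.im) * (w.re * w.re + w.im * w.im)) = 0 := by
      linear_combination ((x.im * w.re-x.re*w.im)*(w.re)) * h3 - (x.im * w.re-x.re*w.im)*x.re * h2 + B * (x.re*w.re+x.im*w.im) * h1
    have hne := (mul_pos hxx hww).ne'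
    have hA' := (mul_eq_zero.1 hA).resolve_right hne
    have hB' := (mul_eq_zero.1 hB).resolve_right hne
    apply hreg
    ext v
    rw [fderiv_complex_apply]
    change v.re * A + v.im * B = 0
    rw [hA', hB']; simp
  obtain ⟨θ, hθ1, hθ2⟩ := local_leftInv Θ q (Eventually.of_forall fun x => hΘ.contDiffAt) (by rw [hΘd.fderiv]; exact hinj)
  have hτ : HasStrictDerivAt (fun t => l (c t)) (x.re * x.re + x.im * x.im) t0 := by
    have h1 : HasStrictDerivAt c x t0 := by
      have := (hc.contDiffAt (x := t0)).hasStrictDerivAt (by simp)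
      rwa [(hcX t0).deriv] at this
    have := (l.hasStrictFDerivAt (x := c t0)).comp_hasStrictDerivAt t0 h1
    rwa [hl] at this
  have hmap := hτ.map_nhds_eq hxx.ne'
  have hN' : N ∩ {t | θ (Θ (c t)) = c t} ∈ 𝓝 t0 := by
    apply inter_mem hN
    exact (hc.continuous.continuousAt (x := t0)).eventually hθ2
  have him : (fun t => l (c t)) '' (N ∩ {t | θ (Θ (c t)) = c t}) ∈ 𝓝 (l q) := by
    rw [hq, ← hmap]; exact image_mem_map hN'
  have h4 := (l.continuous.continuousAt (x := q)).eventually him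
  filter_upwards [h4, hθ2] with z hz hz2 hgz
  obtain ⟨t, ⟨ht, ht2⟩, ht3⟩ := hz
  refine ⟨t, ht, ?_⟩
  have e : Θ (c t) = Θ z := Prod.ext ht3 (by simp only [Θ]; rw [hcg, hgz])
  rw [← ht2, e, hz2]

theorem level_param (g : ℂ → RR) (hg : CDi g) (hcpt : IsCompact {z | g z = 0})
    (hconn : IsConnected {z | g z = 0}) (hreg : ∀ z, g z = 0 → fD g z ≠ 0) :
    ∃ c : RR → ℂ, CDi c ∧ (∀ t, deriv c t ≠ 0) ∧
      (∀ u v, c u = c v ↔ ∃ n : ℤ, u - v = n * PI) ∧ range c = {z | g z = 0} := by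
  obtain ⟨X, hX, ⟨B, hB⟩, ⟨K, hK⟩, hgX, hX0⟩ := level_field g hg hcpt hreg
  have hex : ∀ p, ∃ c : RR → ℂ, c 0 = p ∧ ∀ t, HasDerivAt c (X (c t)) t := ode_global X B hB K hK
  have hin : ∀ c : RR → ℂ, (∀ t, HasDerivAt c (X (c t)) t) → g (c 0) = 0 → ∀ t, g (c t) = 0 := by
    intro c hc h0 t
    have hd : ∀ t, HasDerivAt (fun t => g (c t)) 0 t := by
      intro t
      have := ((hg.differentiable (by simp) (c t)).hasFDerivAt).comp_hasDerivAt t (hc t)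
      rwa [hgX] at this
    have := is_const_of_deriv_eq_zero (fun t => (hd t).differentiableAt) (fun t => (hd t).deriv) t 0
    simpa [h0] using this
  have hun : ∀ c c' : RR → ℂ, (∀ t, HasDerivAt c (X (c t)) t) → (∀ t, HasDerivAt c' (X (c' t)) t) →
      ∀ a b, c a = c' b → ∀ t, c (a + t) = c' (b + t) := by
    intro c c' hc hc' a b hab t
    have := ODE_solution_unique_univ (v := fun _ => X) (s := fun _ => univ) (K := K) (t₀ := 0)
      (f := fun t => c (a + t)) (g := fun t => c' (b + t)) (fun t => hK.lipschitzOnWith)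
      (fun t => ⟨(hc (a + t)).comp_const_add a t, trivial⟩) (fun t => ⟨(hc' (b + t)).comp_const_add b t, trivial⟩)
      (by simpa using hab)
    exact congrFun this t
  have hnb : ∀ c : RR → ℂ, (∀ t, HasDerivAt c (X (c t)) t) → g (c 0) = 0 → ∀ t0,
      ∀ N ∈ 𝓝 t0, ∀ᶠ z in 𝓝 (c t0), g z = 0 → ∃ t ∈ N, c t = z := fun c hc h0 t0 =>
    orbit_nhds g hg X c (ode_smooth X hX c hc) hc hgX (hin c hc h0) t0 (hX0 _ (hin c hc h0 t0)) (hreg _ (hin c hc h0 t0))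
  obtain ⟨p, hp⟩ := hconn.1
  obtain ⟨c, hc0, hc⟩ := hex p
  have hcs := ode_smooth X hX c hc
  have hg0 : g (c 0) = 0 := by rw [hc0]; exact hp
  have hcg := hin c hc hg0
  have hrange : range c = {z | g z = 0} := by
    apply subset_antisymm
    · rintro _ ⟨t, rfl⟩; exact hcg t
    · by_contra hcon
      obtain ⟨z, hz, hzr⟩ := not_subset.1 hcon
      let U := {z | ∀ᶠ y in 𝓝 z, g y = 0 → y ∈ range c}
      let V := {z | ∀ᶠ y in 𝓝 z, g y = 0 → y ∉ range c}
      have hU : IsOpen U := isOpen_iff_mem_nhds.2 fun z hz => (eventually_eventually_nhds.2 hz)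
      have hV : IsOpen V := isOpen_iff_mem_nhds.2 fun z hz => (eventually_eventually_nhds.2 hz)
      have hUmem : ∀ z ∈ range c, z ∈ U := by
        rintro _ ⟨t, rfl⟩
        filter_upwards [hnb c hc hg0 t univ univ_mem] with y hy hgy
        obtain ⟨t, -, ht⟩ := hy hgy; exact ⟨t, ht⟩
      have hVmem : ∀ z, g z = 0 → z ∉ range c → z ∈ V := by
        intro z hgz hzr
        obtain ⟨c', hc'0, hc'⟩ := hex z
        have := hnb c' hc' (by rw [hc'0]; exact hgz) 0 univ univ_mem
        rw [hc'0] at this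
        filter_upwards [this] with y hy hgy hyr
        obtain ⟨t, -, ht⟩ := hy hgy
        obtain ⟨s, hs⟩ := hyr
        apply hzr
        refine ⟨s + -t, ?_⟩
        rw [hun c c' hc hc' s t (hs.trans ht.symm), add_neg_cancel, hc'0]
      obtain ⟨y, hy, hyU, hyV⟩ := hconn.2 U V hU hV (fun z hz => by
        by_cases h : z ∈ range c
        · exact Or.inl (hUmem z h)
        · exact Or.inr (hVmem z hz h)) ⟨p, hp, hUmem p ⟨0, hc0⟩⟩ ⟨z, hz, hVmem z hz hzr⟩
      exact hyV.self_of_nhds hy (hyU.self_of_nhds hy)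
  have hXne : ∀ t, X (c t) ≠ 0 := fun t => hX0 _ (hcg t)
  have hnoninj : ∃ a b, a ≠ b ∧ c a = c b := by
    by_contra hcon
    have hinj : Function.Injective c := by
      intro a b h; by_contra hne; exact hcon ⟨a, b, hne, h⟩
    obtain ⟨q, hq, φ, hφ, hlim⟩ := hcpt.tendsto_subseq (x := fun n : ℕ => c n) (fun n => hcg n)
    rw [← hrange] at hq
    obtain ⟨t0, rfl⟩ := hq
    have h1 := hnb c hc hg0 t0 (Iio (t0 + 1)) (Iio_mem_nhds (by linarith))
    have h2 := hlim.eventually h1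
    have h3 : ∀ᶠ n in atTop, t0 + 1 ≤ ((φ n : ℕ) : RR) :=
      (tendsto_natCast_atTop_atTop.comp hφ.tendsto_atTop).eventually (eventually_ge_atTop (t0 + 1))
    obtain ⟨n, hn1, hn2⟩ := (h2.and h3).exists
    obtain ⟨t, ht, hte⟩ := hn1 (hcg _)
    have := hinj hte
    rw [this] at ht
    exact absurd ht (not_lt.2 hn2)
  let H : AddSubgroup RR :=
    { carrier := {T | ∀ u, c (u + T) = c u}
      add_mem' := fun {a b} ha hb u => by rw [← add_assoc, hb, ha]
      zero_mem' := fun u => by rw [add_zero]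
      neg_mem' := fun {a} ha u => by rw [← ha (u + -a), neg_add_cancel_right] }
  have hH : ∀ a b, c a = c b ↔ a - b ∈ H := by
    intro a b
    constructor
    · intro h u
      have := hun c c hc hc a b h (u - b)
      rw [add_sub_cancel] at this
      rw [← this]; congr 1; ring
    · intro h
      have := h b
      rw [add_sub_cancel] at this; exact this
  have hHc : IsClosed (H : Set RR) := by
    have : (H : Set RR) = ⋂ u, {T | c (u + T) = c u} := by ext; simp [H]
    rw [this]
    exact isClosed_iInter fun u => isClosed_eq (hcs.continuous.comp (continuous_const.add continuous_id)) continuous_const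
  obtain ⟨T, hT⟩ : ∃ T, H = AddSubgroup.zmultiples T := by
    rcases H.dense_or_cyclic with h | ⟨a, ha⟩
    · exfalso
      have hu : (H : Set RR) = univ := by rw [← hHc.closure_eq]; exact h.closure_eq
      have hconst : c = fun _ => c 0 := by
        funext t
        rw [hH]; rw [← SetLike.mem_coe, hu]; trivial
      have h1 := (hc 0).deriv
      rw [hconst, deriv_const] at h1
      exact hXne 0 h1.symm
    · exact ⟨a, by rw [ha, AddSubgroup.zmultiples_eq_closure]⟩
  have hT0 : T ≠ 0 := by
    rintro rfl
    obtain ⟨a, b, hab, h⟩ := hnoninj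
    rw [hH, hT] at h
    simp at h
    exact hab (sub_eq_zero.1 h)
  have hpi := Real.pi_pos.ne'
  refine ⟨fun u => c (u * (T / PI)), hcs.comp (contDiff_id.mul contDiff_const), fun t => ?_, fun u v => ?_, ?_⟩
  · have h1 : HasDerivAt (fun u : RR => u * (T / PI)) (1 * (T / PI)) t := (hasDerivAt_id t).mul_const _
    have := (HasDerivAt.scomp t (hc _) h1).deriv
    have h2 : deriv (fun u => c (u * (T / PI))) t = _ := this
    rw [h2, one_mul]
    exact smul_ne_zero (div_ne_zero hT0 hpi) (hXne _)
  · rw [hH, hT, AddSubgroup.mem_zmultiples_iff]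
    apply exists_congr
    intro n
    rw [zsmul_eq_mul]
    constructor
    · intro h
      have : n * T = (u - v) * T / PI := by rw [h]; ring
      field_simp at this
      linarith
    · intro h
      have : u * (T / PI) - v * (T / PI) = (u - v) * (T / PI) := by ring
      rw [this, h]; field_simp
  · rw [← hrange]
    apply subset_antisymm
    · rintro _ ⟨u, rfl⟩; exact ⟨_, rfl⟩
    · rintro _ ⟨u, rfl⟩
      exact ⟨u * (PI / T), by simp only; congr 1; field_simp⟩


structure IsChart (U V : Set ℂ) (Ψ Ψ' : ℂ → ℂ) : Prop where
  oU : IsOpen U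
  oV : IsOpen V
  s1 : ContDiffOn RR ∞ Ψ U
  s2 : ContDiffOn RR ∞ Ψ' V
  m1 : ∀ z ∈ U, Ψ z ∈ V
  m2 : ∀ z ∈ V, Ψ' z ∈ U
  l : ∀ z ∈ U, Ψ' (Ψ z) = z
  r : ∀ z ∈ V, Ψ (Ψ' z) = z

theorem IsChart.pre {U V : Set ℂ} {Ψ Ψ' : ℂ → ℂ} (h : IsChart U V Ψ Ψ') (Φ : ℂ ≃ ℂ) (hΦ : IsD Φ) :
    IsChart (Φ ⁻¹' U) V (fun z => Ψ (Φ z)) (fun z => Φ.symm (Ψ' z)) where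
  oU := h.oU.preimage hΦ.1.continuous
  oV := h.oV
  s1 := h.s1.comp hΦ.1.contDiffOn (fun z hz => hz)
  s2 := hΦ.2.comp_contDiffOn h.s2
  m1 := fun z hz => h.m1 _ hz
  m2 := fun z hz => by simp only [mem_preimage, Equiv.apply_symm_apply]; exact h.m2 z hz
  l := fun z hz => by rw [h.l _ hz, Equiv.symm_apply_apply]
  r := fun z hz => by rw [Equiv.apply_symm_apply, h.r z hz]

theorem IsChart.post {U V : Set ℂ} {Ψ Ψ' : ℂ → ℂ} (h : IsChart U V Ψ Ψ') (Φ : ℂ ≃ ℂ) (hΦ : IsD Φ) :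
    IsChart U (Φ.symm ⁻¹' V) (fun z => Φ (Ψ z)) (fun z => Ψ' (Φ.symm z)) where
  oU := h.oU
  oV := h.oV.preimage hΦ.2.continuous
  s1 := hΦ.1.comp_contDiffOn h.s1
  s2 := h.s2.comp hΦ.2.contDiffOn (fun z hz => hz)
  m1 := fun z hz => by simp only [mem_preimage, Equiv.symm_apply_apply]; exact h.m1 z hz
  m2 := fun z hz => h.m2 _ hz
  l := fun z hz => by rw [Equiv.symm_apply_apply, h.l z hz]
  r := fun z hz => by rw [h.r _ hz, Equiv.apply_symm_apply]

open Classical in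
noncomputable def chartF (Φ : ℂ ≃ ℂ) (z : ℂ) : ℂ :=
  if z = 0 then 1 else (Φ.symm z⁻¹ - Complex.I) / (Φ.symm z⁻¹ + Complex.I)

open Classical in
noncomputable def chartG (Φ : ℂ ≃ ℂ) (y : ℂ) : ℂ :=
  if y = 1 then 0 else (Φ (Complex.I * (1 + y) / (1 - y)))⁻¹

def chartU (Φ : ℂ ≃ ℂ) : Set ℂ := {z | z = 0 ∨ Φ.symm z⁻¹ + Complex.I ≠ 0}

def chartV (Φ : ℂ ≃ ℂ) : Set ℂ := {y | y = 1 ∨ Φ (Complex.I * (1 + y) / (1 - y)) ≠ 0}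

theorem cayley1 (w : ℂ) (hw : w + Complex.I ≠ 0) : (w - Complex.I) / (w + Complex.I) ≠ 1 := by
  intro h
  rw [div_eq_one_iff_eq hw] at h
  have := congrArg Complex.im h
  simp at this; linarith

theorem cayley2 (w : ℂ) (hw : w + Complex.I ≠ 0) :
    Complex.I * (1 + (w - Complex.I) / (w + Complex.I)) / (1 - (w - Complex.I) / (w + Complex.I)) = w := by
  have h1 : 1 + (w - Complex.I) / (w + Complex.I) = 2 * w / (w + Complex.I) := by
    rw [eq_div_iff hw, add_mul, div_mul_cancel₀ _ hw]; ring
  have h2 : 1 - (w - Complex.I) / (w + Complex.I) = 2 * Complex.I / (w + Complex.I) := by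
    rw [eq_div_iff hw, sub_mul, div_mul_cancel₀ _ hw]; ring
  rw [h1, h2]
  have := Complex.I_ne_zero
  rw [mul_div_assoc', div_div_div_cancel_right₀ hw]
  field_simp

theorem cayley3 (y : ℂ) (hy : y ≠ 1) : Complex.I * (1 + y) / (1 - y) + Complex.I ≠ 0 := by
  have h : 1 - y ≠ 0 := sub_ne_zero.2 (Ne.symm hy)
  have h1 : Complex.I * (1 + y) / (1 - y) + Complex.I = 2 * Complex.I / (1 - y) := by
    rw [eq_div_iff h, add_mul, div_mul_cancel₀ _ h]; ring
  rw [h1]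
  exact div_ne_zero (by simp) h

theorem cayley4 (y : ℂ) (hy : y ≠ 1) :
    (Complex.I * (1 + y) / (1 - y) - Complex.I) / (Complex.I * (1 + y) / (1 - y) + Complex.I) = y := by
  have h : 1 - y ≠ 0 := sub_ne_zero.2 (Ne.symm hy)
  rw [div_eq_iff (cayley3 y hy)]
  have h1 : Complex.I * (1 + y) / (1 - y) + Complex.I = 2 * Complex.I / (1 - y) := by
    rw [eq_div_iff h, add_mul, div_mul_cancel₀ _ h]; ring
  have h2 : Complex.I * (1 + y) / (1 - y) - Complex.I = 2 * Complex.I * y / (1 - y) := by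
    rw [eq_div_iff h, sub_mul, div_mul_cancel₀ _ h]; ring
  rw [h1, h2]; ring

theorem cayley5 (w : ℂ) (hw : w + Complex.I ≠ 0) : ‖(w - Complex.I) / (w + Complex.I)‖ ≤ 1 ↔ 0 ≤ w.im := by
  rw [norm_div, div_le_one (norm_pos_iff.2 hw), ← sq_le_sq₀ (norm_nonneg _) (norm_nonneg _), Complex.sq_norm, Complex.sq_norm,
    Complex.normSq_apply, Complex.normSq_apply]
  simp
  constructor <;> intro h <;> nlinarith

theorem chart_of_line (Φ : ℂ ≃ ℂ) (hΦ : IsD Φ) (σ : ℂ ≃L[RR] ℂ) (hσi : ∀ z, σ z⁻¹ = (σ z)⁻¹) (hσn : ∀ z, ‖σ z‖ = ‖z‖)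
    (hσσ : ∀ z, σ (σ z) = z) (R : RR) (hR : ∀ z, R ≤ ‖z‖ → Φ z = σ z) :
    IsChart (chartU Φ) (chartV Φ) (chartF Φ) (chartG Φ) := by
  have hR' : ∀ z, R ≤ ‖z‖ → Φ.symm z = σ z := by
    intro z hz
    rw [Equiv.symm_apply_eq, hR _ (by rw [hσn]; exact hz), hσσ]
  set r : RR := (|R| + 2)⁻¹ with hr
  have hr0 : 0 < r := by positivity
  have hsmall : ∀ z : ℂ, z ≠ 0 → ‖z‖ < r → Φ.symm z⁻¹ = (σ z)⁻¹ := by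
    intro z hz hzr
    rw [hR' _ (by
      rw [norm_inv]
      have := (lt_inv_comm₀ (norm_pos_iff.2 hz) (by positivity)).1 hzr
      linarith [le_abs_self R]), hσi]
  have hσ0 : ∀ z : ℂ, z ≠ 0 → σ z ≠ 0 := fun z hz h => hz ((map_eq_zero_iff σ σ.injective).1 h)
  have hr1 : r < 1 := inv_lt_one_of_one_lt₀ (by linarith [abs_nonneg R])
  have hden : ∀ z : ℂ, ‖z‖ < r → 1 + Complex.I * σ z ≠ 0 := by
    intro z hz h
    have : Complex.I * σ z = -1 := by linear_combination h
    have := congrArg norm this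
    rw [norm_mul, hσn] at this
    simp at this; linarith
  have hsmall2 : ∀ z : ℂ, ‖z‖ < r → chartF Φ z = (1 - Complex.I * σ z) * (1 + Complex.I * σ z)⁻¹ := by
    intro z hz
    by_cases h : z = 0
    · simp [chartF, h]
    · rw [chartF, if_neg h, hsmall z h hz, ← div_eq_mul_inv]
      have h0 := hσ0 z h
      have e1 : (σ z)⁻¹ - Complex.I = (1 - Complex.I * σ z) / σ z := by field_simp
      have e2 : (σ z)⁻¹ + Complex.I = (1 + Complex.I * σ z) / σ z := by field_simp
      rw [e1, e2, div_div_div_cancel_right₀ h0]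
  have hball : ∀ᶠ z : ℂ in 𝓝 0, ‖z‖ < r := by
    have := Metric.ball_mem_nhds (0:ℂ) hr0
    filter_upwards [this] with z hz using by simpa using hz
  have hU0 : ∀ z : ℂ, ‖z‖ < r → z ∈ chartU Φ := by
    intro z hz
    by_cases h : z = 0
    · exact Or.inl h
    · right
      rw [hsmall z h hz]
      have h0 := hσ0 z h
      have e2 : (σ z)⁻¹ + Complex.I = (1 + Complex.I * σ z) / σ z := by field_simp
      rw [e2]; exact div_ne_zero (hden z hz) h0
  have hVlarge : ∀ᶠ y : ℂ in 𝓝 1, y ≠ 1 → 1 + y ≠ 0 ∧ Φ (Complex.I * (1 + y) / (1 - y)) = σ (Complex.I * (1 + y) / (1 - y)) := by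
    have h1 : ∀ᶠ y : ℂ in 𝓝 1, ‖(1 - y) / (1 + y)‖ < r := by
      have : ContinuousAt (fun y : ℂ => ‖(1 - y) / (1 + y)‖) 1 := by
        apply ContinuousAt.norm
        apply ContinuousAt.div <;> first | fun_prop | norm_num
      exact this.eventually (gt_mem_nhds (by simpa using hr0))
    have h2 : ∀ᶠ y : ℂ in 𝓝 1, 1 + y ≠ 0 :=
      ContinuousAt.eventually_ne (g := fun y : ℂ => 1 + y) (by fun_prop) (by norm_num)
    filter_upwards [h1, h2] with y hy hy2 hy1
    refine ⟨hy2, hR _ ?_⟩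
    have h3 : 1 - y ≠ 0 := sub_ne_zero.2 (Ne.symm hy1)
    rw [mul_div_assoc, norm_mul, Complex.norm_I, one_mul]
    have : ‖(1 + y) / (1 - y)‖ = ‖(1 - y) / (1 + y)‖⁻¹ := by rw [← norm_inv, inv_div]
    rw [this]
    have := (lt_inv_comm₀ (norm_pos_iff.2 (div_ne_zero h3 hy2)) (by positivity)).1 hy
    linarith [le_abs_self R]
  have hne1 : ∀ y : ℂ, y ≠ 1 → 1 - y ≠ 0 := fun y hy => sub_ne_zero.2 (Ne.symm hy)
  have cw : ∀ y : ℂ, y ≠ 1 → ContDiffAt RR ∞ (fun y => Φ (Complex.I * (1 + y) / (1 - y))) y := by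
    intro y hy
    simp only [div_eq_mul_inv]
    exact hΦ.1.contDiffAt.comp y ((contDiffAt_const.mul (contDiffAt_const.add contDiffAt_id)).mul
      ((contDiffAt_const.sub contDiffAt_id).inv (hne1 y hy)))
  have cz : ∀ z : ℂ, z ≠ 0 → ContDiffAt RR ∞ (fun z => Φ.symm z⁻¹) z := by
    intro z hz
    exact hΦ.2.contDiffAt.comp z (contDiffAt_id.inv hz)
  refine ⟨?_, ?_, ?_, ?_, ?_, ?_, ?_, ?_⟩
  · rw [isOpen_iff_mem_nhds]
    intro z hz
    by_cases h : z = 0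
    · subst h
      filter_upwards [hball] with y hy using hU0 y hy
    · have := (cz z h).continuousAt.add (continuousAt_const (y := Complex.I))
      filter_upwards [this.eventually_ne (hz.resolve_left h)] with y hy using Or.inr hy
  · rw [isOpen_iff_mem_nhds]
    intro y hy
    by_cases h : y = 1
    · subst h
      filter_upwards [hVlarge] with y hy
      by_cases h : y = 1
      · exact Or.inl h
      · right
        rw [(hy h).2]
        exact hσ0 _ (div_ne_zero (mul_ne_zero Complex.I_ne_zero (hy h).1) (hne1 y h))
    · filter_upwards [(cw y h).continuousAt.eventually_ne (hy.resolve_left h)] with y hy using Or.inr hy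
  · intro z hz
    apply ContDiffAt.contDiffWithinAt
    by_cases h : z = 0
    · subst h
      have : chartF Φ =ᶠ[𝓝 0] fun z => (1 - Complex.I * σ z) * (1 + Complex.I * σ z)⁻¹ := by
        filter_upwards [hball] with z hz using hsmall2 z hz
      refine ContDiffAt.congr_of_eventuallyEq ?_ this
      have hs : ContDiffAt RR ∞ (fun z => Complex.I * σ z) 0 := contDiffAt_const.mul σ.contDiff.contDiffAt
      exact (contDiffAt_const.sub hs).mul ((contDiffAt_const.add hs).inv (hden 0 (by simpa using hr0)))
    · have : chartF Φ =ᶠ[𝓝 z] fun z => (Φ.symm z⁻¹ - Complex.I) * (Φ.symm z⁻¹ + Complex.I)⁻¹ := by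
        filter_upwards [isOpen_ne.mem_nhds h] with y hy
        rw [chartF, if_neg hy, div_eq_mul_inv]
      refine ContDiffAt.congr_of_eventuallyEq ?_ this
      exact ((cz z h).sub contDiffAt_const).mul (((cz z h).add contDiffAt_const).inv (hz.resolve_left h))
  · intro y hy
    apply ContDiffAt.contDiffWithinAt
    by_cases h : y = 1
    · subst h
      have : chartG Φ =ᶠ[𝓝 1] fun y => σ ((1 - y) * (Complex.I * (1 + y))⁻¹) := by
        filter_upwards [hVlarge] with y hy
        by_cases h : y = 1
        · simp [chartG, h]
        · rw [chartG, if_neg h, (hy h).2, ← hσi, inv_div, div_eq_mul_inv]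
      refine ContDiffAt.congr_of_eventuallyEq ?_ this
      refine σ.contDiff.contDiffAt.comp _ ((contDiffAt_const.sub contDiffAt_id).mul
        ((contDiffAt_const.mul (contDiffAt_const.add contDiffAt_id)).inv ?_))
      simp only [id]
      exact mul_ne_zero Complex.I_ne_zero (by norm_num)
    · have : chartG Φ =ᶠ[𝓝 y] fun y => (Φ (Complex.I * (1 + y) / (1 - y)))⁻¹ := by
        filter_upwards [isOpen_ne.mem_nhds h] with y hy
        rw [chartG, if_neg hy]
      refine ContDiffAt.congr_of_eventuallyEq ?_ this
      exact (cw y h).inv (hy.resolve_left h)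
  · intro z hz
    by_cases h : z = 0
    · left; simp [chartF, h]
    · right
      rw [chartF, if_neg h, cayley2 _ (hz.resolve_left h), Equiv.apply_symm_apply]
      exact inv_ne_zero h
  · intro y hy
    by_cases h : y = 1
    · left; simp [chartG, h]
    · right
      rw [chartG, if_neg h, inv_inv, Equiv.symm_apply_apply]
      exact cayley3 y h
  · intro z hz
    by_cases h : z = 0
    · simp [chartF, chartG, h]
    · have h1 := hz.resolve_left h
      rw [chartF, if_neg h, chartG, if_neg (cayley1 _ h1), cayley2 _ h1, Equiv.apply_symm_apply, inv_inv]
  · intro y hy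
    by_cases h : y = 1
    · simp [chartF, chartG, h]
    · have h1 := hy.resolve_left h
      rw [chartG, if_neg h, chartF, if_neg (inv_ne_zero h1), inv_inv, Equiv.symm_apply_apply, cayley4 y h]


def IsLoop (c : RR → ℂ) : Prop := CDi c ∧ (∀ t, deriv c t ≠ 0) ∧
  ∀ u v, c u = c v ↔ ∃ n : ℤ, u - v = n * PI

theorem IsLoop.per {c : RR → ℂ} (h : IsLoop c) (u : RR) : c (u + PI) = c u :=
  (h.2.2 _ _).2 ⟨1, by simp⟩

theorem deriv_comp_ne {f : ℂ → ℂ} {c : RR → ℂ} {t : RR} {c' : ℂ} (hf : DifferentiableAt RR f (c t))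
    (hi : Function.Injective (fD f (c t))) (hc : HasDerivAt c c' t) (h : c' ≠ 0) :
    deriv (fun t => f (c t)) t ≠ 0 := by
  have h1 := (hf.hasFDerivAt.comp_hasDerivAt t hc).deriv
  have h2 : deriv (fun t => f (c t)) t = _ := h1
  rw [h2]
  intro h0
  exact h (hi (h0.trans (map_zero _).symm))

theorem IsD.fderiv_inj {E : Type} [NormedAddCommGroup E] [NormedSpace RR E] {Φ : E ≃ E} (h : IsD Φ) (z : E) :
    Function.Injective (fD Φ z) := by
  have h1 := (h.1.differentiable (by simp) z).hasFDerivAt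
  have h2 := (h.2.differentiable (by simp) (Φ z)).hasFDerivAt
  have h3 := h2.comp z h1
  have e : Φ.symm ∘ Φ = id := by ext; simp
  rw [e] at h3
  have h4 := h3.unique (hasFDerivAt_id z)
  intro a b hab
  have := congrArg (fun L => L a) h4
  have hb := congrArg (fun L => L b) h4
  simp at this hb
  rw [← this, ← hb, hab]

theorem IsLoop.map {c : RR → ℂ} (h : IsLoop c) (Φ : ℂ ≃ ℂ) (hΦ : IsD Φ) : IsLoop (fun u => Φ (c u)) := by
  refine ⟨hΦ.1.comp h.1, fun t => ?_, fun u v => ?_⟩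
  · exact deriv_comp_ne (hΦ.1.differentiable (by simp) _) (hΦ.fderiv_inj _)
      (h.1.differentiable (by simp) t).hasDerivAt (h.2.1 t)
  · rw [Φ.injective.eq_iff]; exact h.2.2 u v

theorem loop_straight (c : RR → ℂ) (hc : IsLoop c) : ∃ Φ : ℂ ≃ ℂ, IsD Φ ∧
    ∀ v : RR, |v| ≤ 2 → Φ (c (Real.arctan v)) = v := by
  apply arc_straight (fun v => c (Real.arctan v)) (hc.1.comp Real.contDiff_arctan)
  · intro u v h
    obtain ⟨n, hn⟩ := (hc.2.2 _ _).1 h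
    have h1 := Real.arctan_lt_pi_div_two u
    have h2 := Real.neg_pi_div_two_lt_arctan u
    have h3 := Real.arctan_lt_pi_div_two v
    have h4 := Real.neg_pi_div_two_lt_arctan v
    have hp := Real.pi_pos
    have hn1 : (n:RR) < 1 := by
      by_contra hcon; nlinarith
    have hn2 : (-1:RR) < n := by
      by_contra hcon; nlinarith
    have : n = 0 := by
      have a1 : n < 1 := by exact_mod_cast hn1
      have a2 : -1 < n := by exact_mod_cast hn2
      omega
    rw [this] at hn
    apply Real.arctan_injective
    simp at hn; linarith
  · intro s
    have := (HasDerivAt.scomp s (hc.1.differentiable (by simp) _).hasDerivAt (Real.hasDerivAt_arctan s)).deriv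
    have h2 : deriv (fun u => c (Real.arctan u)) s = _ := this
    rw [h2]
    exact smul_ne_zero (by positivity) (hc.2.1 _)

theorem loop_line (c : RR → ℂ) (hc : IsLoop c) (hs : ∀ v : RR, |v| ≤ 2 → c (Real.arctan v) = v) :
    ∃ Φ : ℂ ≃ ℂ, IsD Φ ∧ (∃ R', ∀ z, R' ≤ ‖z‖ → Φ z = z) ∧ (∀ s : RR, Φ s ≠ 0) ∧
      ∀ s : RR, Φ s = (c (PI / 2 - Real.arctan s))⁻¹ := by
  have hp := Real.pi_pos
  have h00 : c 0 = 0 := by simpa using hs 0 (by simp)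
  have hne : ∀ s : RR, c (PI / 2 - Real.arctan s) ≠ 0 := by
    intro s h
    rw [← h00] at h
    obtain ⟨n, hn⟩ := (hc.2.2 _ _).1 h
    have h1 := Real.arctan_lt_pi_div_two s
    have h2 := Real.neg_pi_div_two_lt_arctan s
    have hn1 : (n:RR) < 1 := by
      by_contra hcon; nlinarith
    have hn2 : (0:RR) < n := by
      by_contra hcon; nlinarith
    have a1 : n < 1 := by exact_mod_cast hn1
    have a2 : 0 < n := by exact_mod_cast hn2
    omega
  have hsm : CDi fun s => c (PI / 2 - Real.arctan s) :=
    hc.1.comp (contDiff_const.sub Real.contDiff_arctan)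
  obtain ⟨Φ, h1, h2, h3⟩ := long_line (fun s => (c (PI / 2 - Real.arctan s))⁻¹) (hsm.inv hne) (by
    intro u v h
    have h := inv_injective h
    obtain ⟨n, hn⟩ := (hc.2.2 _ _).1 h
    have h1 := Real.arctan_lt_pi_div_two u
    have h2 := Real.neg_pi_div_two_lt_arctan u
    have h3 := Real.arctan_lt_pi_div_two v
    have h4 := Real.neg_pi_div_two_lt_arctan v
    have hn1 : (n:RR) < 1 := by
      by_contra hcon; nlinarith
    have hn2 : (-1:RR) < n := by
      by_contra hcon; nlinarith
    have : n = 0 := by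
      have a1 : n < 1 := by exact_mod_cast hn1
      have a2 : -1 < n := by exact_mod_cast hn2
      omega
    rw [this] at hn
    apply Real.arctan_injective
    simp at hn; linarith) (by
    intro s
    have hd : HasDerivAt (fun s => PI / 2 - Real.arctan s) (-(1 / (1 + s ^ 2))) s :=
      (Real.hasDerivAt_arctan s).const_sub _
    have := (HasDerivAt.scomp s (hc.1.differentiable (by simp) _).hasDerivAt hd)
    have h5 := (HasDerivAt.inv this (hne s)).deriv
    have h6 : deriv (fun s => (c (PI / 2 - Real.arctan s))⁻¹) s = _ := h5
    rw [h6]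
    apply div_ne_zero
    · apply neg_ne_zero.2
      refine smul_ne_zero (neg_ne_zero.2 (by positivity)) (hc.2.1 _)
    · exact pow_ne_zero _ (hne s)) (by
    intro s hs1
    have h0 : s ≠ 0 := by rintro rfl; simp at hs1; linarith
    have hab : |s⁻¹| ≤ 2 := by
      rw [abs_inv]; exact (inv_le_one_of_one_le₀ hs1).trans one_le_two
    have e : c (PI / 2 - Real.arctan s) = c (Real.arctan s⁻¹) := by
      rcases lt_or_gt_of_ne h0 with h | h
      · rw [Real.arctan_inv_of_neg h, ← hc.per (-(PI / 2) - Real.arctan s)]; congr 1; ring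
      · rw [Real.arctan_inv_of_pos h]
    simp only [e]
    rw [hs _ hab]; push_cast; rw [inv_inv])
  exact ⟨Φ, h1, h2, fun s => by rw [h3]; exact inv_ne_zero (hne s), h3⟩

theorem loop_cot (c : RR → ℂ) (hc : IsLoop c) (h00 : c 0 = 0) (u : RR) (hu : c u ≠ 0) :
    Real.sin u ≠ 0 ∧ c u = c (PI / 2 - Real.arctan (Real.cos u / Real.sin u)) := by
  have hp := Real.pi_pos
  have hs : Real.sin u ≠ 0 := by
    intro h
    obtain ⟨n, hn⟩ := Real.sin_eq_zero_iff.1 h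
    apply hu
    rw [← h00]
    exact (hc.2.2 _ _).2 ⟨n, by rw [hn, sub_zero]⟩
  refine ⟨hs, (hc.2.2 _ _).2 ?_⟩
  have h1 : Real.sin (u - (PI / 2 - Real.arctan (Real.cos u / Real.sin u))) = 0 := by
    rw [Real.sin_sub, Real.sin_pi_div_two_sub, Real.cos_pi_div_two_sub]
    have h2 : Real.sin (Real.arctan (Real.cos u / Real.sin u)) =
        (Real.cos u / Real.sin u) * Real.cos (Real.arctan (Real.cos u / Real.sin u)) := by
      conv_rhs => arg 1; rw [← Real.tan_arctan (Real.cos u / Real.sin u)]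
      rw [Real.tan_mul_cos (Real.cos_arctan_pos _).ne']
    rw [h2]
    field_simp
    ring
  obtain ⟨n, hn⟩ := Real.sin_eq_zero_iff.1 h1
  exact ⟨n, hn.symm⟩

theorem cayley_cot (u : RR) (hs : Real.sin u ≠ 0) :
    (((Real.cos u / Real.sin u : RR) : ℂ) - Complex.I) / (((Real.cos u / Real.sin u : RR) : ℂ) + Complex.I) =
      Complex.exp (-2 * Complex.I * u) := by
  have hs' : Complex.sin u ≠ 0 := by rw [← Complex.ofReal_sin]; exact_mod_cast hs
  have e1 : Complex.cos u - Complex.sin u * Complex.I = Complex.exp (-(u * Complex.I)) := by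
    rw [← neg_mul, Complex.exp_mul_I, Complex.cos_neg, Complex.sin_neg]; ring
  have e2 : Complex.cos u + Complex.sin u * Complex.I = Complex.exp (u * Complex.I) := by
    rw [Complex.exp_mul_I]
  push_cast
  have h1 : Complex.cos u / Complex.sin u - Complex.I = Complex.exp (-(u * Complex.I)) / Complex.sin u := by
    rw [← e1]; field_simp
  have h2 : Complex.cos u / Complex.sin u + Complex.I = Complex.exp (u * Complex.I) / Complex.sin u := by
    rw [← e2]; field_simp
  rw [h1, h2, div_div_div_cancel_right₀ hs', ← Complex.exp_sub]
  congr 1; ring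

theorem half_planes (P : ℂ → Prop) (hA : IsOpen {w : ℂ | w.im ≠ 0 ∧ P w}) (hB : IsOpen {w : ℂ | w.im ≠ 0 ∧ ¬ P w}) :
    ((∀ w : ℂ, 0 < w.im → P w) ∨ (∀ w : ℂ, 0 < w.im → ¬ P w)) ∧
    ((∀ w : ℂ, w.im < 0 → P w) ∨ (∀ w : ℂ, w.im < 0 → ¬ P w)) := by
  have key : ∀ S : Set ℂ, IsPreconnected S → (∀ w ∈ S, w.im ≠ 0) → (∀ w ∈ S, P w) ∨ (∀ w ∈ S, ¬ P w) := by
    intro S hS h0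
    by_contra hcon
    push Not at hcon
    obtain ⟨⟨a, ha, ha'⟩, ⟨b, hb, hb'⟩⟩ := hcon
    obtain ⟨w, hw, h1, h2⟩ := hS _ _ hA hB (fun w hw => by
      by_cases h : P w
      · exact Or.inl ⟨h0 w hw, h⟩
      · exact Or.inr ⟨h0 w hw, h⟩) ⟨b, hb, h0 b hb, hb'⟩ ⟨a, ha, h0 a ha, ha'⟩
    exact h2.2 h1.2
  exact ⟨key {w | 0 < w.im} (convex_halfSpace_im_gt 0).isPreconnected (fun w hw => ne_of_gt hw),
    key {w | w.im < 0} (convex_halfSpace_im_lt 0).isPreconnected (fun w hw => ne_of_lt hw)⟩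

theorem sch_aux (g : ℂ → RR) (hg : Continuous g) (hD : IsCompact {z | g z ≤ 0}) (c : RR → ℂ) (hc : IsLoop c)
    (hr : ∀ z, g z = 0 ↔ z ∈ range c) (h00 : c 0 = 0)
    (Φ : ℂ ≃ ℂ) (hΦ : IsD Φ) (σ : ℂ ≃L[RR] ℂ) (hσi : ∀ z, σ z⁻¹ = (σ z)⁻¹) (hσn : ∀ z, ‖σ z‖ = ‖z‖)
    (hσσ : ∀ z, σ (σ z) = z) (R : RR) (hR : ∀ z, R ≤ ‖z‖ → Φ z = σ z)
    (hΦr : ∀ s : RR, Φ s = (c (PI / 2 - Real.arctan s))⁻¹)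
    (hup : ∀ w : ℂ, 0 < w.im → Φ w ≠ 0 ∧ g (Φ w)⁻¹ < 0) (hlo : ∀ w : ℂ, w.im < 0 → ¬ (Φ w ≠ 0 ∧ g (Φ w)⁻¹ < 0))
    (hΦ0 : ∀ s : RR, Φ s ≠ 0) :
    ∃ U V Ψ Ψ', IsChart U V Ψ Ψ' ∧ (∀ z, g z ≤ 0 → z ∈ U) ∧ (∀ y, ‖y‖ ≤ 1 → y ∈ V) ∧
      (∀ z ∈ U, ‖Ψ z‖ ≤ 1 ↔ g z ≤ 0) ∧ ∀ u : RR, Ψ (c u) = Complex.exp (-2 * Complex.I * u) := by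
  have hmem : ∀ z : ℂ, z ≠ 0 → (g z ≤ 0 ↔ 0 ≤ (Φ.symm z⁻¹).im) := by
    intro z hz
    set w := Φ.symm z⁻¹ with hw
    have hΦw : Φ w = z⁻¹ := Φ.apply_symm_apply _
    rcases lt_trichotomy w.im 0 with h | h | h
    · have h1 := hlo w h
      rw [hΦw, inv_inv] at h1
      have h2 : ¬ g z < 0 := fun h => h1 ⟨inv_ne_zero hz, h⟩
      constructor
      · intro h3
        exfalso
        have h4 := le_antisymm h3 (not_lt.1 h2)
        obtain ⟨u, hu⟩ := (hr z).1 h4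
        obtain ⟨h5, h6⟩ := loop_cot c hc h00 u (by rw [hu]; exact hz)
        have h7 := hΦr (Real.cos u / Real.sin u)
        rw [← h6, hu] at h7
        have h8 : w = ((Real.cos u / Real.sin u : RR) : ℂ) := by rw [hw, ← h7, Equiv.symm_apply_apply]
        rw [h8, Complex.ofReal_im] at h
        exact lt_irrefl _ h
      · intro h3; linarith
    · have h1 : w = (w.re : ℂ) := by apply Complex.ext <;> simp [h]
      have h2 := hΦr w.re
      rw [← h1, hΦw] at h2
      have h3 := inv_injective h2
      have h4 : g z = 0 := (hr z).2 ⟨_, h3.symm⟩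
      rw [h4, h]
    · have h1 := hup w h
      rw [hΦw, inv_inv] at h1
      exact ⟨fun _ => h.le, fun _ => h1.2.le⟩
  have hg0 : g 0 = 0 := (hr 0).2 ⟨0, h00⟩
  refine ⟨_, _, _, _, chart_of_line Φ hΦ σ hσi hσn hσσ R hR, ?_, ?_, ?_, ?_⟩
  · intro z hz
    by_cases h : z = 0
    · exact Or.inl h
    · right
      intro h1
      have h2 := (hmem z h).1 hz
      have h3 := congrArg Complex.im h1
      simp at h3; linarith
  · intro y hy
    by_cases h : y = 1
    · exact Or.inl h
    · right
      have h1 := (cayley5 _ (cayley3 y h)).1 (by rw [cayley4 y h]; exact hy)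
      rcases h1.eq_or_lt with h2 | h2
      · have h3 : Complex.I * (1 + y) / (1 - y) = ((Complex.I * (1 + y) / (1 - y)).re : ℂ) := by
          apply Complex.ext
          · simp
          · rw [← h2]; simp
        rw [h3]; exact hΦ0 _
      · exact (hup _ h2).1
  · intro z hz
    by_cases h : z = 0
    · simp [chartF, h, hg0]
    · rw [chartF, if_neg h, cayley5 _ (hz.resolve_left h), hmem z h]
  · intro u
    by_cases h : c u = 0
    · rw [chartF, if_pos h]
      rw [← h00] at h
      obtain ⟨n, hn⟩ := (hc.2.2 _ _).1 h
      rw [sub_zero] at hn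
      symm
      rw [Complex.exp_eq_one_iff]
      refine ⟨-n, ?_⟩
      rw [hn]; push_cast; ring
    · obtain ⟨h5, h6⟩ := loop_cot c hc h00 u h
      have h7 := hΦr (Real.cos u / Real.sin u)
      rw [← h6] at h7
      rw [chartF, if_neg h, ← h7, Equiv.symm_apply_apply, cayley_cot u h5]

theorem schoenflies0 (g : ℂ → RR) (hg : Continuous g) (hD : IsCompact {z | g z ≤ 0}) (hneg : ∃ z, g z < 0)
    (c : RR → ℂ) (hc : IsLoop c)
    (hr : ∀ z, g z = 0 ↔ z ∈ range c) (hs : ∀ v : RR, |v| ≤ 2 → c (Real.arctan v) = v) :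
    ∃ U V Ψ Ψ', IsChart U V Ψ Ψ' ∧ (∀ z, g z ≤ 0 → z ∈ U) ∧ (∀ y, ‖y‖ ≤ 1 → y ∈ V) ∧
      (∀ z ∈ U, ‖Ψ z‖ ≤ 1 ↔ g z ≤ 0) ∧ ∀ u : RR, Ψ (c u) = Complex.exp (-2 * Complex.I * u) := by
  have h00 : c 0 = 0 := by simpa using hs 0 (by simp)
  obtain ⟨Φ, hΦ, ⟨R, hR⟩, hΦ0, hΦr⟩ := loop_line c hc hs
  have hg0 : g 0 = 0 := (hr 0).2 ⟨0, h00⟩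
  obtain ⟨B, hB⟩ := hD.isBounded.exists_norm_le
  let P : ℂ → Prop := fun w => Φ w ≠ 0 ∧ g (Φ w)⁻¹ < 0
  have hΦc := hΦ.1.continuous
  have hinvc : ∀ w, Φ w ≠ 0 → ContinuousAt (fun w => g (Φ w)⁻¹) w := fun w hw =>
    hg.continuousAt.comp (hΦc.continuousAt.inv₀ hw)
  have him : ∀ w : ℂ, w.im ≠ 0 → ∀ᶠ y : ℂ in 𝓝 w, y.im ≠ 0 := fun w hw =>
    Complex.continuous_im.continuousAt.eventually_ne hw
  have hA : IsOpen {w : ℂ | w.im ≠ 0 ∧ P w} := by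
    rw [isOpen_iff_mem_nhds]
    rintro w ⟨h1, h2, h3⟩
    filter_upwards [him w h1, hΦc.continuousAt.eventually_ne h2, (hinvc w h2).eventually (gt_mem_nhds h3)] with y a b c
    exact ⟨a, b, c⟩
  have hB' : IsOpen {w : ℂ | w.im ≠ 0 ∧ ¬ P w} := by
    rw [isOpen_iff_mem_nhds]
    rintro w ⟨h1, h2⟩
    by_cases h3 : Φ w = 0
    · have h4 : ∀ᶠ y in 𝓝 w, ‖Φ y‖ < (|B| + 1)⁻¹ :=
        (hΦc.norm.continuousAt).eventually (gt_mem_nhds (by beta_reduce; rw [h3, norm_zero]; positivity))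
      filter_upwards [him w h1, h4] with y a b
      refine ⟨a, fun hP => ?_⟩
      have h5 := hB _ hP.2.le
      rw [norm_inv] at h5
      have h6 := (lt_inv_comm₀ (norm_pos_iff.2 hP.1) (by positivity)).1 b
      linarith [le_abs_self B]
    · have h4 : 0 < g (Φ w)⁻¹ := by
        rcases lt_trichotomy (g (Φ w)⁻¹) 0 with h | h | h
        · exact absurd ⟨h3, h⟩ h2
        · exfalso
          obtain ⟨u, hu⟩ := (hr _).1 h
          obtain ⟨h5, h6⟩ := loop_cot c hc h00 u (by rw [hu]; exact inv_ne_zero h3)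
          have h7 := hΦr (Real.cos u / Real.sin u)
          rw [← h6, hu, inv_inv] at h7
          have := Φ.injective h7
          rw [← this] at h1
          exact h1 (Complex.ofReal_im _)
        · exact h
      filter_upwards [him w h1, (hinvc w h3).eventually (lt_mem_nhds h4)] with y a b
      exact ⟨a, fun hP => lt_asymm b hP.2⟩
  obtain ⟨hu, hl⟩ := half_planes P hA hB'
  obtain ⟨zn, hzn⟩ := hneg
  have hzn0 : zn ≠ 0 := by rintro rfl; linarith
  have hPn : P (Φ.symm zn⁻¹) := by
    simp only [P, Equiv.apply_symm_apply, inv_inv]; exact ⟨inv_ne_zero hzn0, hzn⟩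
  have hwn : (Φ.symm zn⁻¹).im ≠ 0 := by
    intro h
    have h1 : Φ.symm zn⁻¹ = ((Φ.symm zn⁻¹).re : ℂ) := by apply Complex.ext <;> simp [h]
    have h2 := hΦr (Φ.symm zn⁻¹).re
    rw [← h1, Equiv.apply_symm_apply] at h2
    have h4 : g zn = 0 := (hr zn).2 ⟨_, (inv_injective h2).symm⟩
    linarith
  have hw0 : (Φ.symm 0).im ≠ 0 := by
    intro h
    have h1 : Φ.symm 0 = ((Φ.symm 0).re : ℂ) := by apply Complex.ext <;> simp [h]
    have h2 := hΦ0 (Φ.symm 0).re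
    rw [← h1, Equiv.apply_symm_apply] at h2
    exact h2 rfl
  have hP0 : ¬ P (Φ.symm 0) := by
    intro h; exact h.1 (Φ.apply_symm_apply 0)
  rcases hu with hu | hu
  · have hl' : ∀ w : ℂ, w.im < 0 → ¬ P w := by
      rcases hl with hl | hl
      · exfalso
        rcases lt_or_gt_of_ne hw0 with h | h
        · exact hP0 (hl _ h)
        · exact hP0 (hu _ h)
      · exact hl
    exact sch_aux g hg hD c hc hr h00 Φ hΦ (ContinuousLinearEquiv.refl RR ℂ) (fun _ => rfl) (fun _ => rfl) (fun _ => rfl) R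
      hR hΦr hu hl' hΦ0
  · have hl' : ∀ w : ℂ, w.im < 0 → P w := by
      rcases hl with hl | hl
      · exact hl
      · exfalso
        rcases lt_or_gt_of_ne hwn with h | h
        · exact (hl _ h) hPn
        · exact (hu _ h) hPn
    let σ : ℂ ≃L[RR] ℂ := Complex.conjCLE
    have hσ : ∀ z, σ z = (starRingEnd ℂ) z := fun z => rfl
    have hσσ : ∀ z, σ (σ z) = z := fun z => by simp [hσ]
    have hσs : ∀ s : RR, σ s = s := fun s => Complex.conj_ofReal s
    have hσD : IsD σ.toEquiv := ⟨σ.contDiff, σ.symm.contDiff⟩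
    let Φ2 : ℂ ≃ ℂ := σ.toEquiv.trans Φ
    have hΦ2 : ∀ z, Φ2 z = Φ (σ z) := fun z => rfl
    refine sch_aux g hg hD c hc hr h00 Φ2 (hσD.trans hΦ) σ (fun z => by simp [hσ]) (fun z => by simp [hσ]) hσσ R ?_ ?_ ?_ ?_ ?_
    · intro z hz
      rw [hΦ2, hR _ (by rw [hσ, RCLike.norm_conj]; exact hz)]
    · intro s; rw [hΦ2, hσs, hΦr]
    · intro w hw; exact hl' (σ w) (by rw [hσ, Complex.conj_im]; linarith)
    · intro w hw; exact hu (σ w) (by rw [hσ, Complex.conj_im]; linarith)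
    · intro s; rw [hΦ2, hσs]; exact hΦ0 s

theorem schoenflies (g : ℂ → RR) (hg : Continuous g) (hD : IsCompact {z | g z ≤ 0}) (hneg : ∃ z, g z < 0)
    (c : RR → ℂ) (hc : IsLoop c) (hr : ∀ z, g z = 0 ↔ z ∈ range c) :
    ∃ U V Ψ Ψ', IsChart U V Ψ Ψ' ∧ (∀ z, g z ≤ 0 → z ∈ U) ∧ (∀ y, ‖y‖ ≤ 1 → y ∈ V) ∧
      (∀ z ∈ U, ‖Ψ z‖ ≤ 1 ↔ g z ≤ 0) ∧ ∀ u : RR, Ψ (c u) = Complex.exp (-2 * Complex.I * u) := by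
  obtain ⟨Φ, hΦ, hΦc⟩ := loop_straight c hc
  obtain ⟨U, V, Ψ, Ψ', h1, h2, h3, h4, h5⟩ := schoenflies0 (fun z => g (Φ.symm z)) (hg.comp hΦ.2.continuous) (by
    have : {z | g (Φ.symm z) ≤ 0} = Φ '' {z | g z ≤ 0} := by
      ext z; constructor
      · intro h; exact ⟨Φ.symm z, h, by simp⟩
      · rintro ⟨y, hy, rfl⟩; simpa using hy
    rw [this]; exact hD.image hΦ.1.continuous) (by
    obtain ⟨z, hz⟩ := hneg; exact ⟨Φ z, by simpa using hz⟩) (fun u => Φ (c u)) (hc.map Φ hΦ) (by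
    intro z
    rw [hr]
    constructor
    · rintro ⟨u, hu⟩; exact ⟨u, by simp [hu]⟩
    · rintro ⟨u, hu⟩; exact ⟨u, by simp [← hu]⟩) hΦc
  refine ⟨_, _, _, _, h1.pre Φ hΦ, fun z hz => h2 _ (by simpa using hz), h3, fun z hz => ?_, h5⟩
  have := h4 (Φ z) hz
  simpa using this


theorem log_cutoff (ε δ : RR) (hε : 0 < ε) (hδ : 0 < δ) : ∃ χ : RR → RR, CDi χ ∧ (∀ t, 0 ≤ χ t ∧ χ t ≤ 1) ∧
    (∃ t0 > 0, ∀ t, |t| ≤ t0 → χ t = 1) ∧ (∀ t, ε ≤ |t| → χ t = 0) ∧ ∀ t, |t * deriv χ t| ≤ δ := by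
  have hst : CDi Real.smoothTransition := Real.smoothTransition.contDiff
  obtain ⟨B, hB⟩ : ∃ B, ∀ x, |deriv Real.smoothTransition x| ≤ B := by
    obtain ⟨B, hB⟩ := (isCompact_Icc (a := (0:RR)) (b := 1)).exists_bound_of_continuousOn
      (hst.continuous_deriv (by simp)).continuousOn
    refine ⟨|B|, fun x => ?_⟩
    by_cases hx : x ∈ Icc (0:RR) 1
    · exact (hB x hx).trans (le_abs_self _)
    · rw [mem_Icc, not_and_or, not_le, not_le] at hx
      have : deriv Real.smoothTransition x = 0 := by
        rcases hx with hx | hx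
        · have : Real.smoothTransition =ᶠ[𝓝 x] fun _ => 0 := by
            filter_upwards [Iio_mem_nhds hx] with y hy using Real.smoothTransition.zero_of_nonpos (le_of_lt hy)
          rw [this.deriv_eq]; simp
        · have : Real.smoothTransition =ᶠ[𝓝 x] fun _ => 1 := by
            filter_upwards [Ioi_mem_nhds hx] with y hy using Real.smoothTransition.one_of_one_le (le_of_lt hy)
          rw [this.deriv_eq]; simp
      rw [this]; simp
  have hB0 : 0 ≤ B := (abs_nonneg _).trans (hB 0)
  set κ := δ / (2 * B + 1) with hκ
  have hκ0 : 0 < κ := by positivity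
  set η := ε ^ 2 * Real.exp (-(1 / κ)) / 2 with hη
  have hη0 : 0 < η := by positivity
  have hp : ∀ t : RR, 0 < t ^ 2 + η := fun t => by positivity
  refine ⟨fun t => Real.smoothTransition (κ * (Real.log (ε ^ 2) - Real.log (t ^ 2 + η))), ?_, ?_, ?_, ?_, ?_⟩
  · refine hst.comp (contDiff_const.mul (contDiff_const.sub ?_))
    exact ((contDiff_id.pow 2).add contDiff_const).log fun t => (hp t).ne'
  · intro t; exact ⟨Real.smoothTransition.nonneg _, Real.smoothTransition.le_one _⟩
  · refine ⟨Real.sqrt η, Real.sqrt_pos.2 hη0, fun t ht => Real.smoothTransition.one_of_one_le ?_⟩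
    have h1 : t ^ 2 ≤ η := by
      rw [← sq_abs]; exact (Real.le_sqrt (abs_nonneg _) hη0.le).1 ht
    have h2 : Real.log (t ^ 2 + η) ≤ Real.log (ε ^ 2) + -(1 / κ) := by
      have : t ^ 2 + η ≤ ε ^ 2 * Real.exp (-(1 / κ)) := by linarith
      refine (Real.log_le_log (hp t) this).trans ?_
      rw [Real.log_mul (by positivity) (Real.exp_pos _).ne', Real.log_exp]
    have h3 : κ * (1 / κ) ≤ κ * (Real.log (ε ^ 2) - Real.log (t ^ 2 + η)) := by
      apply mul_le_mul_of_nonneg_left _ hκ0.le; linarith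
    rwa [mul_one_div_cancel hκ0.ne'] at h3
  · intro t ht
    apply Real.smoothTransition.zero_of_nonpos
    have h1 : Real.log (ε ^ 2) ≤ Real.log (t ^ 2 + η) := by
      apply Real.log_le_log (by positivity)
      rw [← sq_abs t]; nlinarith
    nlinarith
  · intro t
    have h1 : HasDerivAt (fun t : RR => t ^ 2 + η) (2 * t) t := by
      simpa using (hasDerivAt_pow 2 t).add_const η
    have h2 := ((h1.log (hp t).ne').const_sub (Real.log (ε ^ 2))).const_mul κ
    have h3 := (hst.differentiable (by simp) (κ * (Real.log (ε ^ 2) - Real.log (t ^ 2 + η)))).hasDerivAt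
    have h4 := (h3.comp t h2).deriv
    have h5 : deriv (fun t => Real.smoothTransition (κ * (Real.log (ε ^ 2) - Real.log (t ^ 2 + η)))) t = _ := h4
    rw [h5]
    have e : ∀ D : RR, t * (D * (κ * -(2 * t / (t ^ 2 + η)))) = -(D * (2 * κ * (t ^ 2 / (t ^ 2 + η)))) := by
      intro D; ring
    rw [e, abs_neg, abs_mul]
    have h6 : |2 * κ * (t ^ 2 / (t ^ 2 + η))| ≤ 2 * κ := by
      rw [abs_of_nonneg (by positivity)]
      have : t ^ 2 / (t ^ 2 + η) ≤ 1 := by rw [div_le_one (hp t)]; linarith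
      nlinarith
    have h7 := mul_le_mul (hB (κ * (Real.log (ε ^ 2) - Real.log (t ^ 2 + η)))) h6 (abs_nonneg _) hB0
    refine h7.trans ?_
    rw [hκ, mul_div_assoc', mul_div_assoc', div_le_iff₀ (by positivity)]
    nlinarith

theorem clamp (ε : RR) (hε : 0 < ε) : ∃ ψ : RR → RR, CDi ψ ∧ (∀ t, |ψ t| < ε) ∧ (∀ t, |t| ≤ ε / 2 → ψ t = t) := by
  let b : ContDiffBump (0:RR) := ⟨ε / 2, ε, by positivity, by linarith⟩
  refine ⟨fun t => t * b t, contDiff_id.mul b.contDiff, fun t => ?_, fun t ht => ?_⟩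
  · rw [abs_mul, abs_of_nonneg b.nonneg]
    by_cases h : |t| < ε
    · nlinarith [b.nonneg (x := t), b.le_one (x := t), abs_nonneg t]
    · have : b t = 0 := b.zero_of_le_dist (by simpa using not_lt.1 h)
      rw [this, mul_zero]; exact hε
  · have : b t = 1 := b.one_of_mem_closedBall (by simpa using ht)
    simp only [this, mul_one]

theorem per_int {Y α : Type*} (f : RR × Y → α) (hp : ∀ s y, f (s + PI, y) = f (s, y)) (n : ℤ) (s : RR) (y : Y) :
    f (s + n * PI, y) = f (s, y) := by
  have h : Function.Periodic (fun s => f (s, y)) PI := fun s => hp s y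
  exact (h.int_mul n) s

theorem per_rep (s : RR) : ∃ (n : ℤ) (s' : RR), s' ∈ Icc (0:RR) PI ∧ s = s' + n * PI := by
  refine ⟨⌊s / PI⌋, s - ⌊s / PI⌋ * PI, ?_, by ring⟩
  have hp := Real.pi_pos
  have h1 := Int.floor_le (s / PI)
  have h2 := Int.lt_floor_add_one (s / PI)
  rw [le_div_iff₀ hp] at h1
  rw [div_lt_iff₀ hp] at h2
  constructor <;> linarith

theorem per_bound {Y F : Type*} [TopologicalSpace Y] [NormedAddCommGroup F] (f : RR × Y → F) (hf : Continuous f)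
    (hp : ∀ s y, f (s + PI, y) = f (s, y)) (K : Set Y) (hK : IsCompact K) :
    ∃ C, ∀ s, ∀ y ∈ K, ‖f (s, y)‖ ≤ C := by
  obtain ⟨C, hC⟩ := ((isCompact_Icc (a := (0:RR)) (b := PI)).prod hK).exists_bound_of_continuousOn hf.continuousOn
  refine ⟨C, fun s y hy => ?_⟩
  obtain ⟨n, s', hs', rfl⟩ := per_rep s
  rw [per_int f hp]
  exact hC (s', y) ⟨hs', hy⟩

theorem per_tube {Y : Type*} [TopologicalSpace Y] (P : RR × Y → Prop) (hP : IsOpen {x | P x})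
    (hp : ∀ s y, P (s + PI, y) = P (s, y)) (y0 : Y) (h0 : ∀ s, P (s, y0)) :
    ∀ᶠ y in 𝓝 y0, ∀ s, P (s, y) := by
  have := (isCompact_Icc (a := (0:RR)) (b := PI)).eventually_forall_of_forall_eventually (x₀ := y0)
    (P := fun y s => P (s, y)) (fun s hs => by
      have h1 : Continuous fun q : Y × RR => (q.2, q.1) := by fun_prop
      exact (hP.preimage h1).mem_nhds (h0 s))
  filter_upwards [this] with y hy s
  obtain ⟨n, s', hs', rfl⟩ := per_rep s
  rw [per_int P hp]
  exact hy s' hs'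

noncomputable def E0 (p : P2) : ℂ := Complex.exp (p.2 - 2 * Complex.I * p.1)

noncomputable def S0 (z : ℂ) : P2 := (-(Complex.log z).im / 2, (Complex.log z).re)

theorem E0_smooth : CDi E0 := by
  have h : CDi fun p : P2 => (p.2 : ℂ) - 2 * Complex.I * p.1 :=
    (Complex.ofRealCLM.contDiff.comp contDiff_snd).sub
      (contDiff_const.mul (Complex.ofRealCLM.contDiff.comp contDiff_fst))
  have he : CDi Complex.exp := (Complex.contDiff_exp (𝕜 := ℂ)).restrict_scalars RR
  exact he.comp h

theorem E0_ne (p : P2) : E0 p ≠ 0 := Complex.exp_ne_zero _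

theorem E0_add (p q : P2) : E0 (p + q) = E0 p * E0 q := by
  rw [E0, E0, E0, ← Complex.exp_add]; congr 1; simp; ring

theorem E0_S0 (z : ℂ) (hz : z ≠ 0) : E0 (S0 z) = z := by
  rw [E0, S0]
  have : (((Complex.log z).re : RR) : ℂ) - 2 * Complex.I * ((-(Complex.log z).im / 2 : RR) : ℂ) = Complex.log z := by
    conv_rhs => rw [← Complex.re_add_im (Complex.log z)]
    push_cast; ring
  rw [this, Complex.exp_log hz]

theorem E0_norm (p : P2) : ‖E0 p‖ = Real.exp p.2 := by
  rw [E0, Complex.norm_exp]; simp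

theorem E0_per (s t : RR) : E0 (s + PI, t) = E0 (s, t) := by
  rw [E0, E0, Complex.exp_eq_exp_iff_exists_int]
  refine ⟨-1, ?_⟩
  push_cast; ring

theorem E0_eq_iff (p q : P2) : E0 p = E0 q ↔ p.2 = q.2 ∧ ∃ n : ℤ, p.1 = q.1 + n * PI := by
  constructor
  · intro h
    have h2 : p.2 = q.2 := by
      have := congrArg norm h
      rw [E0_norm, E0_norm] at this
      exact Real.exp_injective this
    refine ⟨h2, ?_⟩
    rw [E0, E0, Complex.exp_eq_exp_iff_exists_int] at h
    obtain ⟨n, hn⟩ := h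
    refine ⟨-n, ?_⟩
    have := congrArg Complex.im hn
    simp at this
    push_cast
    linarith
  · rintro ⟨h2, n, hn⟩
    have : p = (q.1 + n * PI, q.2) := Prod.ext hn h2
    rw [this, per_int E0 E0_per]

theorem E0_hasFDerivAt (p : P2) : ∃ L : P2 →L[RR] ℂ, HasFDerivAt E0 L p ∧
    ∀ d, L d = E0 p * (d.2 - 2 * Complex.I * d.1) := by
  have h1 : HasFDerivAt (fun p : P2 => (p.2 : ℂ) - 2 * Complex.I * p.1)
      ((Complex.ofRealCLM.comp (ContinuousLinearMap.snd RR RR RR)) -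
        (2 * Complex.I) • (Complex.ofRealCLM.comp (ContinuousLinearMap.fst RR RR RR))) p := by
    refine HasFDerivAt.sub ?_ (HasFDerivAt.const_mul ?_ _)
    · exact (Complex.ofRealCLM.comp (ContinuousLinearMap.snd RR RR RR)).hasFDerivAt
    · exact (Complex.ofRealCLM.comp (ContinuousLinearMap.fst RR RR RR)).hasFDerivAt
  have h2 := (Complex.hasDerivAt_exp ((p.2 : ℂ) - 2 * Complex.I * p.1)).complexToReal_fderiv
  refine ⟨_, h2.comp p h1, fun d => ?_⟩
  simp [E0]
  try ring

theorem E0_fderiv_bij (p : P2) : Function.Bijective (fD E0 p) := by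
  obtain ⟨L, hL, hLd⟩ := E0_hasFDerivAt p
  rw [hL.fderiv]
  constructor
  · rw [injective_iff_map_eq_zero]
    intro d hd
    rw [hLd] at hd
    have h := (mul_eq_zero.1 hd).resolve_left (E0_ne p)
    have h1 := congrArg Complex.re h
    have h2 := congrArg Complex.im h
    simp at h1 h2
    exact Prod.ext h2 h1
  · intro v
    refine ⟨(-(v / E0 p).im / 2, (v / E0 p).re), ?_⟩
    rw [hLd]
    have : (((v / E0 p).re : RR) : ℂ) - 2 * Complex.I * ((-(v / E0 p).im / 2 : RR) : ℂ) = v / E0 p := by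
      conv_rhs => rw [← Complex.re_add_im (v / E0 p)]
      push_cast; ring
    rw [this, mul_div_cancel₀ _ (E0_ne p)]

theorem smooth_of_E0 {F : Type*} [NormedAddCommGroup F] [NormedSpace RR F] (H : ℂ → F) (p : P2)
    (h : ContDiffAt RR ∞ (fun q => H (E0 q)) p) : ContDiffAt RR ∞ H (E0 p) := by
  have h1 : H =ᶠ[𝓝 (E0 p)] fun z => H (E0 (p + S0 (z * (E0 p)⁻¹))) := by
    filter_upwards [isOpen_ne.mem_nhds (E0_ne p)] with z hz
    rw [E0_add, E0_S0 _ (mul_ne_zero hz (inv_ne_zero (E0_ne p)))]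
    congr 1
    field_simp [E0_ne p]
  have hlog : ContDiffAt RR ∞ (fun z => Complex.log (z * (E0 p)⁻¹)) (E0 p) := by
    have a : ContDiffAt RR ∞ Complex.log (E0 p * (E0 p)⁻¹) := by
      rw [mul_inv_cancel₀ (E0_ne p)]
      exact (Complex.contDiffAt_log (by simp)).restrict_scalars RR
    exact a.comp (E0 p) (contDiffAt_id.mul contDiffAt_const)
  have h2 : ContDiffAt RR ∞ (fun z => p + S0 (z * (E0 p)⁻¹)) (E0 p) := by
    refine contDiffAt_const.add (ContDiffAt.prodMk ?_ ?_)
    · exact ((Complex.imCLM.contDiff.contDiffAt.comp _ hlog).neg).div_const 2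
    · exact Complex.reCLM.contDiff.contDiffAt.comp _ hlog
  refine ContDiffAt.congr_of_eventuallyEq ?_ h1
  have h3 : p + S0 (E0 p * (E0 p)⁻¹) = p := by
    rw [mul_inv_cancel₀ (E0_ne p), S0]; simp
  exact ContDiffAt.comp (E0 p) (g := fun q => H (E0 q)) (by rw [h3]; exact h) h2


theorem inj_of_mono (M : P2 → P2) (hM : Differentiable RR M) (k : RR)
    (h : ∀ x d, d ≠ 0 → 0 < k * (d.2 * (fD M x d).2) + d.1 * (fD M x d).1) :
    Function.Injective M := by
  intro x y hxy
  by_contra hne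
  set d := y - x with hd
  have hd0 : d ≠ 0 := sub_ne_zero.2 (Ne.symm hne)
  have hder : ∀ θ : RR, HasDerivAt (fun θ : RR => k * (d.2 * (M (x + θ • d)).2) + d.1 * (M (x + θ • d)).1)
      (k * (d.2 * (fD M (x + θ • d) d).2) + d.1 * (fD M (x + θ • d) d).1) θ := by
    intro θ
    have h1 : HasDerivAt (fun θ : RR => x + θ • d) d θ := by
      simpa using ((hasDerivAt_id θ).smul_const d).const_add x
    have h2 := (hM (x + θ • d)).hasFDerivAt.comp_hasDerivAt θ h1
    have h3 := (ContinuousLinearMap.snd RR RR RR).hasFDerivAt.comp_hasDerivAt θ h2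
    have h4 := (ContinuousLinearMap.fst RR RR RR).hasFDerivAt.comp_hasDerivAt θ h2
    exact ((h3.const_mul d.2).const_mul k).add (h4.const_mul d.1)
  have hmono : StrictMono (fun θ : RR => k * (d.2 * (M (x + θ • d)).2) + d.1 * (M (x + θ • d)).1) :=
    strictMono_of_deriv_pos fun θ => by rw [(hder θ).deriv]; exact h _ _ hd0
  have := hmono (zero_lt_one)
  simp [hd, hxy] at this

theorem fderiv_per {F : Type*} [NormedAddCommGroup F] [NormedSpace RR F] {Y : Type*} [NormedAddCommGroup Y] [NormedSpace RR Y]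
    (f : RR × Y → F)
    (hp : ∀ s y, f (s + PI, y) = f (s, y)) (s : RR) (y : Y) : fD f (s + PI, y) = fD f (s, y) := by
  have h : (fun x => f (x + (PI, 0))) = f := by
    funext x; obtain ⟨a, b⟩ := x; simp [hp]
  have := fderiv_comp_add_right (𝕜 := RR) (f := f) (x := (s, y)) (PI, 0)
  rw [h] at this
  rw [this]; simp

theorem quad_pos (k A ρ a b c e x y : RR) (hρ : 0 < ρ) (hA : 0 ≤ A) (hk : k = ((1 + 2 * A) ^ 2 + 1) / ρ)
    (ha : ρ / 2 ≤ a) (hb : |b| ≤ 1 / (k + 2)) (hc : |c| ≤ 2 * A) (he : |e| ≤ 1 / (k + 2)) (hxy : x ≠ 0 ∨ y ≠ 0) :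
    0 < k * (y * (a * y + b * x)) + x * (x + c * y + e * x) := by
  have hk0 : 0 < k := by rw [hk]; positivity
  have hkρ : k * ρ = (1 + 2 * A) ^ 2 + 1 := by rw [hk]; field_simp
  have hη : 1 / (k + 2) * (k + 2) = 1 := by field_simp
  have hη0 : 0 < 1 / (k + 2) := by positivity
  set η := 1 / (k + 2)
  have hkη : k * η ≤ 1 := by nlinarith
  have hη2 : η ≤ 1 / 2 := by nlinarith
  have h1 : -(|x| * |y|) ≤ k * (y * (b * x)) := by
    have : |k * (y * (b * x))| ≤ |x| * |y| := by
      rw [abs_mul, abs_mul, abs_mul, abs_of_pos hk0]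
      calc k * (|y| * (|b| * |x|)) ≤ k * (|y| * (η * |x|)) := by gcongr
        _ = (k * η) * (|x| * |y|) := by ring
        _ ≤ 1 * (|x| * |y|) := by gcongr
        _ = _ := one_mul _
    exact (abs_le.1 this).1
  have h2 : -(2 * A * (|x| * |y|)) ≤ x * (c * y) := by
    have : |x * (c * y)| ≤ 2 * A * (|x| * |y|) := by
      rw [abs_mul, abs_mul]
      calc |x| * (|c| * |y|) ≤ |x| * ((2 * A) * |y|) := by gcongr
        _ = _ := by ring
    exact (abs_le.1 this).1
  have h3 : -(1 / 2) * x ^ 2 ≤ x * (e * x) := by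
    nlinarith [(abs_le.1 he).1, sq_nonneg x]
  have h4 : k * ρ / 2 * y ^ 2 ≤ k * (y * (a * y)) := by
    have : 0 ≤ k * y ^ 2 * (a - ρ / 2) := mul_nonneg (by positivity) (by linarith)
    nlinarith
  have h5 : 0 < ((1 + 2 * A) ^ 2 + 1) / 2 * |y| ^ 2 - (1 + 2 * A) * (|x| * |y|) + |x| ^ 2 / 2 := by
    have e1 : ((1 + 2 * A) ^ 2 + 1) / 2 * |y| ^ 2 - (1 + 2 * A) * (|x| * |y|) + |x| ^ 2 / 2
       = ((1 + 2 * A) * |y| - |x|) ^ 2 / 2 + |y| ^ 2 / 2 := by ring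
    rw [e1]
    by_cases hy : y = 0
    · have hx := hxy.resolve_right (not_not.2 hy)
      rw [hy]; simp; positivity
    · positivity
  rw [sq_abs, sq_abs] at h5
  rw [hkρ] at h4
  nlinarith

theorem collar_mono (μ : P2 → P2) (hμ : CDi μ) (hp : ∀ s t, μ (s + PI, t) = μ (s, t))
    (h0 : ∀ s, μ (s, 0) = 0) (hpos : ∀ s, 0 < 1 + (fD μ (s, 0) (0, 1)).2) :
    ∃ (k : RR) (χ : RR → RR) (ε t0 : RR), 0 < ε ∧ 0 < t0 ∧ CDi χ ∧ (∀ t, |t| ≤ t0 → χ t = 1) ∧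
      (∀ t, ε ≤ |t| → χ t = 0) ∧
      ∀ x d, d ≠ 0 → 0 < k * (d.2 * (fD (fun x : P2 => x + χ x.2 • μ x) x d).2) +
        d.1 * (fD (fun x : P2 => x + χ x.2 • μ x) x d).1 := by
  have hμd : Differentiable RR μ := hμ.differentiable (by simp)
  have hDc : Continuous (fD μ) := hμ.continuous_fderiv (by simp)
  have hDp := fderiv_per μ hp
  obtain ⟨A0, hA0⟩ := per_bound (fD μ) hDc hDp (Icc (-1) 1) isCompact_Icc
  set A := max A0 0 with hA
  have hAn : 0 ≤ A := le_max_right _ _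
  have hDA : ∀ x : P2, |x.2| ≤ 1 → ‖fD μ x‖ ≤ A := fun x hx =>
    (hA0 x.1 x.2 (abs_le.1 hx)).trans (le_max_left _ _)
  have hμA : ∀ x : P2, |x.2| ≤ 1 → ‖μ x‖ ≤ A * |x.2| := by
    intro x hx
    have hcv : Convex RR {x : P2 | |x.2| ≤ 1} := by
      have : {x : P2 | |x.2| ≤ 1} = (univ : Set RR) ×ˢ Icc (-1:RR) 1 := by
        ext y; simp [abs_le]
      rw [this]; exact convex_univ.prod (convex_Icc _ _)
    have := hcv.norm_image_sub_le_of_norm_fderiv_le (f := μ) (𝕜 := RR) (C := A) (fun y _ => hμd y) (fun y hy => hDA y hy)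
      (x := (x.1, 0)) (y := x) (show |(0:RR)| ≤ 1 by simp) hx
    rw [h0, sub_zero] at this
    refine this.trans (le_of_eq ?_)
    congr 1
    obtain ⟨a, b⟩ := x
    simp [Prod.norm_def]
  obtain ⟨sm, hsm, hmin⟩ := (isCompact_Icc (a := (0:RR)) (b := PI)).exists_isMinOn ⟨0, by constructor <;> [rfl; exact Real.pi_pos.le]⟩
    (f := fun s => 1 + (fD μ (s, 0) (0, 1)).2) (by fun_prop)
  set m := 1 + (fD μ (sm, 0) (0, 1)).2 with hm
  have hm0 : 0 < m := hpos sm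
  have hml : ∀ s, m ≤ 1 + (fD μ (s, 0) (0, 1)).2 := by
    intro s
    obtain ⟨n, s', hs', rfl⟩ := per_rep s
    rw [per_int (fD μ) hDp]
    exact hmin hs'
  set ρ := min (m / 2) 1 with hρ
  have hρ0 : 0 < ρ := lt_min (by positivity) one_pos
  have hρ1 : ρ ≤ 1 := min_le_right _ _
  have hρm : ρ < m := (min_le_left _ _).trans_lt (by linarith)
  set k := ((1 + 2 * A) ^ 2 + 1) / ρ with hk
  have hk0 : 0 < k := by positivity
  set η := 1 / (k + 2) with hη
  have hη0 : 0 < η := by positivity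
  have hs0 : ∀ s, fD μ (s, 0) (1, 0) = 0 := by
    intro s
    have h1 : HasDerivAt (fun s : RR => ((s, 0) : P2)) (1, 0) s := (hasDerivAt_id s).prodMk (hasDerivAt_const s 0)
    have h2 := (hμd (s, 0)).hasFDerivAt.comp_hasDerivAt s h1
    have h3 : μ ∘ (fun s : RR => ((s, 0) : P2)) = fun _ => 0 := by funext s; simp [h0]
    rw [h3] at h2
    exact h2.unique (hasDerivAt_const s 0)
  have e1 := per_tube (fun x : P2 => ‖fD μ x (1, 0)‖ < η ∧ ρ < 1 + (fD μ x (0, 1)).2)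
    (by
      have c1 : Continuous fun x : P2 => ‖fD μ x (1, 0)‖ := by fun_prop
      have c2 : Continuous fun x : P2 => 1 + (fD μ x (0, 1)).2 := by fun_prop
      exact (isOpen_lt c1 continuous_const).inter (isOpen_lt continuous_const c2))
    (fun s t => by rw [hDp]) 0 (fun s => ⟨by rw [hs0]; simpa using hη0, hρm.trans_le (hml s)⟩)
  obtain ⟨ε0, hε0, hε⟩ := Metric.eventually_nhds_iff.1 e1
  set ε := min (ε0 / 2) 1 with hεd
  have hεp : 0 < ε := lt_min (by positivity) one_pos
  have hε1 : ε ≤ 1 := min_le_right _ _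
  have hεε : ε < ε0 := (min_le_left _ _).trans_lt (by linarith)
  obtain ⟨χ, hχ, hχ01, ⟨t0, ht0, hχ1⟩, hχ0, hχd⟩ := log_cutoff ε (min 1 (ρ / (2 * (A + 1)))) hεp (by positivity)
  refine ⟨k, χ, ε, t0, hεp, ht0, hχ, hχ1, hχ0, ?_⟩
  rintro ⟨s, t⟩ ⟨x, y⟩ hd
  have hxy : x ≠ 0 ∨ y ≠ 0 := by
    by_contra hh; push Not at hh; exact hd (by rw [hh.1, hh.2]; rfl)
  rcases lt_or_ge ε |t| with ht | ht
  · have : (fun x : P2 => x + χ x.2 • μ x) =ᶠ[𝓝 (s, t)] fun x => x := by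
      have : ∀ᶠ x : P2 in 𝓝 (s, t), ε < |x.2| := (isOpen_lt continuous_const (by fun_prop)).mem_nhds ht
      filter_upwards [this] with x hx
      rw [hχ0 _ hx.le]; simp
    rw [this.fderiv_eq, fderiv_id']
    simp only [ContinuousLinearMap.id_apply]
    have h1 := mul_self_nonneg x
    have h2 := mul_nonneg hk0.le (mul_self_nonneg y)
    rcases hxy with h | h
    · have := mul_self_pos.2 h; linarith
    · have := mul_pos hk0 (mul_self_pos.2 h); linarith
  · have hχD := (hχ.differentiable (by simp) t).hasDerivAt
    have h1 : HasFDerivAt (fun x : P2 => χ x.2) (deriv χ t • ContinuousLinearMap.snd RR RR RR) (s, t) :=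
      hχD.comp_hasFDerivAt (s, t) (ContinuousLinearMap.snd RR RR RR).hasFDerivAt
    have h2 := (hasFDerivAt_id ((s, t) : P2)).add (h1.smul (hμd (s, t)).hasFDerivAt)
    have h3 : fD (fun x : P2 => x + χ x.2 • μ x) (s, t) = _ := h2.fderiv
    rw [h3]
    have ht' := hε (y := t) (by rw [Real.dist_eq, sub_zero]; exact ht.trans_lt hεε) s
    obtain ⟨ha, hb⟩ := ht'
    have hDd : fD μ (s, t) (x, y) = x • fD μ (s, t) (1, 0) + y • fD μ (s, t) (0, 1) := by
      rw [← map_smul, ← map_smul, ← map_add]; simp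
    have hD1 : ‖fD μ (s, t) (0, 1)‖ ≤ A := by
      refine ((fD μ (s, t)).le_opNorm _).trans ?_
      have : ‖((0, 1) : P2)‖ = 1 := by simp [Prod.norm_def]
      rw [this, mul_one]; exact hDA _ (ht.trans hε1)
    have hμt := hμA (s, t) (ht.trans hε1)
    have hcd := hχd t
    obtain ⟨hc0, hc1⟩ := hχ01 t
    simp only [ContinuousLinearMap.add_apply, ContinuousLinearMap.smul_apply, ContinuousLinearMap.smulRight_apply,
      ContinuousLinearMap.coe_id', id, ContinuousLinearMap.coe_snd', hDd, Prod.fst_add, Prod.snd_add, Prod.smul_fst, Prod.smul_snd, smul_eq_mul]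
    generalize fD μ (s, t) (1, 0) = U at *
    generalize fD μ (s, t) (0, 1) = V at *
    generalize μ (s, t) = W at *
    have hW : ∀ w : RR, |w| ≤ ‖W‖ → |deriv χ t * w| ≤ A * min 1 (ρ / (2 * (A + 1))) := by
      intro w hw
      rw [abs_mul]
      calc |deriv χ t| * |w| ≤ |deriv χ t| * (A * |t|) := by gcongr; exact hw.trans hμt
        _ = A * |t * deriv χ t| := by rw [abs_mul]; ring
        _ ≤ _ := by gcongr
    have hW1 := hW W.1 (norm_fst_le W)
    have hW2 := hW W.2 (norm_snd_le W)
    have hA1 : A * min 1 (ρ / (2 * (A + 1))) ≤ A := by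
      calc _ ≤ A * 1 := by gcongr; exact min_le_left _ _
        _ = A := mul_one _
    have hA2 : A * min 1 (ρ / (2 * (A + 1))) ≤ ρ / 2 := by
      calc _ ≤ A * (ρ / (2 * (A + 1))) := by gcongr; exact min_le_right _ _
        _ ≤ (A + 1) * (ρ / (2 * (A + 1))) := by gcongr; linarith
        _ = ρ / 2 := by field_simp
    have hU1 := (norm_fst_le U).trans ha.le
    have hU2 := (norm_snd_le U).trans ha.le
    have hV1 := (norm_fst_le V).trans hD1
    rw [Real.norm_eq_abs] at hU1 hU2 hV1
    have hχm : ∀ w B : RR, |w| ≤ B → |χ t * w| ≤ B := by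
      intro w B hw
      rw [abs_mul, abs_of_nonneg hc0]
      nlinarith [abs_nonneg w]
    have := quad_pos k A ρ (1 + χ t * V.2 + deriv χ t * W.2) (χ t * U.2) (χ t * V.1 + deriv χ t * W.1) (χ t * U.1) x y hρ0 hAn hk
      (by have := (abs_le.1 (hW2.trans hA2)).1
          have : ρ ≤ 1 + χ t * V.2 := by nlinarith
          linarith)
      (hχm _ _ hU2) ((abs_add_le _ _).trans (by linarith [hχm _ _ hV1])) (hχm _ _ hU1) hxy
    refine this.trans_le (le_of_eq ?_)
    ring


theorem collar_main (μ : P2 → P2) (hμ : CDi μ) (hp : ∀ s t, μ (s + PI, t) = μ (s, t))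
    (h0 : ∀ s, μ (s, 0) = 0) (hpos : ∀ s, 0 < 1 + (fD μ (s, 0) (0, 1)).2) :
    ∃ Ξ : ℂ ≃ ℂ, IsD Ξ ∧ Ξ 0 = 0 ∧ ∃ t0 > 0, ∀ s t, |t| ≤ t0 → Ξ (E0 (s, t)) = E0 ((s, t) + μ (s, t)) := by
  obtain ⟨k, χ, ε, t0, hε, ht0, hχ, hχ1, hχ0, hq⟩ := collar_mono μ hμ hp h0 hpos
  set M : P2 → P2 := fun x => x + χ x.2 • μ x with hM
  have hMs : CDi M := contDiff_id.add ((hχ.comp contDiff_snd).smul hμ)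
  have hMd : Differentiable RR M := hMs.differentiable (by simp)
  have hMinj := inj_of_mono M hMd k hq
  have hMDinj : ∀ x, Function.Injective (fD M x) := by
    intro x
    rw [injective_iff_map_eq_zero]
    intro d hd
    by_contra hd0
    have := hq x d hd0
    rw [hd] at this
    simp at this
  have hMp : ∀ (p : P2) (n : ℤ), M (p.1 + n * PI, p.2) = ((M p).1 + n * PI, (M p).2) := by
    intro p n
    have := per_int μ hp n p.1 p.2
    simp only [hM, this]
    ext <;> simp
    ring
  have hES : ∀ p, E0 (M (S0 (E0 p))) = E0 (M p) := by
    intro p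
    obtain ⟨h1, n, h2⟩ := (E0_eq_iff _ _).1 (E0_S0 (E0 p) (E0_ne p))
    have : S0 (E0 p) = (p.1 + n * PI, p.2) := Prod.ext h2 h1
    rw [this, hMp, E0_eq_iff]
    exact ⟨rfl, n, rfl⟩
  set f : ℂ → ℂ := fun z => if z = 0 then 0 else E0 (M (S0 z)) with hf
  have hfE : ∀ p, f (E0 p) = E0 (M p) := by
    intro p; simp only [hf, if_neg (E0_ne p)]; exact hES p
  have hf0 : f 0 = 0 := by simp [hf]
  have hfid : ∀ p : P2, ε ≤ |p.2| → f (E0 p) = E0 p := by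
    intro p hp2
    rw [hfE]; simp [hM, hχ0 _ hp2]
  have hsurj : ∀ z : ℂ, z ≠ 0 → ∃ p, E0 p = z ∧ p.2 = Real.log ‖z‖ := fun z hz =>
    ⟨S0 z, E0_S0 z hz, by simp [S0, Complex.log_re]⟩
  have hfne : ∀ z, z ≠ 0 → f z ≠ 0 := by
    intro z hz; obtain ⟨p, rfl, -⟩ := hsurj z hz; rw [hfE]; exact E0_ne _
  have hnear : f =ᶠ[𝓝 0] fun z => z := by
    filter_upwards [Metric.ball_mem_nhds (0:ℂ) (Real.exp_pos (-ε))] with z hz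
    by_cases hz0 : z = 0
    · rw [hz0, hf0]
    · obtain ⟨p, rfl, -⟩ := hsurj z hz0
      apply hfid
      rw [mem_ball_zero_iff, E0_norm, Real.exp_lt_exp] at hz
      rw [abs_of_neg (by linarith)]; linarith
  have hfs : CDi f := by
    rw [contDiff_iff_contDiffAt]
    intro z
    by_cases hz0 : z = 0
    · rw [hz0]; exact contDiffAt_id.congr_of_eventuallyEq hnear
    · obtain ⟨p, rfl, -⟩ := hsurj z hz0
      apply smooth_of_E0
      have : (fun q => f (E0 q)) = fun q => E0 (M q) := funext hfE
      rw [this]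
      exact (E0_smooth.comp hMs).contDiffAt
  have hfd : Differentiable RR f := hfs.differentiable (by simp)
  have hfinj : Function.Injective f := by
    intro z w hzw
    by_cases hz : z = 0
    · by_cases hw : w = 0
      · rw [hz, hw]
      · exact absurd (by rw [← hzw, hz, hf0]) (hfne w hw)
    · by_cases hw : w = 0
      · exact absurd (by rw [hzw, hw, hf0]) (hfne z hz)
      · obtain ⟨p, rfl, -⟩ := hsurj z hz
        obtain ⟨q, rfl, -⟩ := hsurj w hw
        rw [hfE, hfE, E0_eq_iff] at hzw
        obtain ⟨h1, n, h2⟩ := hzw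
        have h3 : M p = M (q.1 + n * PI, q.2) := by rw [hMp]; exact Prod.ext h2 h1
        rw [hMinj h3, E0_eq_iff]
        exact ⟨rfl, n, rfl⟩
  have hfDinj : ∀ z, Function.Injective (fD f z) := by
    intro z
    by_cases hz : z = 0
    · rw [hz, hnear.fderiv_eq, fderiv_id']; exact fun a b h => h
    · obtain ⟨p, rfl, -⟩ := hsurj z hz
      rw [injective_iff_map_eq_zero]
      intro v hv
      obtain ⟨u, rfl⟩ := (E0_fderiv_bij p).2 v
      have hE := E0_smooth.differentiable (by simp)
      have h1 := (hfd (E0 p)).hasFDerivAt.comp p (hE p).hasFDerivAt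
      have h2 := (hE (M p)).hasFDerivAt.comp p (hMd p).hasFDerivAt
      have h3 : f ∘ E0 = E0 ∘ M := funext hfE
      rw [h3] at h1
      have h4 := congrArg (fun L => L u) (h1.unique h2)
      simp only [ContinuousLinearMap.comp_apply] at h4
      rw [hv] at h4
      have h5 : fD M p u = 0 := (E0_fderiv_bij (M p)).1 (by rw [← h4, map_zero])
      have h6 : u = 0 := hMDinj p (by rw [h5, map_zero])
      rw [h6, map_zero]
  obtain ⟨Ξ, hΞ, hΞf⟩ := isD_of_inj f hfs hfinj hfDinj (Real.exp ε) (by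
    intro z hz
    have hz0 : z ≠ 0 := by
      rintro rfl; rw [norm_zero] at hz; linarith [Real.exp_pos ε]
    obtain ⟨p, rfl, -⟩ := hsurj z hz0
    apply hfid
    rw [E0_norm, Real.exp_le_exp] at hz
    exact hz.trans (le_abs_self _))
  refine ⟨Ξ, hΞ, by rw [hΞf, hf0], t0, ht0, fun s t ht => ?_⟩
  rw [hΞf, hfE]
  simp [hM, hχ1 t ht]

theorem disc_pres (Ξ : ℂ ≃ ℂ) (hΞ : IsD Ξ) (h0 : Ξ 0 = 0) (hc : ∀ s, Ξ (E0 (s, 0)) = E0 (s, 0)) (z : ℂ) :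
    ‖Ξ z‖ ≤ 1 ↔ ‖z‖ ≤ 1 := by
  have hcirc : ∀ z : ℂ, ‖z‖ = 1 → Ξ z = z := by
    intro z hz
    have hz0 : z ≠ 0 := by rintro rfl; simp at hz
    have h1 := E0_S0 z hz0
    have h2 : (S0 z).2 = 0 := by simp [S0, Complex.log_re, hz]
    rw [← h1, show S0 z = ((S0 z).1, 0) from Prod.ext rfl h2]
    exact hc _
  have key : ∀ Φ : ℂ ≃ ℂ, IsD Φ → Φ 0 = 0 → (∀ z : ℂ, ‖z‖ = 1 → Φ z = z) → ∀ z, ‖z‖ ≤ 1 → ‖Φ z‖ ≤ 1 := by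
    intro Φ hΦ hΦ0 hΦc z hz
    rcases hz.lt_or_eq with hz | hz
    · have hpre : IsPreconnected (Φ '' Metric.ball 0 1) :=
        ((convex_ball (0:ℂ) 1).isPreconnected).image _ hΦ.1.continuous.continuousOn
      have hne : ∀ w ∈ Φ '' Metric.ball 0 1, ‖w‖ ≠ 1 := by
        rintro _ ⟨w, hw, rfl⟩ h
        have h1 := hΦc _ h
        have h2 := Φ.injective h1
        rw [h2] at h
        rw [mem_ball_zero_iff] at hw
        exact hw.ne h
      by_contra hlt
      rw [not_le] at hlt
      have := (hpre.image norm continuous_norm.continuousOn)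
      obtain ⟨w, hw, hw1⟩ := this.Icc_subset (a := 0) (b := ‖Φ z‖) ⟨Φ 0, ⟨0, by simp, rfl⟩, by rw [hΦ0, norm_zero]⟩
        ⟨Φ z, ⟨z, by simpa using hz, rfl⟩, rfl⟩ (show (1:RR) ∈ Icc 0 ‖Φ z‖ from ⟨zero_le_one, hlt.le⟩)
      exact hne w hw hw1
    · rw [hΦc z hz, hz]
  constructor
  · intro h
    have := key Ξ.symm hΞ.symm (by rw [Equiv.symm_apply_eq, h0]) (fun z hz => by rw [Equiv.symm_apply_eq, hcirc z hz]) _ h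
    simpa using this
  · exact key Ξ hΞ h0 hcirc z

theorem collar_log (e : P2 → ℂ) (he : CDi e) (hp : ∀ s t, e (s + PI, t) = e (s, t))
    (h0 : ∀ s, e (s, 0) = E0 (s, 0))
    (hpos : ∀ s, 0 < (fD e (s, 0) (0, 1) * (E0 (s, 0))⁻¹).re) :
    ∃ Ξ : ℂ ≃ ℂ, IsD Ξ ∧ (∀ z, ‖Ξ z‖ ≤ 1 ↔ ‖z‖ ≤ 1) ∧ ∃ t0 > 0, ∀ s t, |t| ≤ t0 → Ξ (E0 (s, t)) = e (s, t) := by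
  have hE : CDi E0 := E0_smooth
  set w : P2 → ℂ := fun x => e x * (E0 x)⁻¹ with hw
  have hws : CDi w := he.mul (hE.inv E0_ne)
  have hwp : ∀ s t, w (s + PI, t) = w (s, t) := by intro s t; simp only [hw, hp, E0_per]
  have hw0 : ∀ s, w (s, 0) = 1 := by intro s; simp only [hw, h0]; exact mul_inv_cancel₀ (E0_ne _)
  have e1 := per_tube (fun x : P2 => w x ∈ Complex.slitPlane) (Complex.isOpen_slitPlane.preimage hws.continuous)
    (fun s t => by rw [hwp]) 0 (fun s => by rw [hw0]; simp)
  obtain ⟨ε, hε, hεw⟩ := Metric.eventually_nhds_iff.1 e1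
  obtain ⟨ψ, hψ, hψε, hψid⟩ := clamp ε hε
  set l : P2 → ℂ := fun x => Complex.log (w (x.1, ψ x.2)) with hl
  have hsl : ∀ x : P2, w (x.1, ψ x.2) ∈ Complex.slitPlane := fun x =>
    hεw (by rw [Real.dist_eq, sub_zero]; exact hψε _) x.1
  have hin : CDi fun x : P2 => w (x.1, ψ x.2) :=
    hws.comp (contDiff_fst.prodMk (hψ.comp contDiff_snd))
  have hls : CDi l := by
    rw [contDiff_iff_contDiffAt]
    intro x
    have a : ContDiffAt RR ∞ Complex.log (w (x.1, ψ x.2)) := (Complex.contDiffAt_log (hsl x)).restrict_scalars RR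
    exact a.comp x hin.contDiffAt
  set μ : P2 → P2 := fun x => (-(l x).im / 2, (l x).re) with hμ
  have hμs : CDi μ :=
    (((Complex.imCLM.contDiff.comp hls).neg).div_const 2).prodMk (Complex.reCLM.contDiff.comp hls)
  have hψ0 : ψ 0 = 0 := hψid 0 (by simp; positivity)
  have hl0 : ∀ s, l (s, 0) = 0 := by intro s; simp only [hl, hψ0, hw0, Complex.log_one]
  have hE0μ : ∀ s t, |t| ≤ ε / 2 → E0 ((s, t) + μ (s, t)) = e (s, t) := by
    intro s t ht
    have h1 : E0 (μ (s, t)) = w (s, t) := by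
      have h2 : μ (s, t) = S0 (w (s, t)) := by simp only [hμ, hl, hψid t ht, S0]
      rw [h2, E0_S0]
      have := hsl (s, t); simp only [hψid t ht] at this
      exact Complex.slitPlane_ne_zero this
    rw [E0_add, h1]
    simp only [hw]
    rw [mul_comm (e _), mul_inv_cancel_left₀ (E0_ne _)]
  obtain ⟨Ξ, hΞ, hΞ0, t0, ht0, hΞe⟩ := collar_main μ hμs
    (by intro s t; simp only [hμ, hl, hwp])
    (by intro s; simp only [hμ, hl0]; simp) (by
    intro s
    have hd : HasDerivAt (fun t : RR => ((s, t) : P2)) (0, 1) 0 := (hasDerivAt_const 0 s).prodMk (hasDerivAt_id 0)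
    have d1 := ((hμs.differentiable (by simp)) (s, 0)).hasFDerivAt.comp_hasDerivAt 0 hd
    have d2 := (ContinuousLinearMap.snd RR RR RR).hasFDerivAt.comp_hasDerivAt 0 d1
    have dE := ((hE.differentiable (by simp)) (s, 0)).hasFDerivAt.comp_hasDerivAt 0 hd
    have de := ((he.differentiable (by simp)) (s, 0)).hasFDerivAt.comp_hasDerivAt 0 hd
    obtain ⟨L, hL, hLd⟩ := E0_hasFDerivAt (s, 0)
    rw [hL.fderiv, hLd] at dE
    have dw : HasDerivAt (fun t : RR => w (s, t)) (fD e (s, 0) (0, 1) * (E0 (s, 0))⁻¹ - 1) 0 := by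
      have := de.mul (dE.inv (E0_ne _))
      refine this.congr_deriv ?_
      have hz := E0_ne (s, 0)
      simp [Function.comp, h0]
      field_simp
      try ring
    have dlog : HasDerivAt (fun t : RR => Complex.log (w (s, t))) (fD e (s, 0) (0, 1) * (E0 (s, 0))⁻¹ - 1) 0 := by
      have h1 : HasDerivAt Complex.log 1 (w (s, 0)) := by
        rw [hw0]; simpa using Complex.hasDerivAt_log (z := 1) (by simp)
      have := HasDerivAt.scomp (𝕜 := RR) (𝕜' := ℂ) (0:RR) h1 dw
      exact this.congr_deriv (by simp)
    have dre := Complex.reCLM.hasFDerivAt.comp_hasDerivAt 0 dlog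
    have hev : (fun t : RR => (μ (s, t)).2) =ᶠ[𝓝 0] fun t => (Complex.log (w (s, t))).re := by
      have : ∀ᶠ t : RR in 𝓝 0, |t| ≤ ε / 2 := by
        filter_upwards [Metric.closedBall_mem_nhds (0:RR) (half_pos hε)] with t ht
        simpa using ht
      filter_upwards [this] with t ht
      simp only [hμ, hl, hψid t ht]
    have := d2.unique (dre.congr_of_eventuallyEq hev)
    simp only [ContinuousLinearMap.coe_snd'] at this
    rw [this]
    simp only [Complex.reCLM_apply, Complex.sub_re, Complex.one_re]
    linarith [hpos s])
  refine ⟨Ξ, hΞ, disc_pres Ξ hΞ hΞ0 fun s => ?_, min t0 (ε / 2), by positivity, fun s t ht => ?_⟩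
  · rw [hΞe s 0 (by simp; exact ht0.le)]
    rw [hE0μ s 0 (by simp; positivity), h0]
  · rw [hΞe s t (ht.trans (min_le_left _ _)), hE0μ s t (ht.trans (min_le_right _ _))]


theorem uift (W : RR × RR × ℂ → P2) (hW : CDi W) (hp : ∀ s y, W (s + PI, y) = W (s, y))
    (c : RR → ℂ) (hc : Continuous c) (hcp : ∀ s, c (s + PI) = c s) (h0 : ∀ s, W (s, 0, c s) = 0)
    (hD : ∀ s (v : ℂ), fD W (s, 0, c s) (0, 0, v) = 0 → v = 0) :
    ∃ ε > 0, ∃ e : P2 → ℂ, CDi e ∧ (∀ s t, e (s + PI, t) = e (s, t)) ∧ (∀ s, e (s, 0) = c s) ∧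
      ∀ s t, |t| ≤ ε → W (s, t, e (s, t)) = 0 := by
  set G : RR × RR × ℂ → RR × RR × (P2) := fun x => (x.1, x.2.1, W x) with hG
  have hGs : CDi G := contDiff_fst.prodMk ((contDiff_fst.comp contDiff_snd).prodMk hW)
  have hgood : ∀ s, ∃ Θ : OpenPartialHomeomorph (RR × RR × ℂ) (RR × RR × (P2)), (s, 0, c s) ∈ Θ.source ∧
      (∀ x, Θ x = G x) ∧ ContDiffOn RR ∞ Θ.symm Θ.target := by
    intro s
    have hd : HasFDerivAt G ((ContinuousLinearMap.fst RR RR (RR × ℂ)).prod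
        (((ContinuousLinearMap.fst RR RR ℂ).comp (ContinuousLinearMap.snd RR RR (RR × ℂ))).prod (fD W (s, 0, c s)))) (s, 0, c s) :=
      (ContinuousLinearMap.fst RR RR (RR × ℂ)).hasFDerivAt.prodMk
       (((ContinuousLinearMap.fst RR RR ℂ).comp (ContinuousLinearMap.snd RR RR (RR × ℂ))).hasFDerivAt.prodMk
        ((hW.differentiable (by simp)) _).hasFDerivAt)
    set L := (ContinuousLinearMap.fst RR RR (RR × ℂ)).prod
        (((ContinuousLinearMap.fst RR RR ℂ).comp (ContinuousLinearMap.snd RR RR (RR × ℂ))).prod (fD W (s, 0, c s))) with hL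
    have hinj : Function.Injective (L : (RR × RR × ℂ) →ₗ[RR] (RR × RR × (P2))) := by
      rw [injective_iff_map_eq_zero]
      rintro ⟨a, b, v⟩ h
      have h' : (a, b, fD W (s, 0, c s) (a, b, v)) = (0 : RR × RR × (P2)) := h
      simp only [Prod.mk_eq_zero] at h'
      obtain ⟨rfl, rfl, h3⟩ := h'
      rw [hD s v (by rw [h3])]; rfl
    have hfr : Module.finrank RR (RR × RR × ℂ) = Module.finrank RR (RR × RR × (P2)) := by
      simp [Complex.finrank_real_complex]
    let L' := (LinearEquiv.ofInjectiveOfFinrankEq (L : (RR × RR × ℂ) →ₗ[RR] (RR × RR × (P2))) hinj hfr).toContinuousLinearEquiv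
    have hLL : (L' : (RR × RR × ℂ) →L[RR] (RR × RR × (P2))) = L := by
      ext x <;> rfl
    obtain ⟨Θ, a1, a2, -, a4⟩ := ift G (s, 0, c s) (Eventually.of_forall fun x => hGs.contDiffAt) L' (by rw [hLL]; exact hd)
    exact ⟨Θ, a1, a2, a4⟩
  have hbox : ∀ᶠ r : RR in 𝓝 0, ∀ s ∈ Icc (0:RR) PI, ∃ Θ : OpenPartialHomeomorph (RR × RR × ℂ) (RR × RR × (P2)),
      (∀ x, Θ x = G x) ∧ ContDiffOn RR ∞ Θ.symm Θ.target ∧ ∀ t p, |t| < r → ‖p - c s‖ < r → (s, t, p) ∈ Θ.source := by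
    apply isCompact_Icc.eventually_forall_of_forall_eventually
    intro s0 _
    obtain ⟨Θ, a1, a2, a4⟩ := hgood s0
    obtain ⟨r, hr, hball⟩ := Metric.isOpen_iff.1 Θ.open_source _ a1
    have e1 : ∀ᶠ z : P2 in 𝓝 (0, s0), z.1 < r / 2 ∧ dist z.2 s0 < r ∧ ‖c z.2 - c s0‖ < r / 2 := by
      have o : IsOpen {z : P2 | z.1 < r / 2 ∧ dist z.2 s0 < r ∧ ‖c z.2 - c s0‖ < r / 2} :=
        (isOpen_lt continuous_fst continuous_const).inter
          ((isOpen_lt (continuous_snd.dist continuous_const) continuous_const).inter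
            (isOpen_lt ((hc.comp continuous_snd).sub continuous_const).norm continuous_const))
      exact o.mem_nhds (by simp [hr])
    filter_upwards [e1] with z hz
    refine ⟨Θ, a2, a4, fun t p ht hp => hball ?_⟩
    obtain ⟨h1, h2, h3⟩ := hz
    rw [Metric.mem_ball, Prod.dist_eq, Prod.dist_eq]
    refine max_lt h2 (max_lt ?_ ?_)
    · rw [Real.dist_eq, sub_zero]; linarith
    · rw [dist_eq_norm]
      calc ‖p - c s0‖ = ‖(p - c z.2) + (c z.2 - c s0)‖ := by congr 1; ring
        _ ≤ _ := norm_add_le _ _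
        _ < r := by linarith
  obtain ⟨r, hr, hr2⟩ := Metric.eventually_nhds_iff.1 hbox
  set δ := r / 2 with hδ
  have hδ0 : 0 < δ := half_pos hr
  have hΘ := hr2 (y := δ) (by rw [Real.dist_eq, sub_zero, abs_of_pos hδ0]; linarith)
  have hWp := per_int W hp
  have hcpn : ∀ (n : ℤ) s, c (s + n * PI) = c s := fun n s => per_int (fun x : RR × Unit => c x.1) (fun s y => hcp s) n s ()
  have huniq : ∀ s t p p', |t| < δ → ‖p - c s‖ < δ → ‖p' - c s‖ < δ → W (s, t, p) = 0 → W (s, t, p') = 0 → p = p' := by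
    intro s t p p' ht h1 h2 h3 h4
    obtain ⟨n, s', hs', rfl⟩ := per_rep s
    rw [hcpn] at h1 h2
    rw [hWp] at h3 h4
    obtain ⟨Θ, a2, a4, a5⟩ := hΘ s' hs'
    have := Θ.injOn (a5 t p ht h1) (a5 t p' ht h2) (by rw [a2, a2]; simp only [hG, h3, h4])
    simpa using this
  have hloc : ∀ s0 ∈ Icc (0:RR) PI, ∀ t0 p0, |t0| < δ → ‖p0 - c s0‖ < δ → W (s0, t0, p0) = 0 →
      ∃ h : P2 → ℂ, ContDiffAt RR ∞ h (s0, t0) ∧ h (s0, t0) = p0 ∧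
        ∀ᶠ x : P2 in 𝓝 (s0, t0), W (x.1, x.2, h x) = 0 ∧ ‖h x - c x.1‖ < δ ∧ |x.2| < δ := by
    intro s0 hs0 t0 p0 ht hp0 hw
    obtain ⟨Θ, a2, a4, a5⟩ := hΘ s0 hs0
    have hsrc := a5 t0 p0 ht hp0
    have hG0 : Θ (s0, t0, p0) = (s0, t0, 0) := by rw [a2]; simp only [hG, hw]
    have htgt : (s0, t0, (0 : P2)) ∈ Θ.target := by rw [← hG0]; exact Θ.map_source hsrc
    have hinv : Θ.symm (s0, t0, 0) = (s0, t0, p0) := by rw [← hG0]; exact Θ.left_inv hsrc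
    have hin : CDi fun x : P2 => (x.1, x.2, (0 : P2)) :=
      contDiff_fst.prodMk (contDiff_snd.prodMk contDiff_const)
    have hs : ContDiffAt RR ∞ (fun x : P2 => (Θ.symm (x.1, x.2, 0)).2.2) (s0, t0) := by
      have h1 : ContDiffAt RR ∞ Θ.symm ((fun x : P2 => (x.1, x.2, (0 : P2))) (s0, t0)) :=
        a4.contDiffAt (Θ.open_target.mem_nhds htgt)
      exact (contDiff_snd.comp contDiff_snd).contDiffAt.comp _ (ContDiffAt.comp (s0, t0) h1 hin.contDiffAt)
    refine ⟨_, hs, by simp only [hinv], ?_⟩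
    have e1 : ∀ᶠ x : P2 in 𝓝 (s0, t0), (x.1, x.2, (0 : P2)) ∈ Θ.target :=
      hin.continuous.continuousAt.preimage_mem_nhds (Θ.open_target.mem_nhds htgt)
    have e2 : ∀ᶠ x : P2 in 𝓝 (s0, t0), ‖(Θ.symm (x.1, x.2, 0)).2.2 - c x.1‖ < δ := by
      have : ContinuousAt (fun x : P2 => ‖(Θ.symm (x.1, x.2, 0)).2.2 - c x.1‖) (s0, t0) :=
        (hs.continuousAt.sub (hc.comp continuous_fst).continuousAt).norm
      exact this.preimage_mem_nhds (Iio_mem_nhds (by simpa only [hinv] using hp0))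
    have e3 : ∀ᶠ x : P2 in 𝓝 (s0, t0), |x.2| < δ :=
      (isOpen_lt (continuous_snd.abs) continuous_const).mem_nhds ht
    filter_upwards [e1, e2, e3] with x h1 h2 h3
    refine ⟨?_, h2, h3⟩
    have h4 := Θ.right_inv h1
    rw [a2] at h4
    simp only [hG, Prod.mk.injEq] at h4
    obtain ⟨h5, h6, h7⟩ := h4
    rw [show ((x.1, x.2, (Θ.symm (x.1, x.2, 0)).2.2) : RR × RR × ℂ) = Θ.symm (x.1, x.2, 0) from
      Prod.ext h5.symm (Prod.ext h6.symm rfl)]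
    exact h7
  have hex : ∀ᶠ t : RR in 𝓝 0, ∀ s ∈ Icc (0:RR) PI, ∃ p, ‖p - c s‖ < δ ∧ W (s, t, p) = 0 := by
    apply isCompact_Icc.eventually_forall_of_forall_eventually
    intro s0 hs0
    obtain ⟨h, -, -, h3⟩ := hloc s0 hs0 0 (c s0) (by simpa using hδ0) (by simpa using hδ0) (h0 s0)
    have hsw : Tendsto (fun z : P2 => (z.2, z.1)) (𝓝 (0, s0)) (𝓝 (s0, 0)) :=
      (continuous_snd.prodMk continuous_fst).tendsto (0, s0)
    filter_upwards [hsw.eventually h3] with z hz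
    exact ⟨_, hz.2.1, hz.1⟩
  obtain ⟨ε0, hε0, hex2⟩ := Metric.eventually_nhds_iff.1 hex
  set ε := min ε0 δ with hε
  have hεp : 0 < ε := lt_min hε0 hδ0
  have hex3 : ∀ x : P2, |x.2| < ε → ∃ p, ‖p - c x.1‖ < δ ∧ W (x.1, x.2, p) = 0 := by
    rintro ⟨s, t⟩ ht
    obtain ⟨n, s', hs', rfl⟩ := per_rep s
    simp only [hcpn, hWp]
    exact hex2 (by rw [Real.dist_eq, sub_zero]; exact ht.trans_le (min_le_left _ _)) s' hs'
  choose! e he1 he2 using hex3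
  have htδ : ∀ t, |t| < ε → |t| < δ := fun t ht => ht.trans_le (min_le_right _ _)
  have hep : ∀ s t, |t| < ε → e (s + PI, t) = e (s, t) := by
    intro s t ht
    have a1 := he1 (s + PI, t) ht
    have a2 := he2 (s + PI, t) ht
    simp only [hcp, hp] at a1 a2
    exact huniq s t _ _ (htδ t ht) a1 (he1 (s, t) ht) a2 (he2 (s, t) ht)
  have hes0 : ∀ s0 ∈ Icc (0:RR) PI, ∀ t0, |t0| < ε → ContDiffAt RR ∞ e (s0, t0) := by
    intro s0 hs0 t0 ht0
    obtain ⟨h, a1, a2, a3⟩ := hloc s0 hs0 t0 (e (s0, t0)) (htδ _ ht0) (he1 (s0, t0) ht0) (he2 (s0, t0) ht0)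
    refine a1.congr_of_eventuallyEq ?_
    have e3 : ∀ᶠ x : P2 in 𝓝 (s0, t0), |x.2| < ε :=
      (isOpen_lt (continuous_snd.abs) continuous_const).mem_nhds ht0
    filter_upwards [a3, e3] with x hx hx2
    exact huniq x.1 x.2 _ _ hx.2.2 (he1 x hx2) hx.2.1 (he2 x hx2) hx.1
  obtain ⟨ψ, hψ, hψε, hψid⟩ := clamp ε hεp
  have hψ0 : ψ 0 = 0 := hψid 0 (by simp; positivity)
  have hper : ∀ s t, e (s + PI, ψ t) = e (s, ψ t) := fun s t => hep s _ (hψε t)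
  refine ⟨ε / 2, half_pos hεp, fun x => e (x.1, ψ x.2), ?_, hper, fun s => ?_, fun s t ht => ?_⟩
  · rw [contDiff_iff_contDiffAt]
    have key : ∀ s0 ∈ Icc (0:RR) PI, ∀ t0, ContDiffAt RR ∞ (fun x : P2 => e (x.1, ψ x.2)) (s0, t0) := by
      intro s0 hs0 t0
      exact ContDiffAt.comp (s0, t0) (hes0 s0 hs0 (ψ t0) (hψε t0)) (contDiff_fst.prodMk (hψ.comp contDiff_snd)).contDiffAt
    rintro ⟨s, t⟩
    obtain ⟨n, s', hs', rfl⟩ := per_rep s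
    have : (fun x : P2 => e (x.1, ψ x.2)) = (fun x : P2 => e (x.1, ψ x.2)) ∘ fun x => (x.1 - n * PI, x.2) := by
      funext x
      have := per_int (fun x : P2 => e (x.1, ψ x.2)) hper n (x.1 - n * PI) x.2
      simp only [sub_add_cancel] at this
      simpa using this
    rw [this]
    refine ContDiffAt.comp _ ?_ ((contDiff_fst.sub contDiff_const).prodMk contDiff_snd).contDiffAt
    simp only [add_sub_cancel_right]
    exact key s' hs' t
  · simp only [hψ0]
    exact huniq s 0 _ _ (by simpa using hδ0) (he1 (s, 0) (by simpa using hεp)) (by simpa using hδ0)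
      (he2 (s, 0) (by simpa using hεp)) (h0 s)
  · simp only [hψid t ht]
    exact he2 (s, t) (by show |t| < ε; linarith)


theorem loop_stable {Y F : Type} [NormedAddCommGroup Y] [NormedSpace RR Y] [FiniteDimensional RR Y]
    [NormedAddCommGroup F] [NormedSpace RR F] [CompleteSpace F]
    (Λ : RR × (RR × Y) → F) (hΛ : CDi Λ) (hp : ∀ s y, Λ (s + PI, y) = Λ (s, y)) (T : Set Y) (hT : IsCompact T)
    (γ : RR → F) (hγ0 : ∀ s, ∀ τ ∈ T, Λ (s, 0, τ) = γ s) (hγ : ∀ t, deriv γ t ≠ 0)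
    (hγi : ∀ u v, γ u = γ v → ∃ n : ℤ, u - v = n * PI) :
    ∃ ε > 0, ∀ t, |t| < ε → ∀ τ ∈ T, (∀ s s', Λ (s, t, τ) = Λ (s', t, τ) → ∃ n : ℤ, s - s' = n * PI) ∧
      ∀ s, fD Λ (s, t, τ) (1, 0) ≠ 0 := by
  have hΛd := hΛ.differentiable (by simp)
  set Q : (RR × RR × (RR × Y)) → F := fun x => ∫ θ in (0:RR)..1, fD Λ (x.1 + θ * x.2.1, x.2.2) (1, 0) with hQ
  have hin : CDi fun q : (RR × RR × (RR × Y)) × RR => (q.1.1 + q.2 * q.1.2.1, q.1.2.2) := by fun_prop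
  have hD : CDi (fD Λ) := hΛ.fderiv_right (by simp)
  have hφ : CDi fun q : (RR × RR × (RR × Y)) × RR => fD Λ (q.1.1 + q.2 * q.1.2.1, q.1.2.2) (1, 0) :=
    (hD.comp hin).clm_apply contDiff_const
  have hQc : Continuous Q := (contDiff_paramInt _ hφ).continuous
  have hder : ∀ s y, HasDerivAt (fun s => Λ (s, y)) (fD Λ (s, y) (1, 0)) s := by
    intro s y
    exact (hΛd (s, y)).hasFDerivAt.comp_hasDerivAt s ((hasDerivAt_id s).prodMk (hasDerivAt_const s y))
  have hQe : ∀ s h y, Λ (s + h, y) - Λ (s, y) = h • Q (s, h, y) := by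
    intro s h y
    have h1 : ∀ θ ∈ uIcc (0:RR) 1, HasDerivAt (fun θ => Λ (s + θ * h, y)) (h • fD Λ (s + θ * h, y) (1, 0)) θ := by
      intro θ _
      have := (hder (s + θ * h) y).scomp θ (((hasDerivAt_id θ).mul_const h).const_add s)
      exact this.congr_deriv (by simp)
    have h2 := intervalIntegral.integral_eq_sub_of_hasDerivAt h1 (by
      apply Continuous.intervalIntegrable
      have : Continuous fun θ : RR => fD Λ (s + θ * h, y) (1, 0) :=
        hφ.continuous.comp (g := fun q : (RR × RR × (RR × Y)) × RR => fD Λ (q.1.1 + q.2 * q.1.2.1, q.1.2.2) (1, 0))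
          (f := fun θ => ((s, h, y), θ)) (by fun_prop)
      exact this.const_smul h)
    rw [intervalIntegral.integral_smul] at h2
    simp only [one_mul, zero_mul, add_zero] at h2
    exact h2.symm
  have hQ0 : ∀ s y, Q (s, 0, y) = fD Λ (s, y) (1, 0) := by
    intro s y; simp [hQ]
  have hpi := Real.pi_pos
  have hne : ∀ s, ∀ h ∈ Icc (-(PI / 2)) (PI / 2), ∀ τ ∈ T, Q (s, h, 0, τ) ≠ 0 := by
    intro s h hh τ hτ h0
    by_cases hh0 : h = 0
    · rw [hh0, hQ0, ← (hder s (0, τ)).deriv] at h0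
      have : (fun s => Λ (s, 0, τ)) = γ := funext fun s => hγ0 s τ hτ
      rw [this] at h0
      exact hγ s h0
    · have := hQe s h (0, τ)
      rw [h0, smul_zero, hγ0 _ τ hτ, hγ0 _ τ hτ, sub_eq_zero] at this
      obtain ⟨n, hn⟩ := hγi _ _ this
      rw [add_sub_cancel_left] at hn
      have hn1 : |(n:RR)| * PI ≤ PI / 2 := by
        have : |h| ≤ PI / 2 := abs_le.2 hh
        rw [hn, abs_mul, abs_of_pos hpi] at this; exact this
      have hn2 : |(n:RR)| < 1 := by nlinarith
      have hn3 : n = 0 := by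
        have : |n| < 1 := by exact_mod_cast hn2
        exact Int.abs_lt_one_iff.1 this
      rw [hn3] at hn; simp at hn; exact hh0 hn
  have hev : ∀ᶠ t : RR in 𝓝 0, ∀ x ∈ (Icc (0:RR) PI) ×ˢ ((Icc (-(PI / 2)) (PI / 2)) ×ˢ T),
      Q (x.1, x.2.1, t, x.2.2) ≠ 0 := by
    apply (isCompact_Icc.prod (isCompact_Icc.prod hT)).eventually_forall_of_forall_eventually
    rintro ⟨s, h, τ⟩ ⟨-, hh, hτ⟩
    have hc : Continuous fun z : RR × (RR × RR × Y) => Q (z.2.1, z.2.2.1, z.1, z.2.2.2) := hQc.comp (by fun_prop)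
    exact (isOpen_ne.preimage hc).mem_nhds (hne s h hh τ hτ)
  obtain ⟨ε, hε, hev⟩ := Metric.eventually_nhds_iff.1 hev
  refine ⟨ε, hε, fun t ht τ hτ => ?_⟩
  have hQp : ∀ s h y, Q (s + PI, h, y) = Q (s, h, y) := by
    intro s h y
    simp only [hQ]
    congr 1; funext θ
    rw [show s + PI + θ * h = (s + θ * h) + PI by ring, fderiv_per Λ hp]
  have hall : ∀ s, ∀ h ∈ Icc (-(PI / 2)) (PI / 2), Q (s, h, t, τ) ≠ 0 := by
    intro s h hh
    obtain ⟨n, s', hs', rfl⟩ := per_rep s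
    rw [per_int Q (fun s y => hQp s y.1 y.2)]
    exact hev (by rw [Real.dist_eq, sub_zero]; exact ht) (s', h, τ) ⟨hs', hh, hτ⟩
  refine ⟨fun s s' hss => ?_, fun s => ?_⟩
  · obtain ⟨n, h, hh, he⟩ := per_rep (s - s' + PI / 2)
    refine ⟨n, ?_⟩
    have h1 : Λ (s' + (h - PI / 2), t, τ) = Λ (s', t, τ) := by
      rw [← hss, ← per_int Λ hp n]
      congr 2; linarith
    have h2 := hQe s' (h - PI / 2) (t, τ)
    rw [h1, sub_self] at h2
    have h3 := (smul_eq_zero.1 h2.symm).resolve_right (hall s' _ ⟨by linarith [hh.1], by linarith [hh.2]⟩)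
    linarith
  · rw [← hQ0]; exact hall s 0 ⟨by linarith, by linarith⟩

noncomputable def rt (r : RR → RR) (κ m : RR) : RR := 2 * m / (1 + r (2 * κ * m))

theorem rt_exists : ∃ r : RR → RR, CDi r ∧ (∀ u, 0 < r u) ∧ ∀ u, |u| ≤ 1 / 2 → r u = Real.sqrt (1 + u) := by
  obtain ⟨ψ, h1, h2, h3⟩ := clamp 1 one_pos
  have hp : ∀ u, 0 < 1 + ψ u := fun u => by linarith [(abs_lt.1 (h2 u)).1]
  refine ⟨fun u => Real.sqrt (1 + ψ u), ?_, fun u => Real.sqrt_pos.2 (hp u), fun u hu => by simp only [h3 u hu]⟩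
  exact ContDiff.sqrt (contDiff_const.add h1) fun u => (hp u).ne'

theorem rt_eq (r : RR → RR) (hr : ∀ u, 0 < r u) (h : ∀ u, |u| ≤ 1 / 2 → r u = Real.sqrt (1 + u)) (κ m : RR) (hm : |2 * κ * m| ≤ 1 / 2) :
    rt r κ m + κ * rt r κ m ^ 2 / 2 = m := by
  have h1 := h _ hm
  have h2 : r (2 * κ * m) ^ 2 = 1 + 2 * κ * m := by
    rw [h1, Real.sq_sqrt]; linarith [(abs_le.1 hm).1]
  have h3 := hr (2 * κ * m)
  rw [rt]
  generalize r (2 * κ * m) = R at *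
  have h4 : 0 < 1 + R := by linarith
  field_simp
  linear_combination m * (-h2)

theorem rt_rec (r : RR → RR) (hr : ∀ u, 0 < r u) (h : ∀ u, |u| ≤ 1 / 2 → r u = Real.sqrt (1 + u)) (κ n : RR) (hn : |κ * n| ≤ 1 / 8) :
    rt r κ (n + κ * n ^ 2 / 2) = n := by
  obtain ⟨a, b⟩ := abs_le.1 hn
  have h1 : r (2 * κ * (n + κ * n ^ 2 / 2)) = 1 + κ * n := by
    rw [h, show 1 + 2 * κ * (n + κ * n ^ 2 / 2) = (1 + κ * n) ^ 2 by ring, Real.sqrt_sq (by linarith)]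
    rw [abs_le, show 2 * κ * (n + κ * n ^ 2 / 2) = 2 * (κ * n) + (κ * n) ^ 2 by ring]
    constructor <;> nlinarith
  rw [rt, h1]
  have : 0 < 1 + (1 + κ * n) := by linarith
  rw [div_eq_iff this.ne']
  ring

theorem prim_ds (D μ : P2 → RR) (hD : CDi D) (hμ : CDi μ) (h0 : ∀ s, μ (s, 0) = 0) (ε : RR)
    (h : ∀ s t, |t| ≤ ε → fD μ (s, t) (0, 1) = - fD D (s, t) (1, 0)) (s t : RR) (ht : |t| ≤ ε) :
    t * fD (fun x : P2 => -∫ θ in (0:RR)..1, D (x.1, θ * x.2)) (s, t) (1, 0) = μ (s, t) := by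
  have hDd := hD.differentiable (by simp)
  have hc1 : Continuous fun x => fD D x (1, 0) := (hD.continuous_fderiv (by simp)).clm_apply continuous_const
  have hsm : CDi fun x : P2 => -∫ θ in (0:RR)..1, D (x.1, θ * x.2) := by
    refine (contDiff_paramInt (fun q : (P2) × RR => D (q.1.1, q.2 * q.1.2)) (hD.comp ?_)).neg
    fun_prop
  have h1 : HasDerivAt (fun s => ∫ θ in (0:RR)..1, D (s, θ * t)) (∫ θ in (0:RR)..1, fD D (s, θ * t) (1, 0)) s := by
    have hc2 : Continuous fun q : P2 => fD D (q.1, q.2 * t) (1, 0) :=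
      hc1.comp (f := fun q : P2 => (q.1, q.2 * t)) (by fun_prop)
    obtain ⟨C, hC⟩ := ((isCompact_closedBall s 1).prod (isCompact_Icc (a := (0:RR)) (b := 1))).exists_bound_of_continuousOn hc2.continuousOn
    refine (intervalIntegral.hasDerivAt_integral_of_dominated_loc_of_deriv_le (bound := fun _ => C)
      (F := fun s θ => D (s, θ * t)) (F' := fun s θ => fD D (s, θ * t) (1, 0))
      (Metric.closedBall_mem_nhds s one_pos) ?_ ?_ ?_ ?_ ?_ ?_).2
    · exact Eventually.of_forall fun x => (hD.continuous.comp (f := fun θ : RR => (x, θ * t)) (by fun_prop)).aestronglyMeasurable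
    · exact (hD.continuous.comp (f := fun θ : RR => (s, θ * t)) (by fun_prop)).intervalIntegrable _ _
    · exact (hc2.comp (f := fun θ : RR => (s, θ)) (by fun_prop)).aestronglyMeasurable
    · refine Eventually.of_forall fun θ hθ x hx => hC (x, θ) ⟨hx, ?_⟩
      rw [uIoc_of_le zero_le_one] at hθ
      exact ⟨hθ.1.le, hθ.2⟩
    · exact intervalIntegrable_const
    · refine Eventually.of_forall fun θ hθ x hx => ?_
      exact (hDd (x, θ * t)).hasFDerivAt.comp_hasDerivAt x ((hasDerivAt_id x).prodMk (hasDerivAt_const x _))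
  have h2 := ((hsm.differentiable (by simp)) (s, t)).hasFDerivAt.comp_hasDerivAt s ((hasDerivAt_id s).prodMk (hasDerivAt_const s t))
  have h3 := h2.unique h1.neg
  rw [h3]
  have h4 : ∀ θ ∈ uIcc (0:RR) 1, HasDerivAt (fun θ => μ (s, θ * t)) (t * -fD D (s, θ * t) (1, 0)) θ := by
    intro θ hθ
    rw [uIcc_of_le zero_le_one] at hθ
    have a := ((hμ.differentiable (by simp)) (s, θ * t)).hasFDerivAt.comp_hasDerivAt θ
      ((hasDerivAt_const θ s).prodMk ((hasDerivAt_id θ).mul_const t))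
    refine a.congr_deriv ?_
    rw [← h s (θ * t) (by rw [abs_mul, abs_of_nonneg hθ.1]; nlinarith [hθ.2, abs_nonneg t])]
    rw [show ((0, 1 * t) : P2) = t • (0, 1) by simp, map_smul, smul_eq_mul]
  have h5 := intervalIntegral.integral_eq_sub_of_hasDerivAt h4 (by
    apply Continuous.intervalIntegrable
    exact continuous_const.mul (hc1.comp (f := fun θ : RR => (s, θ * t)) (by fun_prop)).neg)
  rw [intervalIntegral.integral_const_mul, intervalIntegral.integral_neg] at h5
  rw [h5]; simp [h0]


noncomputable def P4 : R4 →L[RR] ℂ := LinearMap.toContinuousLinearMap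
  { toFun := fun v => ⟨v.1, v.2.2.1⟩
    map_add' := fun v w => by apply Complex.ext <;> simp
    map_smul' := fun a v => by apply Complex.ext <;> simp }

noncomputable def mk4 : ℂ × P2 →L[RR] R4 := LinearMap.toContinuousLinearMap
  { toFun := fun v => (v.1.re, v.2.1, v.1.im, v.2.2)
    map_add' := fun v w => by simp
    map_smul' := fun a v => by simp }

theorem P4_apply (v : R4) : P4 v = ⟨v.1, v.2.2.1⟩ := rfl
theorem mk4_apply (v : ℂ × P2) : mk4 v = (v.1.re, v.2.1, v.1.im, v.2.2) := rfl

def dt (a b : ℂ) : RR := a.re * b.im - a.im * b.re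

theorem omega_P4 (v w : R4) : omega4 v w = dt (P4 v) (P4 w) + v.2.1 * w.2.2.2 - v.2.2.2 * w.2.1 := by
  simp only [omega4, dt, P4_apply]

theorem mk4_P4 (v : R4) : mk4 (P4 v, v.2.1, v.2.2.2) = v := rfl

structure LagMap (F : ℂ → R4) : Prop where
  s : CDi F
  i : ∀ p, Function.Injective (fD F p)
  w : ∀ p u v, omega4 (fD F p u) (fD F p v) = 0

theorem y2_fderiv {E : Type*} [NormedAddCommGroup E] [NormedSpace RR E] (F : E → R4) (p : E) (hF : DifferentiableAt RR F p) (v : E) :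
    fD (fun q => (F q).2.2.2) p v = (fD F p v).2.2.2 := by
  have h := ((ContinuousLinearMap.snd RR RR RR).comp ((ContinuousLinearMap.snd RR RR (P2)).comp
    (ContinuousLinearMap.snd RR RR (RR × P2)))).hasFDerivAt.comp p hF.hasFDerivAt
  have h2 : fD (fun q => (F q).2.2.2) p = _ := h.fderiv
  rw [h2]; rfl

theorem lag_vert (F : ℂ → R4) (hF : LagMap F) (p v : ℂ) (h1 : P4 (fD F p v) = 0) (h2 : (fD F p v).2.2.2 = 0)
    (hg : fD (fun q => (F q).2.2.2) p ≠ 0) : v = 0 := by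
  have hd := hF.s.differentiable (by simp) p
  obtain ⟨u, hu⟩ : ∃ u, (fD F p u).2.2.2 ≠ 0 := by
    by_contra h; push Not at h
    apply hg; ext u
    rw [y2_fderiv F p hd, h]; rfl
  have h3 := hF.w p v u
  rw [omega_P4, h1, h2] at h3
  simp [dt, hu] at h3
  apply hF.i p
  rw [map_zero, ← mk4_P4 (fD F p v), h1, h2, h3]
  exact map_zero mk4

theorem z_imm (F : ℂ → R4) (hF : LagMap F) (c : RR → ℂ) (hc : CDi c) (hc' : ∀ t, deriv c t ≠ 0) (h0 : ∀ s, (F (c s)).2.2.2 = 0)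
    (hg : ∀ s, fD (fun q => (F q).2.2.2) (c s) ≠ 0) (s : RR) :
    HasDerivAt (fun s => F (c s)) (fD F (c s) (deriv c s)) s ∧ (fD F (c s) (deriv c s)).2.2.2 = 0 ∧
    deriv (fun s => P4 (F (c s))) s = P4 (fD F (c s) (deriv c s)) ∧ deriv (fun s => P4 (F (c s))) s ≠ 0 := by
  have hd := (hF.s.differentiable (by simp) (c s)).hasFDerivAt.comp_hasDerivAt s ((hc.differentiable (by simp)) s).hasDerivAt
  have hP := P4.hasFDerivAt.comp_hasDerivAt s hd
  have h4 : (fD F (c s) (deriv c s)).2.2.2 = 0 := by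
    have := ((ContinuousLinearMap.snd RR RR RR).comp ((ContinuousLinearMap.snd RR RR (P2)).comp
      (ContinuousLinearMap.snd RR RR (RR × P2)))).hasFDerivAt.comp_hasDerivAt s hd
    have h : HasDerivAt (fun s => (F (c s)).2.2.2) (fD F (c s) (deriv c s)).2.2.2 s := this
    have e : (fun s => (F (c s)).2.2.2) = fun _ => 0 := funext h0
    rw [e] at h
    exact h.unique (hasDerivAt_const s 0)
  have hP2 : deriv (fun s => P4 (F (c s))) s = _ := hP.deriv
  refine ⟨hd, h4, hP2, ?_⟩
  rw [hP2]
  intro h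
  exact hc' s (lag_vert F hF _ _ h h4 (hg s))

noncomputable def nuF (z : RR → ℂ) (s : RR) : ℂ := Complex.I * deriv z s * ((Complex.normSq (deriv z s))⁻¹ : RR)

theorem nuF_smooth (z : RR → ℂ) (hz : CDi z) (hz' : ∀ s, deriv z s ≠ 0) : CDi (nuF z) := by
  have h1 : CDi (deriv z) := ((contDiff_infty_iff_deriv).1 hz).2
  refine (contDiff_const.mul h1).mul (Complex.ofRealCLM.contDiff.comp ?_)
  have : (fun s => Complex.normSq (deriv z s)) = fun s => (deriv z s).re * (deriv z s).re + (deriv z s).im * (deriv z s).im := by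
    funext s; exact Complex.normSq_apply _
  refine ContDiff.inv ?_ fun s => (Complex.normSq_pos.2 (hz' s)).ne'
  rw [this]
  have a := Complex.reCLM.contDiff.comp h1
  have b := Complex.imCLM.contDiff.comp h1
  exact (a.mul a).add (b.mul b)

theorem nuF_dt (z : RR → ℂ) (s : RR) (h : deriv z s ≠ 0) : dt (deriv z s) (nuF z s) = 1 := by
  have h1 := (Complex.normSq_pos.2 h).ne'
  rw [Complex.normSq_apply, ← sq, ← sq] at h1
  simp [dt, nuF, Complex.normSq_apply]
  field_simp

theorem nuF_dec (z : RR → ℂ) (s : RR) (h : deriv z s ≠ 0) (w : ℂ)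
    (hw : (deriv z s).re * w.re + (deriv z s).im * w.im = 0) : w = dt (deriv z s) w • nuF z s := by
  have h1 := (Complex.normSq_pos.2 h).ne'
  rw [Complex.normSq_apply, ← sq, ← sq] at h1
  apply Complex.ext <;> simp [dt, nuF, Complex.normSq_apply]
  · field_simp; linear_combination (deriv z s).re * hw
  · field_simp; linear_combination (deriv z s).im * hw

theorem omega_G (z ν : RR → ℂ) (hz : Differentiable RR z) (hν : Differentiable RR ν) (n x : P2 → RR) (q : P2)
    (hn : DifferentiableAt RR n q) (hx : DifferentiableAt RR x q) (hd : dt (deriv z q.1) (ν q.1) = 1) :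
    (fD (fun q : P2 => mk4 (z q.1 + n q • ν q.1, x q, q.2)) q (1, 0)).2.2.2 = 0 ∧
    (fD (fun q : P2 => mk4 (z q.1 + n q • ν q.1, x q, q.2)) q (0, 1)).2.2.2 = 1 ∧
    omega4 (fD (fun q : P2 => mk4 (z q.1 + n q • ν q.1, x q, q.2)) q (1, 0))
      (fD (fun q : P2 => mk4 (z q.1 + n q • ν q.1, x q, q.2)) q (0, 1)) =
      (1 + dt (deriv ν q.1) (ν q.1) * n q) * fD n q (0, 1) + fD x q (1, 0) := by
  have hf := (ContinuousLinearMap.fst RR RR RR).hasFDerivAt (x := q)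
  have h1 : HasFDerivAt (fun q : P2 => z q.1) _ q := (hz q.1).hasDerivAt.hasFDerivAt.comp q hf
  have h2 : HasFDerivAt (fun q : P2 => ν q.1) _ q := (hν q.1).hasDerivAt.hasFDerivAt.comp q hf
  have h3 := mk4.hasFDerivAt.comp q ((h1.add (hn.hasFDerivAt.smul h2)).prodMk
    (hx.hasFDerivAt.prodMk (ContinuousLinearMap.snd RR RR RR).hasFDerivAt))
  have h4 : fD (fun q : P2 => mk4 (z q.1 + n q • ν q.1, x q, q.2)) q = _ := h3.fderiv
  rw [h4]
  refine ⟨?_, ?_, ?_⟩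
  · simp [mk4_apply]
  · simp [mk4_apply]
  · simp [mk4_apply, omega4]
    simp only [dt] at hd ⊢
    linear_combination (fD n q (0, 1)) * hd


theorem deriv_per {E : Type*} [NormedAddCommGroup E] [NormedSpace RR E] (z : RR → E) (h : ∀ s, z (s + PI) = z s) (s : RR) :
    deriv z (s + PI) = deriv z s := by
  have : (fun s => z (s + PI)) = z := funext h
  conv_rhs => rw [← this]
  rw [deriv_comp_add_const]

theorem nf (F : ℂ → R4) (hF : LagMap F) (c : RR → ℂ) (hc : IsLoop c) (h0 : ∀ s, (F (c s)).2.2.2 = 0)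
    (hg : ∀ s, fD (fun q => (F q).2.2.2) (c s) ≠ 0) (z : RR → ℂ) (hz : ∀ s, z s = P4 (F (c s))) :
    ∃ ε > 0, ∃ (e : P2 → ℂ) (n x : P2 → RR), CDi e ∧ CDi n ∧ CDi x ∧
      (∀ s t, e (s + PI, t) = e (s, t)) ∧ (∀ s t, n (s + PI, t) = n (s, t)) ∧ (∀ s t, x (s + PI, t) = x (s, t)) ∧
      (∀ s, e (s, 0) = c s) ∧ (∀ s, n (s, 0) = 0) ∧ (∀ s, x (s, 0) = (F (c s)).2.1) ∧
      (∀ s t, |t| ≤ ε → F (e (s, t)) = mk4 (z s + n (s, t) • nuF z s, x (s, t), t)) ∧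
      ∀ s t, |t| < ε → (1 + dt (deriv (nuF z) s) (nuF z s) * n (s, t)) * fD n (s, t) (0, 1) = - fD x (s, t) (1, 0) := by
  have hcs := hc.1
  have hcp : ∀ s, c (s + PI) = c s := fun s => (hc.2.2 _ _).2 ⟨1, by simp⟩
  have hze : z = fun s => P4 (F (c s)) := funext hz
  have hzs : CDi z := by rw [hze]; exact P4.contDiff.comp (hF.s.comp hcs)
  have hzi := z_imm F hF c hcs hc.2.1 h0 hg
  rw [← hze] at hzi
  have hz' : ∀ s, deriv z s ≠ 0 := fun s => (hzi s).2.2.2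
  have hzp : ∀ s, z (s + PI) = z s := fun s => by rw [hz, hz, hcp]
  have hzp' := deriv_per z hzp
  have hνp : ∀ s, nuF z (s + PI) = nuF z s := fun s => by simp only [nuF, hzp']
  have hνs := nuF_smooth z hzs hz'
  have hz's : CDi (deriv z) := ((contDiff_infty_iff_deriv).1 hzs).2
  have hre : CDi fun s => (deriv z s).re := Complex.reCLM.contDiff.comp hz's
  have him : CDi fun s => (deriv z s).im := Complex.imCLM.contDiff.comp hz's
  have hzre : CDi fun s => (z s).re := Complex.reCLM.contDiff.comp hzs
  have hzim : CDi fun s => (z s).im := Complex.imCLM.contDiff.comp hzs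
  have hFs := hF.s
  have f1 : CDi fun p => (F p).1 := contDiff_fst.comp hFs
  have f2 : CDi fun p => (F p).2.1 := contDiff_fst.comp (contDiff_snd.comp hFs)
  have f3 : CDi fun p => (F p).2.2.1 := contDiff_fst.comp (contDiff_snd.comp (contDiff_snd.comp hFs))
  have f4 : CDi fun p => (F p).2.2.2 := contDiff_snd.comp (contDiff_snd.comp (contDiff_snd.comp hFs))
  set W : RR × RR × ℂ → P2 := fun q => ((deriv z q.1).re * ((F q.2.2).1 - (z q.1).re) +
    (deriv z q.1).im * ((F q.2.2).2.2.1 - (z q.1).im), (F q.2.2).2.2.2 - q.2.1) with hW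
  have hWs : CDi W := by
    have s2 : CDi fun q : RR × RR × ℂ => q.2.2 := contDiff_snd.comp contDiff_snd
    exact (((hre.comp contDiff_fst).mul ((f1.comp s2).sub (hzre.comp contDiff_fst))).add
      ((him.comp contDiff_fst).mul ((f3.comp s2).sub (hzim.comp contDiff_fst)))).prodMk ((f4.comp s2).sub (contDiff_fst.comp contDiff_snd))
  have hdW : ∀ s (v : ℂ), fD W (s, 0, c s) (0, 0, v) = ((deriv z s).re * (fD F (c s) v).1 +
      (deriv z s).im * (fD F (c s) v).2.2.1, (fD F (c s) v).2.2.2) := by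
    intro s v
    let π3 := (ContinuousLinearMap.snd RR RR (P2)).comp (ContinuousLinearMap.snd RR RR (RR × P2))
    let A : R4 →L[RR] P2 := ((deriv z s).re • ContinuousLinearMap.fst RR RR (RR × P2) +
      (deriv z s).im • ((ContinuousLinearMap.fst RR RR RR).comp π3)).prod ((ContinuousLinearMap.snd RR RR RR).comp π3)
    have hl : HasFDerivAt (fun p : ℂ => ((s, 0, p) : RR × RR × ℂ))
        ((ContinuousLinearMap.inr RR RR (RR × ℂ)).comp (ContinuousLinearMap.inr RR RR ℂ)) (c s) := by
      have := (hasFDerivAt_const s (c s)).prodMk ((hasFDerivAt_const (0:RR) (c s)).prodMk (hasFDerivAt_id (𝕜 := RR) (c s)))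
      exact this
    have h1 := ((hWs.differentiable (by simp)) (s, 0, c s)).hasFDerivAt.comp (c s) hl
    have h2 := (A.hasFDerivAt.comp (c s) ((hFs.differentiable (by simp)) (c s)).hasFDerivAt).sub_const
      ((deriv z s).re * (z s).re + (deriv z s).im * (z s).im, (0:RR))
    have h3 : W ∘ (fun p : ℂ => ((s, 0, p) : RR × RR × ℂ)) = fun p => (A ∘ F) p - ((deriv z s).re * (z s).re + (deriv z s).im * (z s).im, (0:RR)) := by
      funext p
      simp [hW, A, π3]
      ring
    rw [h3] at h1
    exact congrArg (fun L : ℂ →L[RR] P2 => L v) (h1.unique h2)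
  obtain ⟨ε, hε, e, hes, hep, he0, heW⟩ := uift W hWs (fun s y => by simp only [hW, hzp, hzp']) c hcs.continuous hcp
    (fun s => by simp [hW, h0, hz s, P4_apply]) (by
      intro s v hv
      rw [hdW, Prod.mk_eq_zero] at hv
      obtain ⟨a1, a2⟩ := hv
      obtain ⟨b1, b2, b3, b4⟩ := hzi s
      have hw := hF.w (c s) (deriv c s) v
      rw [omega_P4, ← b3, b2, a2] at hw
      have hw2 : dt (deriv z s) (P4 (fD F (c s) v)) = 0 := by linarith
      refine lag_vert F hF (c s) v ?_ a2 (hg s)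
      rw [nuF_dec z s b4 (P4 (fD F (c s) v)) a1, hw2, zero_smul])
  have hνd := hνs.differentiable (by simp)
  set n : P2 → RR := fun q => (deriv z q.1).re * ((F (e q)).2.2.1 - (z q.1).im) - (deriv z q.1).im * ((F (e q)).1 - (z q.1).re) with hn
  set x : P2 → RR := fun q => (F (e q)).2.1 with hx
  have hns : CDi n := ((hre.comp contDiff_fst).mul ((f3.comp hes).sub (hzim.comp contDiff_fst))).sub
    ((him.comp contDiff_fst).mul ((f1.comp hes).sub (hzre.comp contDiff_fst)))
  have hxs : CDi x := f2.comp hes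
  have hFe : ∀ s t, |t| ≤ ε → F (e (s, t)) = mk4 (z s + n (s, t) • nuF z s, x (s, t), t) := by
    intro s t ht
    have h1 := heW s t ht
    simp only [hW, Prod.mk_eq_zero] at h1
    have h2 := nuF_dec z s (hz' s) (P4 (F (e (s, t))) - z s) (by simpa [P4_apply] using h1.1)
    have h3 : dt (deriv z s) (P4 (F (e (s, t))) - z s) = n (s, t) := by simp [dt, hn, P4_apply]
    rw [h3] at h2
    rw [← h2, add_sub_cancel]
    conv_lhs => rw [← mk4_P4 (F (e (s, t))), sub_eq_zero.1 h1.2]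
  refine ⟨ε, hε, e, n, x, hes, hns, hxs, hep, fun s t => by simp only [hn, hzp, hzp', hep], fun s t => by simp only [hx, hep],
    he0, fun s => by simp [hn, he0, hz s, P4_apply], fun s => by simp only [hx, he0], hFe, fun s t ht => ?_⟩
  have h1 := (omega_G z (nuF z) (hzs.differentiable (by simp)) hνd n x (s, t) (hns.differentiable (by simp) _)
    (hxs.differentiable (by simp) _) (nuF_dt z s (hz' s))).2.2
  have h2 : (fun q : P2 => mk4 (z q.1 + n q • nuF z q.1, x q, q.2)) =ᶠ[𝓝 (s, t)] F ∘ e := by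
    have : ∀ᶠ q : P2 in 𝓝 (s, t), |q.2| < ε := (isOpen_lt (continuous_snd.abs) continuous_const).mem_nhds ht
    filter_upwards [this] with q hq
    exact (hFe q.1 q.2 hq.le).symm
  rw [h2.fderiv_eq, fderiv_comp _ (hFs.differentiable (by simp) _) (hes.differentiable (by simp) _)] at h1
  simp only [ContinuousLinearMap.comp_apply] at h1
  rw [hF.w] at h1
  linarith


theorem cutoff1 (ε : RR) (hε : 0 < ε) : ∃ χ : RR → RR, CDi χ ∧ (∀ t, χ t ∈ Icc (0:RR) 1) ∧ (∀ t, t * deriv χ t ∈ Icc (-1:RR) 1) ∧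
    (∀ t, t ≤ -ε → χ t = 1 ∧ deriv χ t = 0) ∧ ∃ t0 > 0, t0 < ε ∧ ∀ t, -t0 ≤ t → χ t = 0 ∧ deriv χ t = 0 := by
  obtain ⟨χ, h1, h2, ⟨t0, ht0, h3⟩, h4, h5⟩ := log_cutoff (ε / 2) 1 (by positivity) one_pos
  let X : RR → RR := fun t => if t ≤ 0 then 1 - χ t else 0
  have e1 : ∀ t, t < 0 → X =ᶠ[𝓝 t] fun t => 1 - χ t := fun t ht => by
    filter_upwards [Iio_mem_nhds ht] with y hy
    simp only [X, if_pos (le_of_lt (mem_Iio.1 hy))]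
  have e0 : ∀ t, -t0 ≤ t → X t = 0 := fun t ht => by
    simp only [X]
    split_ifs with h
    · rw [h3 t (abs_le.2 ⟨ht, by linarith⟩), sub_self]
    · rfl
  have e2 : ∀ t, -t0 < t → X =ᶠ[𝓝 t] fun t => 0 := fun t ht => by
    filter_upwards [Ioi_mem_nhds ht] with y hy using e0 y (mem_Ioi.1 hy).le
  have d1 : ∀ t, t < 0 → deriv X t = - deriv χ t := fun t ht => by
    rw [(e1 t ht).deriv_eq, deriv_const_sub]
  have d2 : ∀ t, -t0 < t → deriv X t = 0 := fun t ht => by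
    rw [(e2 t ht).deriv_eq, deriv_const]
  refine ⟨X, ?_, fun t => ?_, fun t => ?_, fun t ht => ⟨?_, ?_⟩, min (t0 / 2) (ε / 2), by positivity, ?_, fun t ht => ?_⟩
  · rw [contDiff_iff_contDiffAt]
    intro t
    rcases lt_or_ge t 0 with h | h
    · exact (contDiff_const.sub h1).contDiffAt.congr_of_eventuallyEq (e1 t h)
    · exact contDiffAt_const.congr_of_eventuallyEq (e2 t (by linarith))
  · simp only [X]
    split_ifs
    · exact ⟨by linarith [(h2 t).2], by linarith [(h2 t).1]⟩
    · simp
  · rcases lt_or_ge t 0 with h | h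
    · rw [d1 t h, mem_Icc, ← abs_le, mul_neg, abs_neg]; exact h5 t
    · rw [d2 t (by linarith)]; simp
  · simp only [X, if_pos (show t ≤ 0 by linarith)]
    rw [h4 t (by rw [abs_of_nonpos (by linarith)]; linarith), sub_zero]
  · have : X =ᶠ[𝓝 t] fun t => 1 := by
      filter_upwards [Iio_mem_nhds (show t < -(ε / 2) by linarith)] with y hy
      have := mem_Iio.1 hy
      simp only [X, if_pos (show y ≤ 0 by linarith)]
      rw [h4 y (by rw [abs_of_nonpos (by linarith)]; linarith), sub_zero]
    rw [this.deriv_eq, deriv_const]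
  · exact (min_le_right _ _).trans_lt (by linarith)
  · have := min_le_left (t0 / 2) (ε / 2)
    exact ⟨e0 t (by linarith), d2 t (by linarith)⟩

theorem lag2 (L : P2 →L[RR] R4) (h1 : (L (1, 0)).2.2.2 = 0) (h2 : (L (0, 1)).2.2.2 = 1) (h3 : omega4 (L (1, 0)) (L (0, 1)) = 0)
    (h4 : L (1, 0) ≠ 0) : Function.Injective L ∧ ∀ u v, omega4 (L u) (L v) = 0 := by
  have h5 : ∀ u : P2, L u = u.1 • L (1, 0) + u.2 • L (0, 1) := fun u => by
    rw [← map_smul, ← map_smul, ← map_add]; simp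
  constructor
  · rw [injective_iff_map_eq_zero]
    intro u hu
    have h6 := h5 u
    rw [hu] at h6
    have h7 := congrArg (fun v : R4 => v.2.2.2) h6
    simp [h1, h2] at h7
    rw [← h7, zero_smul, add_zero] at h6
    exact Prod.ext ((smul_eq_zero.1 h6.symm).resolve_right h4) h7.symm
  · intro u v
    rw [h5 u, h5 v]
    simp only [omega4] at *
    simp
    linear_combination (u.1 * v.2 - u.2 * v.1) * h3

theorem interp (z ν : RR → ℂ) (hz : CDi z) (hν : CDi ν) (hzp : ∀ s, z (s + PI) = z s)
    (hνp : ∀ s, ν (s + PI) = ν s) (hd : ∀ s, dt (deriv z s) (ν s) = 1) (ε : RR) (hε : 0 < ε)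
    (n x : Fin 2 → P2 → RR) (hn : ∀ i, CDi (n i)) (hx : ∀ i, CDi (x i))
    (hnp : ∀ i s t, n i (s + PI, t) = n i (s, t)) (hxp : ∀ i s t, x i (s + PI, t) = x i (s, t))
    (hn0 : ∀ i s, n i (s, 0) = 0) (γ : RR → R4) (hγ : ∀ i s, γ s = mk4 (z s, x i (s, 0), 0)) (hγ' : ∀ s, deriv γ s ≠ 0)
    (hγi : ∀ u v, γ u = γ v → ∃ n : ℤ, u - v = n * PI)
    (hr : ∀ i s t, |t| < ε → (1 + dt (deriv ν s) (ν s) * n i (s, t)) * fD (n i) (s, t) (0, 1) = - fD (x i) (s, t) (1, 0)) :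
    ∃ ε2, 0 < ε2 ∧ ε2 < ε ∧ ∃ t0 > 0, t0 < ε2 / 2 ∧ ∃ Γ : P2 → R4, CDi Γ ∧ (∀ s t, Γ (s + PI, t) = Γ (s, t)) ∧
      (∀ q, (Γ q).2.2.2 = q.2) ∧ (∀ s t, |t| < ε2 → Function.Injective (fD Γ (s, t)) ∧
        (∀ u v, omega4 (fD Γ (s, t) u) (fD Γ (s, t) v) = 0) ∧ ∀ s', Γ (s, t) = Γ (s', t) → ∃ n : ℤ, s - s' = n * PI) ∧
      (∀ s t, |t| < ε2 → t ≤ -(ε2 / 2) → Γ (s, t) = mk4 (z s + n 0 (s, t) • ν s, x 0 (s, t), t)) ∧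
      ∀ s t, |t| < ε2 → -t0 ≤ t → Γ (s, t) = mk4 (z s + n 1 (s, t) • ν s, x 1 (s, t), t) := by
  obtain ⟨r, rs, rp, rr⟩ := rt_exists
  have hν's : CDi (deriv ν) := ((contDiff_infty_iff_deriv).1 hν).2
  set κ : RR → RR := fun s => dt (deriv ν s) (ν s) with hκ
  have hκs : CDi κ := by
    have a := Complex.reCLM.contDiff.comp hν's
    have b := Complex.imCLM.contDiff.comp hν's
    have c := Complex.reCLM.contDiff.comp hν
    have d := Complex.imCLM.contDiff.comp hν
    exact (a.mul d).sub (b.mul c)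
  have hκp : ∀ s, κ (s + PI) = κ s := fun s => by simp only [hκ, hνp, deriv_per ν hνp]
  have hκ1 : CDi fun q : P2 => κ q.1 := hκs.comp contDiff_fst
  set m : Fin 2 → P2 → RR := fun i q => n i q + κ q.1 * n i q ^ 2 / 2 with hm
  have hms : ∀ i, CDi (m i) := fun i => (hn i).add ((hκ1.mul ((hn i).pow 2)).div_const 2)
  have hmp : ∀ i s t, m i (s + PI, t) = m i (s, t) := fun i s t => by simp only [hm, hnp, hκp]
  have hm0 : ∀ i s, m i (s, 0) = 0 := fun i s => by simp [hm, hn0]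
  have hdm : ∀ (n : P2 → RR) (q : P2), DifferentiableAt RR n q →
      fD (fun q => n q + κ q.1 * n q ^ 2 / 2) q (0, 1) = (1 + κ q.1 * n q) * fD n q (0, 1) := by
    intro n q hnq
    have h1 : HasFDerivAt (fun q : P2 => κ q.1) _ q := (hκs.differentiable (by simp) q.1).hasDerivAt.hasFDerivAt.comp q
      (ContinuousLinearMap.fst RR RR RR).hasFDerivAt
    have h2 := hnq.hasFDerivAt.add ((h1.mul (hnq.hasFDerivAt.mul hnq.hasFDerivAt)).mul_const (2:RR)⁻¹)
    have e : (fun q => n q + κ q.1 * n q ^ 2 / 2) = fun q => n q + κ q.1 * (n q * n q) * (2:RR)⁻¹ := by funext q; ring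
    have h3 : fD (fun q => n q + κ q.1 * (n q * n q) * (2:RR)⁻¹) q = _ := h2.fderiv
    rw [e, h3]
    simp
    ring
  have hmt : ∀ i s t, |t| < ε → fD (m i) (s, t) (0, 1) = - fD (x i) (s, t) (1, 0) := fun i s t ht => by
    rw [← hr i s t ht]; exact hdm (n i) (s, t) ((hn i).differentiable (by simp) _)
  have md := fun i => (hms i).differentiable (by simp)
  have xd := fun i => (hx i).differentiable (by simp)
  set D : P2 → RR := fun q => x 0 q - x 1 q with hD
  set μ : P2 → RR := fun q => m 0 q - m 1 q with hμ
  have hDs : CDi D := (hx 0).sub (hx 1)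
  have hμs : CDi μ := (hms 0).sub (hms 1)
  set A : P2 → RR := fun x : P2 => -∫ θ in (0:RR)..1, D (x.1, θ * x.2) with hA
  have hAs : CDi A := by
    refine (contDiff_paramInt (fun q : (P2) × RR => D (q.1.1, q.2 * q.1.2)) (hDs.comp ?_)).neg
    fun_prop
  have hAd := hAs.differentiable (by simp)
  have hx01 : ∀ s, x 0 (s, 0) = x 1 (s, 0) := fun s => by
    have := (hγ 0 s).symm.trans (hγ 1 s)
    simpa [mk4_apply] using this
  have hA0 : ∀ s, A (s, 0) = 0 := fun s => by simp [hA, hD, hx01]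
  have hAp : ∀ s t, A (s + PI, t) = A (s, t) := fun s t => by simp only [hA, hD, hxp]
  have hAt : ∀ s t, |t| ≤ ε / 2 → t * fD A (s, t) (1, 0) = μ (s, t) := fun s t ht =>
    prim_ds D μ hDs hμs (fun s => by simp [hμ, hm0]) (ε / 2) (fun s t ht => by
      simp only [hμ, hD]
      rw [fderiv_fun_sub (md 0 _) (md 1 _), fderiv_fun_sub (xd 0 _) (xd 1 _)]
      simp only [ContinuousLinearMap.sub_apply]
      rw [hmt 0 s t (by linarith), hmt 1 s t (by linarith)]; ring) s t ht
  let M : RR × (RR × (P2)) → RR := fun q => m 1 (q.1, q.2.1) + q.2.2.1 * μ (q.1, q.2.1)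
  let X : RR × (RR × (P2)) → RR := fun q => x 1 (q.1, q.2.1) + q.2.2.1 * D (q.1, q.2.1) - q.2.2.2 * A (q.1, q.2.1)
  let N : RR × (RR × (P2)) → RR := fun q => rt r (κ q.1) (M q)
  let Λ : RR × (RR × (P2)) → R4 := fun q => mk4 (z q.1 + N q • ν q.1, X q, q.2.1)
  have hj : CDi fun q : RR × (RR × (P2)) => (q.1, q.2.1) := by fun_prop
  have h1' : CDi fun q : RR × (RR × (P2)) => q.2.2.1 := by fun_prop
  have h2' : CDi fun q : RR × (RR × (P2)) => q.2.2.2 := by fun_prop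
  have hMs : CDi M := ((hms 1).comp hj).add (h1'.mul (hμs.comp hj))
  have hXs : CDi X := (((hx 1).comp hj).add (h1'.mul (hDs.comp hj))).sub (h2'.mul (hAs.comp hj))
  have hNs : CDi N := by
    have a : CDi fun q : RR × (RR × (P2)) => κ q.1 := hκs.comp contDiff_fst
    exact (contDiff_const.mul hMs).div (contDiff_const.add (rs.comp ((contDiff_const.mul a).mul hMs))) fun q => by
      have := rp (2 * κ q.1 * M q); change 1 + r (2 * κ q.1 * M q) ≠ 0; linarith
  have hΛs : CDi Λ := mk4.contDiff.comp (((hz.comp contDiff_fst).add (hNs.smul (hν.comp contDiff_fst))).prodMk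
    (hXs.prodMk (contDiff_fst.comp contDiff_snd)))
  let T : Set (P2) := Icc (0:RR) 1 ×ˢ Icc (-1:RR) 1
  obtain ⟨ε3, hε3, hst⟩ := loop_stable Λ hΛs (fun s y => by simp only [Λ, N, M, X, hzp, hνp, hκp, hmp, hxp, hAp, hμ, hD]) T
    (isCompact_Icc.prod isCompact_Icc) γ (fun s τ _ => by
      simp [Λ, N, M, X, hm0, hμ, hD, hA0, hx01, rt, hγ 1 s]) hγ' hγi
  have hev : ∀ᶠ t in 𝓝 (0:RR), ∀ s, ∀ i, |κ s * m i (s, t)| < 1 / 4 ∧ |κ s * n i (s, t)| < 1 / 8 := by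
    refine per_tube (fun q : P2 => ∀ i, |κ q.1 * m i q| < 1 / 4 ∧ |κ q.1 * n i q| < 1 / 8) ?_
      (fun s y => by simp only [hκp, hmp, hnp]) 0 (fun s i => by simp [hm0, hn0])
    have : {q : P2 | ∀ i, |κ q.1 * m i q| < 1 / 4 ∧ |κ q.1 * n i q| < 1 / 8} =
      ⋂ i, {q | |κ q.1 * m i q| < 1 / 4} ∩ {q | |κ q.1 * n i q| < 1 / 8} := by ext; simp
    rw [this]
    exact isOpen_iInter_of_finite fun i => (isOpen_lt (hκ1.continuous.mul (hms i).continuous).abs continuous_const).inter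
      (isOpen_lt (hκ1.continuous.mul (hn i).continuous).abs continuous_const)
  obtain ⟨ε4, hε4, hev⟩ := Metric.eventually_nhds_iff.1 hev
  obtain ⟨ε2, hε2, e3, e4, e5⟩ : ∃ ε2 > 0, ε2 ≤ ε3 ∧ ε2 ≤ ε4 ∧ ε2 ≤ ε / 2 :=
    ⟨min ε3 (min ε4 (ε / 2)), by positivity, min_le_left _ _, (min_le_right _ _).trans (min_le_left _ _),
      (min_le_right _ _).trans (min_le_right _ _)⟩
  have hb : ∀ s t i, |t| < ε2 → |κ s * m i (s, t)| < 1 / 4 ∧ |κ s * n i (s, t)| < 1 / 8 := fun s t i ht =>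
    hev (by simp; linarith) s i
  obtain ⟨χ, χs, χ1, χ2, χ3, t0, ht0, ht0', χ4⟩ := cutoff1 (ε2 / 2) (by positivity)
  have χ's : CDi (deriv χ) := ((contDiff_infty_iff_deriv).1 χs).2
  let ι : P2 → RR × (RR × (P2)) := fun q => (q.1, q.2, χ q.2, q.2 * deriv χ q.2)
  have hι : CDi ι := contDiff_fst.prodMk (contDiff_snd.prodMk ((χs.comp contDiff_snd).prodMk
    (contDiff_snd.mul (χ's.comp contDiff_snd))))
  have hιT : ∀ t, (χ t, t * deriv χ t) ∈ T := fun t => ⟨χ1 t, χ2 t⟩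
  have hΓs : CDi (fun q => Λ (ι q)) := hΛs.comp hι
  have hNι : ∀ q : P2, |q.2| < ε2 → N (ι q) + κ q.1 * N (ι q) ^ 2 / 2 = M (ι q) := by
    intro q hq
    refine rt_eq r rp rr _ _ ?_
    obtain ⟨a0, a1⟩ := abs_lt.1 (hb q.1 q.2 0 hq).1
    obtain ⟨b0, b1⟩ := abs_lt.1 (hb q.1 q.2 1 hq).1
    obtain ⟨c0, c1⟩ := χ1 q.2
    simp only [M, ι, hμ]
    rw [abs_le]
    constructor <;> nlinarith
  have hrec : ∀ i s t, |t| < ε2 → rt r (κ s) (m i (s, t)) = n i (s, t) := fun i s t ht =>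
    rt_rec r rp rr _ _ (hb s t i ht).2.le
  refine ⟨ε2, hε2, by linarith, t0, ht0, ht0', fun q => Λ (ι q), hΓs, fun s t => ?_, fun q => rfl, fun s t ht => ?_,
    fun s t ht h => ?_, fun s t ht h => ?_⟩
  · simp only [Λ, ι, N, M, X, hzp, hνp, hκp, hmp, hxp, hAp, hμ, hD]
  · have hΓd := hΓs.differentiable (by simp) (s, t)
    obtain ⟨h1, h2⟩ := hst t (by linarith) _ (hιT t)
    have hom := omega_G z ν (hz.differentiable (by simp)) (hν.differentiable (by simp)) (fun q => N (ι q)) (fun q => X (ι q)) (s, t)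
      ((hNs.comp hι).differentiable (by simp) _) ((hXs.comp hι).differentiable (by simp) _) (hd s)
    have hιd := (hι.differentiable (by simp) (s, t))
    have hs1 : HasDerivAt (fun s : RR => (s, t)) ((1, 0) : P2) s := (hasDerivAt_id s).prodMk (hasDerivAt_const s t)
    have ht1 : HasDerivAt (fun t : RR => (s, t)) ((0, 1) : P2) t := (hasDerivAt_const t s).prodMk (hasDerivAt_id t)
    have hne : fD (fun q => Λ (ι q)) (s, t) (1, 0) ≠ 0 := by
      have a := hΓd.hasFDerivAt.comp_hasDerivAt s hs1
      have hs2 : HasDerivAt (fun s : RR => ι (s, t)) ((1, 0) : RR × (RR × (P2))) s := (hasDerivAt_id s).prodMk (hasDerivAt_const s (t, χ t, t * deriv χ t))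
      have b := (hΛs.differentiable (by simp) (ι (s, t))).hasFDerivAt.comp_hasDerivAt s hs2
      rw [a.unique b]
      exact h2 s
    have hw : (1 + κ s * N (ι (s, t))) * fD (fun q => N (ι q)) (s, t) (0, 1) + fD (fun q => X (ι q)) (s, t) (1, 0) = 0 := by
      have a := hdm (fun q => N (ι q)) (s, t) ((hNs.comp hι).differentiable (by simp) _)
      have ee : (fun q => N (ι q) + κ q.1 * N (ι q) ^ 2 / 2) =ᶠ[𝓝 (s, t)] fun q => M (ι q) := by
        have : ∀ᶠ q : P2 in 𝓝 (s, t), |q.2| < ε2 := (isOpen_lt (continuous_snd.abs) continuous_const).mem_nhds ht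
        filter_upwards [this] with q hq using hNι q hq
      rw [ee.fderiv_eq] at a
      rw [← a]
      have g1 := (((hMs.comp hι).differentiable (by simp)) (s, t)).hasFDerivAt.comp_hasDerivAt t ht1
      have g2 := (((hXs.comp hι).differentiable (by simp)) (s, t)).hasFDerivAt.comp_hasDerivAt s hs1
      have k1 := fun i => (md i (s, t)).hasFDerivAt.comp_hasDerivAt t ht1
      have k2 := fun i => (xd i (s, t)).hasFDerivAt.comp_hasDerivAt s hs1
      have k3 := (hAd (s, t)).hasFDerivAt.comp_hasDerivAt s hs1
      have g3 := (k1 1).add (((χs.differentiable (by simp) t).hasDerivAt).mul ((k1 0).sub (k1 1)))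
      have g4 := ((k2 1).add (((k2 0).sub (k2 1)).const_mul (χ t))).sub (k3.const_mul (t * deriv χ t))
      have u1 := g1.unique g3
      have u2 := g2.unique g4
      have v1 := hmt 0 s t (by linarith)
      have v2 := hmt 1 s t (by linarith)
      have v3 := hAt s t (by linarith)
      simp only [hμ, Function.comp, Pi.sub_apply] at u1 u2 v3
      have u1' : fD (fun q => M (ι q)) (s, t) (0, 1) = _ := u1
      have u2' : fD (fun q => X (ι q)) (s, t) (1, 0) = _ := u2
      rw [u1', u2', v1, v2]
      linear_combination (- deriv χ t) * v3
    obtain ⟨i1, i2⟩ := lag2 (fD (fun q => Λ (ι q)) (s, t)) hom.1 hom.2.1 (hom.2.2.trans hw) hne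
    exact ⟨i1, i2, fun s' h => h1 s s' h⟩
  · obtain ⟨a, b⟩ := χ3 t h
    simp only [Λ, ι, N, M, X, a, b, hμ, hD, one_mul, mul_zero, zero_mul, add_sub_cancel, sub_zero, hrec 0 s t ht]
  · obtain ⟨a, b⟩ := χ4 t h
    simp only [Λ, ι, N, M, X, a, b, mul_zero, zero_mul, add_zero, sub_zero, hrec 1 s t ht]


theorem chart_collar (g : ℂ → RR) (hg : CDi g) (hD : IsCompact {z | g z ≤ 0}) (hneg : ∃ z, g z < 0) (c : RR → ℂ) (hc : IsLoop c)
    (hr : ∀ z, g z = 0 ↔ z ∈ range c) (e : P2 → ℂ) (he : CDi e) (hep : ∀ s t, e (s + PI, t) = e (s, t))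
    (he0 : ∀ s, e (s, 0) = c s) (ε : RR) (hε : 0 < ε) (hge : ∀ s t, |t| ≤ ε → g (e (s, t)) = t) :
    ∃ U V Ψ Ψ', IsChart U V Ψ Ψ' ∧ (∀ z, g z ≤ 0 → z ∈ U) ∧ (∀ y, ‖y‖ ≤ 1 → y ∈ V) ∧ (∀ z ∈ U, ‖Ψ z‖ ≤ 1 ↔ g z ≤ 0) ∧
      ∃ t0 > 0, ∀ s t, |t| ≤ t0 → e (s, t) ∈ U ∧ Ψ (e (s, t)) = E0 (s, t) := by
  obtain ⟨U, V, Ψ, Ψ', hch, hU, hV, hdisc, hcirc⟩ := schoenflies g hg.continuous hD hneg c hc hr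
  have hev : ∀ᶠ t in 𝓝 (0:RR), ∀ s, e (s, t) ∈ U :=
    per_tube (fun q => e q ∈ U) (hch.oU.preimage he.continuous) (fun s y => by simp only [hep]) 0 (fun s => hU _ (by
      rw [hge s 0 (by simpa using hε.le)]))
  obtain ⟨δ', hδ', hev⟩ := Metric.eventually_nhds_iff.1 hev
  obtain ⟨δ, hδ, hδ1, hδ2⟩ : ∃ δ > 0, δ ≤ δ' ∧ δ ≤ ε := ⟨min δ' ε, by positivity, min_le_left _ _, min_le_right _ _⟩
  have hUe : ∀ s t, |t| < δ → e (s, t) ∈ U := fun s t ht => hev (by simp; linarith) s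
  obtain ⟨ψ, ψs, ψb, ψi⟩ := clamp δ hδ
  set f : P2 → ℂ := fun q => Ψ (e (q.1, ψ q.2)) with hf
  have hfs : CDi f := by
    rw [← contDiffOn_univ]
    exact hch.s1.comp (he.comp (contDiff_fst.prodMk (ψs.comp contDiff_snd))).contDiffOn fun q _ => hUe _ _ (ψb _)
  have hfe : ∀ s t, |t| ≤ δ / 2 → f (s, t) = Ψ (e (s, t)) := fun s t ht => by simp only [hf, ψi t ht]
  have hf0 : ∀ s, f (s, 0) = E0 (s, 0) := fun s => by
    rw [hfe s 0 (by simp; positivity), he0, hcirc]; simp only [E0]; congr 1; push_cast; ring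
  have hfd := hfs.differentiable (by simp)
  have hs1 : ∀ s t, HasDerivAt (fun s : RR => (s, t)) ((1, 0) : P2) s := fun s t => (hasDerivAt_id s).prodMk (hasDerivAt_const s t)
  have ht1 : ∀ s t, HasDerivAt (fun t : RR => (s, t)) ((0, 1) : P2) t := fun s t => (hasDerivAt_const t s).prodMk (hasDerivAt_id t)
  obtain ⟨Ξ, hΞ, hΞd, t1, ht1', hΞe⟩ := collar_log f hfs (fun s t => by simp only [hf, hep]) hf0 (by
    intro s
    have hn1 : ‖E0 (s, 0)‖ = 1 := by rw [E0_norm]; simp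
    have hE := E0_ne (s, 0)
    set w := fD f (s, 0) (0, 1) * (E0 (s, 0))⁻¹ with hw
    have h1 : HasDerivAt (fun t => (f (s, t) * (E0 (s, 0))⁻¹).re) w.re 0 := by
      have a := ((hfd (s, 0)).hasFDerivAt.comp_hasDerivAt 0 (ht1 s 0)).mul_const (E0 (s, 0))⁻¹
      exact Complex.reCLM.hasFDerivAt.comp_hasDerivAt 0 a
    have hge0 : 0 ≤ w.re := by
      refine ge_of_tendsto h1.tendsto_slope_zero_left ?_
      filter_upwards [Ioo_mem_nhdsLT (show -(δ / 2) < 0 by linarith)] with t ht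
      have b1 : |t| ≤ δ / 2 := abs_le.2 ⟨ht.1.le, by linarith [ht.2]⟩
      have b2 : ‖f (s, t)‖ ≤ 1 := by
        rw [hfe s t b1, hdisc _ (hUe s t (by linarith)), hge s t (by linarith)]; exact ht.2.le
      have b3 : (f (s, t) * (E0 (s, 0))⁻¹).re ≤ 1 := (Complex.re_le_norm _).trans (by rw [norm_mul, norm_inv, hn1]; simpa using b2)
      rw [zero_add, hf0, mul_inv_cancel₀ hE, Complex.one_re, smul_eq_mul]
      exact mul_nonneg_of_nonpos_of_nonpos (inv_nonpos.2 ht.2.le) (by linarith)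
    refine hge0.lt_of_ne fun hw0 => ?_
    have d1 : fD f (s, 0) (1, 0) = E0 (s, 0) * (-2 * Complex.I) := by
      have a := (hfd (s, 0)).hasFDerivAt.comp_hasDerivAt s (hs1 s 0)
      obtain ⟨L, hL, hL'⟩ := E0_hasFDerivAt (s, 0)
      have b := hL.comp_hasDerivAt s (hs1 s 0)
      have : (f ∘ fun s => (s, 0)) = E0 ∘ fun s => (s, 0) := funext hf0
      rw [this] at a
      rw [a.unique b, hL']; simp
    have d2 : fD f (s, 0) (0, 1) = E0 (s, 0) * (w.im * Complex.I) := by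
      have : w = w.im * Complex.I := by apply Complex.ext <;> simp [← hw0]
      rw [← this, hw]; field_simp
    have d3 : fD f (s, 0) (w.im / 2, 1) = 0 := by
      have : ((w.im / 2, 1) : P2) = (w.im / 2) • (1, 0) + (0, 1) := by simp
      rw [this, map_add, map_smul, d1, d2, Complex.real_smul]; push_cast; ring
    have hfV : f (s, 0) ∈ V := hV _ (by rw [hf0, hn1])
    have hgd : DifferentiableAt RR (fun y => g (Ψ' y)) (f (s, 0)) :=
      (hg.contDiffAt.comp _ (hch.s2.contDiffAt (hch.oV.mem_nhds hfV))).differentiableAt (by simp)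
    have k1 := hgd.hasFDerivAt.comp (s, (0:RR)) (hfd (s, 0)).hasFDerivAt
    have k2 : ((fun y => g (Ψ' y)) ∘ f) =ᶠ[𝓝 (s, (0:RR))] fun q => q.2 := by
      have : ∀ᶠ q : P2 in 𝓝 (s, 0), |q.2| < δ / 2 :=
        (isOpen_lt (continuous_snd.abs) continuous_const).mem_nhds (by simp; positivity)
      filter_upwards [this] with q hq
      simp only [Function.comp]
      rw [show f q = Ψ (e q) from hfe q.1 q.2 hq.le, hch.l _ (hUe q.1 q.2 (by linarith)), hge q.1 q.2 (by linarith)]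
    have k3 := congrArg (fun L : P2 →L[RR] RR => L (w.im / 2, 1))
      ((k1.congr_of_eventuallyEq k2.symm).unique (ContinuousLinearMap.snd RR RR RR).hasFDerivAt)
    simp [d3] at k3)
  refine ⟨U, _, _, _, hch.post Ξ.symm hΞ.symm, hU, fun y hy => hV _ ((hΞd y).2 hy), fun z hz => ?_, min t1 (δ / 2), by positivity,
    fun s t ht => ⟨hUe s t ?_, ?_⟩⟩
  · rw [← hdisc z hz, ← hΞd (Ξ.symm (Ψ z)), Equiv.apply_symm_apply]
  · linarith [min_le_right t1 (δ / 2)]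
  · rw [Equiv.symm_apply_eq, hΞe s t (ht.trans (min_le_left _ _)), hfe s t (ht.trans (min_le_right _ _))]


theorem push_lag {E : Type} [NormedAddCommGroup E] [NormedSpace RR E] [FiniteDimensional RR E] (hE : Module.finrank RR E = 2)
    (f : ℂ → R4) (e : E → ℂ) (H : E → R4) (x : E) (h : (fun x => f (e x)) =ᶠ[𝓝 x] H) (hf : DifferentiableAt RR f (e x))
    (he : DifferentiableAt RR e x) (hi : Function.Injective (fD H x)) (hw : ∀ u v, omega4 (fD H x u) (fD H x v) = 0) :
    Function.Injective (fD f (e x)) ∧ (∀ u v, omega4 (fD f (e x) u) (fD f (e x) v) = 0) ∧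
      ∀ v, ∃ u, fD f (e x) u = fD H x v := by
  have h1 : fD H x = (fD f (e x)).comp (fD e x) := by
    rw [← h.fderiv_eq]; exact fderiv_comp x hf he
  have h2 : Function.Injective (fD e x) := fun u v huv => hi (by rw [h1]; simp [huv])
  have h3 : Function.Surjective (fD e x) :=
    (LinearMap.injective_iff_surjective_of_finrank_eq_finrank (f := (fD e x : E →ₗ[RR] ℂ)) (by rw [hE, Complex.finrank_real_complex])).1 h2
  have h4 : ∀ u, fD f (e x) (fD e x u) = fD H x u := fun u => by rw [h1]; rfl
  refine ⟨fun u v huv => ?_, fun u v => ?_, fun v => ⟨_, h4 v⟩⟩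
  · obtain ⟨u, rfl⟩ := h3 u
    obtain ⟨v, rfl⟩ := h3 v
    rw [h4, h4] at huv
    rw [hi huv]
  · obtain ⟨u, rfl⟩ := h3 u
    obtain ⟨v, rfl⟩ := h3 v
    rw [h4, h4, hw]

theorem glue (F : Fin 2 → ℂ → R4) (hF : ∀ i, LagMap (F i)) (hinj : ∀ i, Function.Injective (F i))
    (hD : ∀ i, IsCompact {p | (F i p).2.2.2 ≤ 0}) (c : Fin 2 → RR → ℂ) (hc : ∀ i, IsLoop (c i))
    (hr : ∀ i p, (F i p).2.2.2 = 0 ↔ p ∈ range (c i))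
    (hreg : ∀ i p, (F i p).2.2.2 = 0 → fD (fun q => (F i q).2.2.2) p ≠ 0) (h01 : ∀ s, F 0 (c 0 s) = F 1 (c 1 s)) (α : RR) (hα : α < 0) :
    ∃ f : ℂ → R4, LagMap f ∧ Function.Injective f ∧ (∀ p, 0 < (F 1 p).2.2.2 → f p = F 1 p) ∧
      (∀ p, (F 1 p).2.2.2 ≤ 0 → (f p).2.2.2 ≤ 0) ∧ ∃ ζ : ℂ → ℂ, (∀ q, (F 0 q).2.2.2 = α → f (ζ q) = F 0 q ∧
        ∀ v, ∃ u, fD f (ζ q) u = fD (F 0) q v) ∧ ∀ p, (f p).2.2.2 = α → ∃ q, (F 0 q).2.2.2 = α ∧ ζ q = p := by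
  have hgs : ∀ i, CDi fun p => (F i p).2.2.2 := fun i => contDiff_snd.comp (contDiff_snd.comp (contDiff_snd.comp (hF i).s))
  have hc0 : ∀ i s, (F i (c i s)).2.2.2 = 0 := fun i s => (hr i _).2 ⟨s, rfl⟩
  set z : RR → ℂ := fun s => P4 (F 0 (c 0 s)) with hz
  have hzz : ∀ i s, z s = P4 (F i (c i s)) := fun i s => by
    fin_cases i
    · rfl
    · exact congrArg P4 (h01 s)
  choose ε hε e n x hes hns hxs hep hnp hxp he0 hn0 hx0 hFe hrel using fun i =>
    nf (F i) (hF i) (c i) (hc i) (hc0 i) (fun s => hreg i _ (hc0 i s)) z (hzz i)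
  have hneg : ∀ i, ∃ p, (F i p).2.2.2 < 0 := fun i => by
    by_contra h; push Not at h
    refine hreg i _ (hc0 i 0) (IsLocalMin.fderiv_eq_zero (Eventually.of_forall fun p => ?_))
    dsimp only
    rw [hc0]; exact h p
  choose U V Ψ Ψ' hch hU hV hdisc τ hτ hΨe using fun i => chart_collar _ (hgs i) (hD i) (hneg i) (c i) (hc i) (hr i) (e i) (hes i) (hep i)
    (he0 i) (ε i) (hε i) (fun s t ht => by rw [hFe i s t ht, mk4_apply])
  obtain ⟨σ, hσ, hσε, hστ⟩ : ∃ σ > 0, (∀ i, σ ≤ ε i) ∧ ∀ i, σ ≤ τ i := by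
    refine ⟨min (min (ε 0) (ε 1)) (min (τ 0) (τ 1)), lt_min (lt_min (hε 0) (hε 1)) (lt_min (hτ 0) (hτ 1)), fun i => ?_, fun i => ?_⟩ <;>
      fin_cases i <;> simp
  have hge : ∀ i s t, |t| ≤ σ → (F i (e i (s, t))).2.2.2 = t := fun i s t ht => by rw [hFe i s t (ht.trans (hσε i)), mk4_apply]
  have hΨ : ∀ i s t, |t| ≤ σ → e i (s, t) ∈ U i ∧ Ψ i (e i (s, t)) = E0 (s, t) := fun i s t ht => hΨe i s t (ht.trans (hστ i))
  have hrep : ∀ y : ℂ, y ≠ 0 → ∃ s t, y = E0 (s, t) ∧ ‖y‖ = Real.exp t := fun y hy =>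
    ⟨(S0 y).1, (S0 y).2, (E0_S0 y hy).symm, by conv_lhs => rw [← E0_S0 y hy, E0_norm]⟩
  have hback : ∀ i p s t, p ∈ U i → |t| ≤ σ → Ψ i p = E0 (s, t) → p = e i (s, t) := fun i p s t hp ht h => by
    rw [← (hch i).l p hp, h, ← (hΨ i s t ht).2, (hch i).l _ (hΨ i s t ht).1]
  have hback' : ∀ i s t, |t| ≤ σ → Ψ' i (E0 (s, t)) = e i (s, t) := fun i s t ht => by
    rw [← (hΨ i s t ht).2, (hch i).l _ (hΨ i s t ht).1]
  have hle : ∀ i y, ‖y‖ ≤ 1 → (F i (Ψ' i y)).2.2.2 ≤ 0 := fun i y hy => by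
    rw [← hdisc i _ ((hch i).m2 y (hV i y hy)), (hch i).r y (hV i y hy)]; exact hy
  obtain ⟨ε', hε', hdeep⟩ : ∃ ε' > 0, ∀ y : ℂ, ‖y‖ ≤ 1 → (F 0 (Ψ' 0 y)).2.2.2 ≤ -ε' ∨ ∃ s, y = E0 (s, (F 0 (Ψ' 0 y)).2.2.2) := by
    have hcp : IsCompact (Metric.closedBall (0:ℂ) (Real.exp (-σ))) := isCompact_closedBall _ _
    have hsub : ∀ y ∈ Metric.closedBall (0:ℂ) (Real.exp (-σ)), ‖y‖ ≤ Real.exp (-σ) ∧ ‖y‖ < 1 := fun y hy => by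
      rw [mem_closedBall_zero_iff] at hy
      exact ⟨hy, hy.trans_lt (Real.exp_lt_one_iff.2 (by linarith))⟩
    have hco : ContinuousOn (fun y => (F 0 (Ψ' 0 y)).2.2.2) (Metric.closedBall (0:ℂ) (Real.exp (-σ))) :=
      (hgs 0).continuous.comp_continuousOn ((hch 0).s2.continuousOn.mono fun y hy => hV 0 y (hsub y hy).2.le)
    obtain ⟨y0, hy0, hmax⟩ := hcp.exists_isMaxOn ⟨0, by simp; positivity⟩ hco
    refine ⟨-(F 0 (Ψ' 0 y0)).2.2.2, ?_, fun y hy => ?_⟩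
    · have h1 := hle 0 y0 (hsub y0 hy0).2.le
      rcases h1.lt_or_eq with h | h
      · linarith
      · exfalso
        obtain ⟨s, hs⟩ := (hr 0 _).1 h
        have h2 := (hΨ 0 s 0 (by simp; linarith)).2
        rw [he0, hs, (hch 0).r y0 (hV 0 y0 (hsub y0 hy0).2.le)] at h2
        have h3 := (hsub y0 hy0).2
        rw [h2, E0_norm] at h3
        simp at h3
    · by_cases h : ‖y‖ ≤ Real.exp (-σ)
      · left; rw [neg_neg]; exact hmax (mem_closedBall_zero_iff.2 h)
      · right
        push Not at h
        obtain ⟨s, t, h1, h2⟩ := hrep y (norm_pos_iff.1 ((Real.exp_pos _).trans h))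
        rw [h2, Real.exp_lt_exp] at h
        rw [h2, Real.exp_le_one_iff] at hy
        have ht : |t| ≤ σ := abs_le.2 ⟨h.le, by linarith⟩
        refine ⟨s, ?_⟩
        rw [h1, hback' 0 s t ht, hge 0 s t ht]
  have hzs : CDi z := P4.contDiff.comp ((hF 0).s.comp (hc 0).1)
  have hzi := z_imm (F 0) (hF 0) (c 0) (hc 0).1 (hc 0).2.1 (hc0 0) (fun s => hreg 0 _ (hc0 0 s))
  have hz' : ∀ s, deriv z s ≠ 0 := fun s => (hzi s).2.2.2
  have hzp : ∀ s, z (s + PI) = z s := fun s => by simp only [hz, (hc 0).per]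
  obtain ⟨ε2, hε2, hlt, t0, ht0, ht0', Γ, Γs, Γp, Γy, Γi, Γ0, Γ1⟩ := interp z (nuF z) hzs (nuF_smooth z hzs hz') hzp
    (fun s => by simp only [nuF, deriv_per z hzp]) (fun s => nuF_dt z s (hz' s)) (min σ (min ε' (-α))) (by
      have := neg_pos.2 hα; positivity) n x hns hxs hnp hxp hn0 (fun s => F 0 (c 0 s)) (fun i s => by
        rw [hx0, hzz i s, ← hc0 i s]
        have : F 0 (c 0 s) = F i (c i s) := by
          fin_cases i
          · rfl
          · exact h01 s
        rw [mk4_P4, this]) (fun s hs => by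
        have h1 := (hzi s).1.deriv
        rw [hs] at h1
        have h2 := (hzi s).2.2
        rw [← h1] at h2
        exact h2.2 (h2.1.trans (map_zero P4))) (fun u v h => ((hc 0).2.2 u v).1 (hinj 0 h))
      (fun i s t ht => hrel i s t (ht.trans_le ((min_le_left _ _).trans (hσε i))))
  have l1 : ε2 < σ := hlt.trans_le (min_le_left _ _)
  have l2 : ε2 < ε' := hlt.trans_le ((min_le_right _ _).trans (min_le_left _ _))
  have l3 : ε2 < -α := hlt.trans_le ((min_le_right _ _).trans (min_le_right _ _))
  have hΓE : ∀ q, Γ (S0 (E0 q)) = Γ q := fun q => by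
    obtain ⟨h1, k, h2⟩ := (E0_eq_iff _ _).1 (E0_S0 (E0 q) (E0_ne q))
    have := per_int Γ Γp k q.1 q.2
    rw [← h2] at this
    rw [← show Γ (q.1, q.2) = Γ q from rfl, ← this, ← h1]
  let f : ℂ → R4 := fun p => if 0 < (F 1 p).2.2.2 then F 1 p else if ‖Ψ 1 p‖ < Real.exp (-(ε2 / 2)) then F 0 (Ψ' 0 (Ψ 1 p)) else Γ (S0 (Ψ 1 p))
  have f1 : ∀ p, 0 < (F 1 p).2.2.2 → f p = F 1 p := fun p hp => by simp only [f, if_pos hp]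
  have elt1 : Real.exp (-(ε2 / 2)) < 1 := Real.exp_lt_one_iff.2 (by linarith)
  let C : Set ℂ := {p | p ∈ U 1 ∧ ‖Ψ 1 p‖ < Real.exp (-(ε2 / 2))}
  have fC : ∀ p ∈ C, f p = F 0 (Ψ' 0 (Ψ 1 p)) := fun p hp => by
    have := (hdisc 1 p hp.1).1 (hp.2.le.trans elt1.le)
    simp only [f, if_neg this.not_gt, if_pos hp.2]
  have oC : IsOpen C := (hch 1).s1.continuousOn.norm.isOpen_inter_preimage (hch 1).oU isOpen_Iio
  have fB : ∀ s t, |t| < ε2 → f (e 1 (s, t)) = Γ (s, t) := by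
    intro s t ht
    obtain ⟨h1, h2⟩ := hΨ 1 s t (by linarith)
    have h3 := hge 1 s t (by linarith)
    have h4 := abs_lt.1 ht
    simp only [f, h2, h3, E0_norm, Real.exp_lt_exp]
    split_ifs with a b
    · rw [Γ1 s t ht (by linarith), hFe 1 s t (by linarith [hσε 1])]
    · rw [hback' 0 s t (by linarith), Γ0 s t ht (by linarith), hFe 0 s t (by linarith [hσε 0])]
    · exact hΓE _
  have tri : ∀ p, 0 < (F 1 p).2.2.2 ∨ p ∈ C ∨ ∃ s t, |t| < ε2 ∧ p = e 1 (s, t) := by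
    intro p
    by_cases h1 : 0 < (F 1 p).2.2.2
    · exact Or.inl h1
    right
    push Not at h1
    have hp := hU 1 p h1
    by_cases h2 : ‖Ψ 1 p‖ < Real.exp (-(ε2 / 2))
    · exact Or.inl ⟨hp, h2⟩
    right
    push Not at h2
    have h3 := (hdisc 1 p hp).2 h1
    obtain ⟨s, t, h4, h5⟩ := hrep _ (norm_pos_iff.1 ((Real.exp_pos _).trans_le h2))
    rw [h5, Real.exp_le_exp] at h2
    rw [h5, Real.exp_le_one_iff] at h3
    have ht : |t| < ε2 := abs_lt.2 ⟨by linarith, by linarith⟩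
    exact ⟨s, t, ht, hback 1 p s t hp (by linarith) h4⟩
  have fy : ∀ p, (F 1 p).2.2.2 ≤ 0 → (f p).2.2.2 ≤ 0 := fun p hp => by
    rcases tri p with h | h | ⟨s, t, ht, rfl⟩
    · linarith
    · rw [fC p h]; exact hle 0 _ (h.2.le.trans elt1.le)
    · rw [fB s t ht, Γy]; rwa [hge 1 s t (by linarith)] at hp
  let ζ : ℂ → ℂ := fun q => Ψ' 1 (Ψ 0 q)
  have hy1 : ∀ p ∈ C, ‖Ψ 1 p‖ ≤ 1 := fun p hp => hp.2.le.trans elt1.le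
  have hζ1 : ∀ p ∈ C, ζ (Ψ' 0 (Ψ 1 p)) = p := fun p hp => by
    simp only [ζ]; rw [(hch 0).r _ (hV 0 _ (hy1 p hp)), (hch 1).l p hp.1]
  have hfs : ∀ p, ContDiffAt RR ∞ f p := by
    intro p
    rcases tri p with h | h | ⟨s, t, ht, rfl⟩
    · refine (hF 1).s.contDiffAt.congr_of_eventuallyEq ?_
      filter_upwards [(isOpen_lt continuous_const (hgs 1).continuous).mem_nhds h] with q hq using f1 q hq
    · have h1 : ContDiffAt RR ∞ (fun p => F 0 (Ψ' 0 (Ψ 1 p))) p := (hF 0).s.contDiffAt.comp _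
        (((hch 0).s2.contDiffAt ((hch 0).oV.mem_nhds (hV 0 _ (hy1 p h)))).comp p ((hch 1).s1.contDiffAt ((hch 1).oU.mem_nhds h.1)))
      refine h1.congr_of_eventuallyEq ?_
      filter_upwards [oC.mem_nhds h] with q hq using fC q hq
    · obtain ⟨h1, h2⟩ := hΨ 1 s t (by linarith)
      have h3 : ContDiffAt RR ∞ (fun y => Γ (S0 y)) (Ψ 1 (e 1 (s, t))) := by
        rw [h2]; apply smooth_of_E0
        simp only [hΓE]; exact Γs.contDiffAt
      have h4 : ContDiffAt RR ∞ (Ψ 1) (e 1 (s, t)) := (hch 1).s1.contDiffAt ((hch 1).oU.mem_nhds h1)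
      refine (h3.comp _ h4).congr_of_eventuallyEq ?_
      have h5 := h4.continuousAt.norm
      have h6 : ‖Ψ 1 (e 1 (s, t))‖ ∈ Ioo (Real.exp (-ε2)) (Real.exp ε2) := by
        rw [h2, E0_norm]; exact ⟨Real.exp_lt_exp.2 (abs_lt.1 ht).1, Real.exp_lt_exp.2 (abs_lt.1 ht).2⟩
      filter_upwards [(hch 1).oU.mem_nhds h1, h5 (isOpen_Ioo.mem_nhds h6)] with q hq hq2
      obtain ⟨s', t', h7, h8⟩ := hrep (Ψ 1 q) (norm_pos_iff.1 ((Real.exp_pos _).trans hq2.1))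
      have h9 : ‖Ψ 1 q‖ ∈ Ioo (Real.exp (-ε2)) (Real.exp ε2) := hq2
      rw [h8, mem_Ioo, Real.exp_lt_exp, Real.exp_lt_exp] at h9
      have ht' := abs_lt.2 h9
      rw [Function.comp, h7, hΓE, hback 1 q s' t' hq (by linarith) h7, fB s' t' ht']
  have hfd : ∀ p, DifferentiableAt RR f p := fun p => (hfs p).differentiableAt (by simp)
  have pC : ∀ q, q ∈ U 0 → ‖Ψ 0 q‖ < Real.exp (-(ε2 / 2)) → ζ q ∈ C ∧ f (ζ q) = F 0 q := fun q h0 h => by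
    have hv := hV 1 _ (h.le.trans elt1.le)
    have : ζ q ∈ C := ⟨(hch 1).m2 _ hv, by simp only [ζ]; rwa [(hch 1).r _ hv]⟩
    refine ⟨this, ?_⟩
    rw [fC _ this]
    simp only [ζ]
    rw [(hch 1).r _ hv, (hch 0).l q h0]
  have pushC : ∀ q, q ∈ U 0 → ‖Ψ 0 q‖ < Real.exp (-(ε2 / 2)) → _ := fun q h0 h =>
    push_lag Complex.finrank_real_complex f ζ (F 0) q (by
      have h4 : ContDiffAt RR ∞ (Ψ 0) q := (hch 0).s1.contDiffAt ((hch 0).oU.mem_nhds h0)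
      filter_upwards [(hch 0).oU.mem_nhds h0, h4.continuousAt.norm (isOpen_Iio.mem_nhds h)] with q' a b using (pC q' a b).2) (hfd _)
      ((((hch 1).s2.contDiffAt ((hch 1).oV.mem_nhds (hV 1 _ (h.le.trans elt1.le)))).comp q
        ((hch 0).s1.contDiffAt ((hch 0).oU.mem_nhds h0))).differentiableAt (by simp)) ((hF 0).i q) ((hF 0).w q)
  have inC : ∀ p ∈ C, Ψ' 0 (Ψ 1 p) ∈ U 0 ∧ ‖Ψ 0 (Ψ' 0 (Ψ 1 p))‖ < Real.exp (-(ε2 / 2)) := fun p hp => by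
    have hv := hV 0 _ (hy1 p hp)
    exact ⟨(hch 0).m2 _ hv, by rw [(hch 0).r _ hv]; exact hp.2⟩
  have hlag : ∀ p, Function.Injective (fD f p) ∧ ∀ u v, omega4 (fD f p u) (fD f p v) = 0 := by
    intro p
    rcases tri p with h | h | ⟨s, t, ht, rfl⟩
    · have : f =ᶠ[𝓝 p] F 1 := by
        filter_upwards [(isOpen_lt continuous_const (hgs 1).continuous).mem_nhds h] with q hq using f1 q hq
      rw [this.fderiv_eq]
      exact ⟨(hF 1).i p, (hF 1).w p⟩
    · have := pushC _ (inC p h).1 (inC p h).2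
      rw [hζ1 p h] at this
      exact ⟨this.1, this.2.1⟩
    · have := push_lag (by simp) f (e 1) Γ (s, t) (by
        have : ∀ᶠ q : P2 in 𝓝 (s, t), |q.2| < ε2 := (isOpen_lt (continuous_snd.abs) continuous_const).mem_nhds ht
        filter_upwards [this] with q hq using fB q.1 q.2 hq) (hfd _) ((hes 1).differentiable (by simp) _) (Γi s t ht).1 (Γi s t ht).2.1
      exact ⟨this.1, this.2.1⟩
  have mid : ∀ p, (f p).2.2.2 ≤ 0 → -ε2 < (f p).2.2.2 → ∃ s, p = e 1 (s, (f p).2.2.2) := by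
    intro p hp hp2
    rcases tri p with h | h | ⟨s, t, ht, rfl⟩
    · rw [f1 p h] at hp; linarith
    · rw [fC p h] at hp2 hp ⊢
      obtain ⟨s, hs⟩ := (hdeep _ (hy1 p h)).resolve_left (by linarith)
      exact ⟨s, hback 1 p s _ h.1 (abs_le.2 ⟨by linarith, by linarith⟩) hs⟩
    · exact ⟨s, by rw [fB s t ht, Γy]⟩
  have low : ∀ p, (f p).2.2.2 ≤ -ε2 → p ∈ C := by
    intro p hp
    rcases tri p with h | h | ⟨s, t, ht, rfl⟩
    · rw [f1 p h] at hp; linarith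
    · exact h
    · rw [fB s t ht, Γy] at hp; linarith [(abs_lt.1 ht).1]
  refine ⟨f, ⟨contDiff_iff_contDiffAt.2 hfs, fun p => (hlag p).1, fun p => (hlag p).2⟩, fun p p' h => ?_, f1, fy, ζ, fun q hq => ?_, fun p hp => ?_⟩
  · rcases lt_or_ge 0 (f p).2.2.2 with h0 | h0
    · have : ∀ p, 0 < (f p).2.2.2 → f p = F 1 p := fun p hp => f1 p (by
        by_contra hh; linarith [fy p (not_lt.1 hh)])
      have h0' := h0
      rw [h] at h0'
      rw [this p h0, this p' h0'] at h
      exact hinj 1 h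
    rcases lt_or_ge (-ε2) (f p).2.2.2 with h1 | h1
    · obtain ⟨s, hs⟩ := mid p h0 h1
      obtain ⟨s', hs'⟩ := mid p' (h ▸ h0) (h ▸ h1)
      rw [← h] at hs'
      generalize (f p).2.2.2 = t at *
      have ht : |t| < ε2 := abs_lt.2 ⟨h1, by linarith⟩
      rw [hs, hs', fB s t ht, fB s' t ht] at h
      obtain ⟨k, hk⟩ := (Γi s t ht).2.2 s' h
      have := per_int (e 1) (hep 1) k s' t
      rw [hs, hs', ← this, ← hk]; congr 2; ring
    · have a := low p h1
      have b := low p' (h ▸ h1)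
      rw [fC p a, fC p' b] at h
      rw [← hζ1 p a, hinj 0 h, hζ1 p' b]
  · have hq0 := hU 0 q (by linarith)
    have hb : ‖Ψ 0 q‖ < Real.exp (-(ε2 / 2)) := by
      by_contra hh; push Not at hh
      have h3 := (hdisc 0 q hq0).2 (by linarith)
      obtain ⟨s, t, h4, h5⟩ := hrep _ (norm_pos_iff.1 ((Real.exp_pos _).trans_le hh))
      rw [h5, Real.exp_le_exp] at hh
      rw [h5, Real.exp_le_one_iff] at h3
      have ht : |t| ≤ σ := abs_le.2 ⟨by linarith, by linarith⟩
      rw [hback 0 q s t hq0 ht h4, hge 0 s t ht] at hq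
      linarith
    exact ⟨(pC q hq0 hb).2, (pushC q hq0 hb).2.2⟩
  · have a := low p (by linarith)
    exact ⟨Ψ' 0 (Ψ 1 p), by rw [← fC p a, hp], hζ1 p a⟩


theorem lift_smooth {X E : Type} [NormedAddCommGroup X] [NormedSpace RR X] [NormedAddCommGroup E] [NormedSpace RR E] [FiniteDimensional RR E]
    (f : E → R4) (hf : CDi f) (hi : ∀ p, Function.Injective (fD f p)) (he : IsEmbedding f) (h : X → R4)
    (hh : CDi h) (hr : ∀ x, h x ∈ range f) : ∃ θ : X → E, CDi θ ∧ ∀ x, f (θ x) = h x := by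
  choose θ hθ using hr
  refine ⟨θ, ?_, hθ⟩
  have hc : Continuous θ := by
    rw [he.isInducing.continuous_iff]
    have : f ∘ θ = h := funext hθ
    rw [this]; exact hh.continuous
  rw [contDiff_iff_contDiffAt]
  intro x
  obtain ⟨g, g1, g2⟩ := local_leftInv f (θ x) (Eventually.of_forall fun y => hf.contDiffAt) (hi _)
  have h1 : ContDiffAt RR ∞ (fun y => g (h y)) x := by
    refine ContDiffAt.comp x ?_ hh.contDiffAt
    rw [← hθ]; exact g1.self_of_nhds
  refine h1.congr_of_eventuallyEq ?_
  filter_upwards [hc.continuousAt.eventually g2] with y hy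
  rw [← hθ y, hy]

theorem tv {E : Type} [NormedAddCommGroup E] [NormedSpace RR E] (f : E → R4) (hf : CDi f) (p : E) :
    fD (fun q => (f q).2.2.2) p ≠ 0 ↔ ∃ u, (fD f p u).2.2.2 ≠ 0 := by
  have hd := hf.differentiable (by simp) p
  constructor
  · intro h
    by_contra hh; push Not at hh
    apply h; ext u
    rw [y2_fderiv f p hd, hh]; rfl
  · rintro ⟨u, hu⟩ h
    rw [← y2_fderiv f p hd, h] at hu
    exact hu rfl

theorem IsFlatParam.emb {f : R2 → R4} (hf : IsFlatParam f) : IsEmbedding f :=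
  (IsClosedEmbedding.of_continuous_injective_isClosedMap hf.1.continuous hf.2.1 hf.2.2.1.isClosedMap).isEmbedding

theorem trans_all {L : Set R4} {a : RR} (h : TransverseAt L a) (f : R2 → R4) (hf : IsFlatParam f) (hL : range f = L) (p : R2)
    (hp : (f p).2.2.2 = a) : ∃ u, (fD f p u).2.2.2 ≠ 0 := by
  obtain ⟨k, hk, hkL, hkt⟩ := h
  obtain ⟨θ, θs, hθ⟩ := lift_smooth f hf.1 hf.2.2.2.1 hf.emb k hk.1 (fun x => by rw [hL, ← hkL]; exact ⟨x, rfl⟩)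
  obtain ⟨x, hx⟩ : f p ∈ range k := by rw [hkL, ← hL]; exact ⟨p, rfl⟩
  have hθx : θ x = p := hf.2.1 (by rw [hθ, hx])
  obtain ⟨u, hu⟩ := (tv k hk.1 x).1 (hkt x (by rw [hx, hp]))
  have e : (fun x => f (θ x)) = k := funext hθ
  have h1 : fD (fun x => f (θ x)) x = _ := fderiv_comp x (hf.1.differentiable (by simp) (θ x)) (θs.differentiable (by simp) x)
  rw [e, hθx] at h1
  rw [h1] at hu
  exact ⟨_, hu⟩

theorem shift_fderiv {E E' : Type} [NormedAddCommGroup E] [NormedSpace RR E] [NormedAddCommGroup E'] [NormedSpace RR E']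
    (f : E' → R4) (hf : CDi f) (e : E ≃L[RR] E') (w : R4) (p v : E) :
    fD (fun p => f (e p) + w) p v = fD f (e p) (e v) := by
  have h := ((hf.differentiable (by simp) (e p)).hasFDerivAt.comp p e.hasFDerivAt).add_const w
  have h2 : fD (fun p => f (e p) + w) p = _ := h.fderiv
  rw [h2]; rfl

theorem shift_smooth {E E' : Type} [NormedAddCommGroup E] [NormedSpace RR E] [NormedAddCommGroup E'] [NormedSpace RR E']
    (f : E' → R4) (hf : CDi f) (e : E ≃L[RR] E') (w : R4) : CDi (fun p => f (e p) + w) :=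
  (hf.comp e.contDiff).add contDiff_const

theorem sl {L : Set R4} {a : RR} {S : Set R3} (h : L ∩ {p | p.2.2.2 = a} = iMap a '' S) (v : R4) :
    v ∈ L ∧ v.2.2.2 = a ↔ ∃ s ∈ S, iMap a s = v := by
  rw [← mem_image, ← h]; rfl

theorem iMap_inj (a : RR) : Function.Injective (iMap a) := by
  rintro ⟨x, y, z⟩ ⟨x', y', z'⟩ h
  simp [iMap] at h
  simp [h]

theorem core (S₁ S₂ S₃ : Set R3) (hc2 : IsConnected S₂) (f : Fin 2 → R2 → R4) (hf : ∀ i, IsFlatParam (f i)) (ℓ : Fin 2 → RR) (hℓ : ∀ i, ℓ i < 0)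
    (hs : ∀ i, range (f i) ∩ {p | p.2.2.2 = ℓ i} = iMap (ℓ i) '' S₂)
    (ht : ∀ i p, (f i p).2.2.2 = ℓ i → ∃ u, (fD (f i) p u).2.2.2 ≠ 0) (a b : RR) (ha : a < ℓ 0) (hb : ℓ 1 < b) (hb0 : b < 0)
    (hsa : range (f 0) ∩ {p | p.2.2.2 = a} = iMap a '' S₁) (hsb : range (f 1) ∩ {p | p.2.2.2 = b} = iMap b '' S₃)
    (hta : ∀ p, (f 0 p).2.2.2 = a → ∃ u, (fD (f 0) p u).2.2.2 ≠ 0)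
    (htb : ∀ p, (f 1 p).2.2.2 = b → ∃ u, (fD (f 1) p u).2.2.2 ≠ 0) : SliceRel S₁ S₃ := by
  let ec : ℂ ≃L[RR] R2 := Complex.equivRealProdCLM
  let w : Fin 2 → R4 := fun i => (0, 0, 0, -ℓ i)
  let F : Fin 2 → ℂ → R4 := fun i p => f i (ec p) + w i
  have hFy : ∀ i p, (F i p).2.2.2 = (f i (ec p)).2.2.2 - ℓ i := fun i p => by simp [F, w, sub_eq_add_neg]
  have hFl : ∀ i, LagMap (F i) := fun i => ⟨shift_smooth _ (hf i).1 ec _, fun p u v h => by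
      rw [shift_fderiv _ (hf i).1, shift_fderiv _ (hf i).1] at h
      exact ec.injective ((hf i).2.2.2.1 _ h), fun p u v => by
      rw [shift_fderiv _ (hf i).1, shift_fderiv _ (hf i).1]; exact (hf i).2.2.2.2.1 _ _ _⟩
  have hFe : ∀ i, IsEmbedding (F i) := fun i =>
    (Homeomorph.addRight (w i)).isEmbedding.comp ((hf i).emb.comp ec.toHomeomorph.isEmbedding)
  have hFD : ∀ i, IsCompact {p | (F i p).2.2.2 ≤ 0} := fun i => by
    obtain ⟨K, hK, hK'⟩ := (hf i).2.2.2.2.2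
    refine (hK.image ec.symm.continuous).of_isClosed_subset (isClosed_le (by
      have := (hFl i).s.continuous; fun_prop) continuous_const) fun p hp => ?_
    refine ⟨ec p, ?_, by simp⟩
    by_contra h
    have h1 : (F i p).2.2.2 ≤ 0 := hp
    rw [hFy, hK' _ h] at h1
    linarith [hℓ i, show ((ec p).1, (ec p).2, (0:RR), (0:RR)).2.2.2 = 0 from rfl]
  have hFC : ∀ i v, (∃ p, (F i p).2.2.2 = 0 ∧ F i p = v) ↔ v ∈ iMap 0 '' S₂ := by
    intro i v
    constructor
    · rintro ⟨p, hp, rfl⟩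
      rw [hFy] at hp
      obtain ⟨s, h1, h2⟩ := (sl (hs i) (f i (ec p))).1 ⟨⟨_, rfl⟩, by linarith⟩
      exact ⟨s, h1, by simp [F, ← h2, iMap, w]⟩
    · rintro ⟨s, h1, rfl⟩
      obtain ⟨⟨p, h2⟩, h3⟩ := (sl (hs i) _).2 ⟨s, h1, rfl⟩
      refine ⟨ec.symm p, ?_, ?_⟩
      · rw [hFy, ContinuousLinearEquiv.apply_symm_apply, h2, h3, sub_self]
      · simp [F, h2, iMap, w]
  have hreg : ∀ i p, (F i p).2.2.2 = 0 → fD (fun q => (F i q).2.2.2) p ≠ 0 := fun i p hp => by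
    rw [tv _ (hFl i).s]
    rw [hFy] at hp
    obtain ⟨u, hu⟩ := ht i (ec p) (by linarith)
    refine ⟨ec.symm u, ?_⟩
    rw [shift_fderiv _ (hf i).1]; simpa using hu
  have hconn : IsConnected {p | (F 0 p).2.2.2 = 0} := by
    have h1 : F 0 '' {p | (F 0 p).2.2.2 = 0} = iMap 0 '' S₂ := ext fun v => hFC 0 v
    have h2 : IsConnected (iMap 0 '' S₂) := hc2.image _ (by unfold iMap; fun_prop)
    rw [← h1] at h2
    exact ⟨h2.nonempty.of_image, (hFe 0).isInducing.isPreconnected_image.1 h2.isPreconnected⟩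
  have hyc : ∀ i, CDi fun p => (F i p).2.2.2 := fun i => contDiff_snd.comp (contDiff_snd.comp (contDiff_snd.comp (hFl i).s))
  obtain ⟨c, c1, c2, c3, c4⟩ := level_param (fun p => (F 0 p).2.2.2) (hyc 0)
    ((hFD 0).of_isClosed_subset (isClosed_eq (hyc 0).continuous continuous_const) fun p hp => le_of_eq hp) hconn (hreg 0)
  have hc0 : ∀ s, (F 0 (c s)).2.2.2 = 0 := fun s => by
    have : c s ∈ {p | (F 0 p).2.2.2 = 0} := c4 ▸ ⟨s, rfl⟩
    exact this
  obtain ⟨d, d1, d2⟩ := lift_smooth (F 1) (hFl 1).s (hFl 1).i (hFe 1) (fun s => F 0 (c s)) ((hFl 0).s.comp c1) (fun s => by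
    obtain ⟨p, -, hp⟩ := (hFC 1 _).2 ((hFC 0 _).1 ⟨c s, hc0 s, rfl⟩)
    exact ⟨p, hp⟩)
  have hdl : IsLoop d := by
    refine ⟨d1, fun t h => c2 t ?_, fun u v => ?_⟩
    · have h1 := ((hFl 0).s.differentiable (by simp) (c t)).hasFDerivAt.comp_hasDerivAt t (c1.differentiable (by simp) t).hasDerivAt
      have h2 := ((hFl 1).s.differentiable (by simp) (d t)).hasFDerivAt.comp_hasDerivAt t (d1.differentiable (by simp) t).hasDerivAt
      have : F 1 ∘ d = F 0 ∘ c := funext d2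
      rw [this, h, map_zero] at h2
      exact (hFl 0).i (c t) (by rw [map_zero]; exact h1.unique h2)
    · rw [← c3]
      constructor
      · intro h; apply (hFe 0).injective; rw [← d2, ← d2, h]
      · intro h; apply (hFe 1).injective; rw [d2, d2, h]
  obtain ⟨k, k1, k2, k3, k4, ζ, k5, k6⟩ := glue F hFl (fun i => (hFe i).injective) hFD ![c, d] (fun i => by
      fin_cases i
      · exact ⟨c1, c2, c3⟩
      · exact hdl) (fun i p => by
      fin_cases i
      · exact (Set.ext_iff.1 c4 p).symm
      · constructor
        · intro hp
          obtain ⟨q, hq1, hq2⟩ := (hFC 0 _).2 ((hFC 1 _).1 ⟨p, hp, rfl⟩)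
          obtain ⟨s, rfl⟩ : q ∈ range c := by rw [c4]; exact hq1
          exact ⟨s, (hFe 1).injective ((d2 s).trans hq2)⟩
        · rintro ⟨s, rfl⟩
          exact (congrArg (fun v : R4 => v.2.2.2) (d2 s)).trans (hc0 s)) hreg (fun s => (d2 s).symm) (a - ℓ 0) (by linarith)
  let G : R2 → R4 := fun p => k (ec.symm p) + -(w 1)
  have hGy : ∀ p, (G p).2.2.2 = (k (ec.symm p)).2.2.2 + ℓ 1 := fun p => by simp [G, w]
  have hG1 : ∀ p, 0 < (F 1 (ec.symm p)).2.2.2 → G p = f 1 p := fun p hp => by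
    simp only [G, k3 _ hp, F, ContinuousLinearEquiv.apply_symm_apply]; abel
  have hGs : CDi G := shift_smooth k k1.s ec.symm _
  have hGd := shift_fderiv k k1.s ec.symm (-(w 1))
  have hKc : IsCompact (ec '' {p | (F 1 p).2.2.2 ≤ 0}) := (hFD 1).image ec.continuous
  have hGK : ∀ p, p ∉ ec '' {p | (F 1 p).2.2.2 ≤ 0} → G p = f 1 p := fun p hp => hG1 p (by
    by_contra h; exact hp ⟨ec.symm p, not_lt.1 h, by simp⟩)
  have hGp : IsFlatParam G := by
    obtain ⟨K, hK, hK'⟩ := (hf 1).2.2.2.2.2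
    refine ⟨hGs, fun p q h => ec.symm.injective (k2 (add_right_cancel h)), ?_, fun p u v h => ?_, fun p u v => ?_,
      K ∪ ec '' {p | (F 1 p).2.2.2 ≤ 0}, hK.union hKc, fun p hp => ?_⟩
    · rw [isProperMap_iff_tendsto_cocompact]
      refine ⟨hGs.continuous, (isProperMap_iff_tendsto_cocompact.1 (hf 1).2.2.1).2.congr' ?_⟩
      filter_upwards [hKc.compl_mem_cocompact] with p hp using (hGK p hp).symm
    · have h' : fD k (ec.symm p) (ec.symm u) = fD k (ec.symm p) (ec.symm v) := by rw [← hGd, ← hGd]; exact h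
      exact ec.symm.injective (k1.i _ h')
    · have := k1.w (ec.symm p) (ec.symm u) (ec.symm v)
      rw [← hGd, ← hGd] at this; exact this
    · rw [mem_union, not_or] at hp
      rw [hGK p hp.2, hK' p hp.1]
  have hGb : ∀ p, (G p).2.2.2 = b → 0 < (F 1 (ec.symm p)).2.2.2 := fun p hp => by
    by_contra h
    have := k4 _ (not_lt.1 h)
    rw [hGy] at hp; linarith
  refine ⟨range G, a - ℓ 0 + ℓ 1, b, by linarith, hb0, ⟨G, hGp, rfl⟩, ⟨G, hGp, rfl, fun p hp => ?_⟩, ⟨G, hGp, rfl, fun p hp => ?_⟩, ?_, ?_⟩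
  · rw [tv G hGs]
    rw [hGy] at hp
    obtain ⟨q, hq, hq2⟩ := k6 (ec.symm p) (by linarith)
    have h5 := (k5 q hq).2
    rw [hFy] at hq
    obtain ⟨v, hv⟩ := hta (ec q) (by linarith)
    obtain ⟨u, hu⟩ := h5 (ec.symm v)
    refine ⟨ec u, ?_⟩
    have h7 : fD G p (ec u) = fD k (ec.symm p) u := by
      have := hGd p (ec u)
      rwa [ContinuousLinearEquiv.symm_apply_apply] at this
    have h8 : fD (F 0) q (ec.symm v) = fD (f 0) (ec q) v := by
      have := shift_fderiv (f 0) (hf 0).1 ec (w 0) q (ec.symm v)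
      rwa [ContinuousLinearEquiv.apply_symm_apply] at this
    rw [h7, ← hq2, hu, h8]; exact hv
  · rw [tv G hGs]
    have h1 := hGb p hp
    have h2 : G =ᶠ[𝓝 p] f 1 := by
      filter_upwards [(isOpen_lt continuous_const ((hyc 1).continuous.comp ec.symm.continuous)).mem_nhds h1] with q hq using hG1 q hq
    rw [h2.fderiv_eq]
    exact htb p (by rw [← hG1 p h1, hp])
  · ext v
    constructor
    · rintro ⟨⟨p, rfl⟩, hp⟩
      have hp' : (G p).2.2.2 = a - ℓ 0 + ℓ 1 := hp
      rw [hGy] at hp'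
      obtain ⟨q, hq, hq2⟩ := k6 (ec.symm p) (by linarith)
      have h5 := (k5 q hq).1
      rw [hFy] at hq
      obtain ⟨s, h1, h2⟩ := (sl hsa (f 0 (ec q))).1 ⟨⟨_, rfl⟩, by linarith⟩
      refine ⟨s, h1, ?_⟩
      simp only [G, ← hq2, h5, F, ← h2]
      simp [iMap, w]; ring
    · rintro ⟨s, h1, rfl⟩
      obtain ⟨⟨p, h2⟩, h3⟩ := (sl hsa _).2 ⟨s, h1, rfl⟩
      have h4 := (k5 (ec.symm p) (by rw [hFy, ContinuousLinearEquiv.apply_symm_apply, h2, h3])).1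
      refine ⟨⟨ec (ζ (ec.symm p)), ?_⟩, rfl⟩
      simp only [G, ContinuousLinearEquiv.symm_apply_apply, h4, F, ContinuousLinearEquiv.apply_symm_apply, h2]
      simp [iMap, w]; ring
  · rw [← hsb]
    ext v
    constructor
    · rintro ⟨⟨p, rfl⟩, hp⟩
      exact ⟨⟨p, (hG1 p (hGb p hp)).symm⟩, hp⟩
    · rintro ⟨⟨p, rfl⟩, hp⟩
      refine ⟨⟨p, hG1 p ?_⟩, hp⟩
      have hp' : (f 1 p).2.2.2 = b := hp
      rw [hFy, ContinuousLinearEquiv.apply_symm_apply]; linarith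

theorem rel_trans (S₁ S₂ S₃ : Set R3) (hS₂ : S₂.Nonempty) (hS₂c : IsConnected S₂) (h12 : SliceRel S₁ S₂) (h23 : SliceRel S₂ S₃) :
    SliceRel S₁ S₃ := by
  have h12' := h12
  have h23' := h23
  obtain ⟨L, a, b, hab, hb, ⟨f, hf, hfL⟩, ta, tb, sa, sb⟩ := h12'
  obtain ⟨L', a', b', hab', hb', ⟨f', hf', hfL'⟩, ta', tb', sa', sb'⟩ := h23'
  rcases hab.lt_or_eq with h | rfl
  swap
  · rw [(iMap_inj a).image_injective (sa.symm.trans sb)]; exact h23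
  rcases hab'.lt_or_eq with h' | rfl
  swap
  · rw [← (iMap_inj a').image_injective (sa'.symm.trans sb')]; exact h12
  have A := trans_all ta f hf hfL
  have B := trans_all tb f hf hfL
  have A' := trans_all ta' f' hf' hfL'
  have B' := trans_all tb' f' hf' hfL'
  subst hfL; subst hfL'
  refine core S₁ S₂ S₃ hS₂c ![f, f'] (fun i => ?_) ![b, a'] (fun i => ?_) (fun i => ?_) (fun i => ?_) a b' h h' hb' sa sb' A B'
  · fin_cases i
    · exact hf
    · exact hf'
  · fin_cases i
    · exact hb
    · exact h'.trans hb'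
  · fin_cases i
    · exact sb
    · exact sa'
  · fin_cases i
    · exact B
    · exact A'
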